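/- Let N ≥ 1, 2 ≤ p < ∞, 0 < γ < p, λ₊, λ₋ > 0, δ₀ > 0, M > 0 and d > 0 be given. Then there exist α ∈ (0,1) and C₁ > 0, depending only on N, p, γ, λ₊, λ₋, δ₀, M and d, such that: for every open bounded Ω ⊆ ℝ^N, every δ ∈ [0, δ₀], every local minimizer u of J_δ on Ω with sup_Ω |u| ≤ M, and every set Ω' ⊆ Ω with dist(Ω', ∂Ω) ≥ d, one has sup_{x ∈ Ω'} ‖∇u(x)‖ ≤ C₁ and ‖∇u(x) − ∇u(y)‖ ≤ C₁ ‖x − y‖^α for all x, y ∈ Ω'. -/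

import Mathlib

open MeasureTheory Metric Set
open scoped InnerProductSpace

/-- The Alt–Phillips potential `F_γ(t) = λ₊ (t₊)^γ + λ₋ (t₋)^γ`. -/
noncomputable def Fgam (γ lp lm : ℝ) (t : ℝ) : ℝ :=
  lp * (max t 0) ^ γ + lm * (max (-t) 0) ^ γ

/-- `u` is a `C¹(Ω)` function with `∫_Ω ‖∇u‖^p < ∞` which is a local minimizer of the
functional with density `‖∇v‖^p/p + F(v)`, with respect to Lipschitz competitors on
balls compactly contained in `Ω` agreeing with `u` on the boundary sphere. -/
def APLocMin (N : ℕ) (p : ℝ) (F : ℝ → ℝ) (Ω : Set (EuclideanSpace ℝ (Fin N)))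
    (u : EuclideanSpace ℝ (Fin N) → ℝ) : Prop :=
  (∀ x ∈ Ω, DifferentiableAt ℝ u x) ∧
  ContinuousOn (fun x => gradient u x) Ω ∧
  IntegrableOn (fun x => ‖gradient u x‖ ^ p) Ω volume ∧
  ∀ (z : EuclideanSpace ℝ (Fin N)) (r : ℝ), 0 < r → closure (Metric.ball z r) ⊆ Ω →
    ∀ (v : EuclideanSpace ℝ (Fin N) → ℝ) (K : NNReal),
      LipschitzOnWith K v (closure (Metric.ball z r)) →
      Set.EqOn v u (Metric.sphere z r) →
      (∫ x in Metric.ball z r, (‖gradient u x‖ ^ p / p + F (u x))) ≤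
        ∫ x in Metric.ball z r, (‖gradient v x‖ ^ p / p + F (v x))


namespace AP
set_option linter.unusedSectionVars false
open Filter
open scoped Topology Gradient NNReal

section basics
variable {E : Type*} [NormedAddCommGroup E] [InnerProductSpace ℝ E] [FiniteDimensional ℝ E]

def Lip (f : E → ℝ) : Prop := ∃ K : ℝ≥0, LipschitzWith K f

theorem Lip.cont {f : E → ℝ} (h : Lip f) : Continuous f := h.choose_spec.continuous

theorem Lip.mk' {f : E → ℝ} {K : ℝ} (hK : 0 ≤ K) (h : ∀ x y, |f x - f y| ≤ K * ‖x - y‖) : Lip f :=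
  ⟨⟨K, hK⟩, LipschitzWith.of_dist_le_mul fun x y => by
    rw [Real.dist_eq, dist_eq_norm]; exact h x y⟩

theorem Lip.ex {f : E → ℝ} (h : Lip f) : ∃ K : ℝ, 0 ≤ K ∧ (∀ x y, |f x - f y| ≤ K * ‖x - y‖) ∧
    ∀ x, ‖∇ f x‖ ≤ K := by
  obtain ⟨K, hK⟩ := h
  refine ⟨K, K.2, fun x y => ?_, fun x => ?_⟩
  · have := hK.dist_le_mul x y
    rwa [Real.dist_eq, dist_eq_norm] at this
  · rw [gradient, LinearIsometryEquiv.norm_map]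
    exact norm_fderiv_le_of_lipschitz ℝ hK

theorem grad_le {f : E → ℝ} {K : ℝ} (hK : 0 ≤ K) (h : ∀ x y, |f x - f y| ≤ K * ‖x - y‖) (x : E) :
    ‖∇ f x‖ ≤ K := by
  rw [gradient, LinearIsometryEquiv.norm_map]
  have : LipschitzWith ⟨K, hK⟩ f := LipschitzWith.of_dist_le_mul fun x y => by
    rw [Real.dist_eq, dist_eq_norm]; exact h x y
  exact norm_fderiv_le_of_lipschitz ℝ this

theorem Lip.add {f g : E → ℝ} (hf : Lip f) (hg : Lip g) : Lip (fun x => f x + g x) :=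
  ⟨_, hf.choose_spec.add hg.choose_spec⟩
theorem Lip.sub {f g : E → ℝ} (hf : Lip f) (hg : Lip g) : Lip (fun x => f x - g x) :=
  ⟨_, hf.choose_spec.sub hg.choose_spec⟩
theorem Lip.cst (c : ℝ) : Lip (fun _ : E => c) := ⟨0, LipschitzWith.const c⟩
theorem Lip.max {f g : E → ℝ} (hf : Lip f) (hg : Lip g) : Lip (fun x => max (f x) (g x)) :=
  ⟨_, hf.choose_spec.max hg.choose_spec⟩
theorem Lip.min {f g : E → ℝ} (hf : Lip f) (hg : Lip g) : Lip (fun x => min (f x) (g x)) :=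
  ⟨_, hf.choose_spec.min hg.choose_spec⟩
theorem Lip.smul {f : E → ℝ} (c : ℝ) (hf : Lip f) : Lip (fun x => c * f x) := by
  obtain ⟨K, hK, h, -⟩ := hf.ex
  refine Lip.mk' (K := |c| * K) (by positivity) fun x y => ?_
  rw [← mul_sub, abs_mul, mul_assoc]
  exact mul_le_mul_of_nonneg_left (h x y) (abs_nonneg c)
theorem Lip.mul {f g : E → ℝ} (hf : Lip f) (hg : Lip g) {a b : ℝ} (ha : ∀ x, |f x| ≤ a)
    (hb : ∀ x, |g x| ≤ b) : Lip (fun x => f x * g x) := by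
  obtain ⟨K, hK, h, -⟩ := hf.ex
  obtain ⟨K', hK', h', -⟩ := hg.ex
  have ha0 := (abs_nonneg _).trans (ha 0)
  have hb0 := (abs_nonneg _).trans (hb 0)
  refine Lip.mk' (K := K * b + a * K') (by positivity) fun x y => ?_
  have : f x * g x - f y * g y = (f x - f y) * g x + f y * (g x - g y) := by ring
  rw [this, add_mul]
  refine (abs_add_le _ _).trans (add_le_add ?_ ?_)
  · rw [abs_mul]
    calc _ ≤ (K * ‖x - y‖) * b := mul_le_mul (h x y) (hb x) (abs_nonneg _) (by positivity)
      _ = _ := by ring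
  · rw [abs_mul]
    calc _ ≤ a * (K' * ‖x - y‖) := mul_le_mul (ha y) (h' x y) (abs_nonneg _) ha0
      _ = _ := by ring
theorem Lip.tr {f : E → ℝ} (hf : Lip f) (z : E) : Lip (fun x => f (x + z)) := by
  obtain ⟨K, hK, h, -⟩ := hf.ex
  exact Lip.mk' hK fun x y => by simpa using h (x + z) (y + z)
theorem Lip.scale {f : E → ℝ} (hf : Lip f) (y : E) (s : ℝ) : Lip (fun x => f (y + s • x)) := by
  obtain ⟨K, hK, h, -⟩ := hf.ex
  refine Lip.mk' (K := K * |s|) (by positivity) fun x x' => (h _ _).trans_eq ?_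
  rw [add_sub_add_left_eq_sub, ← smul_sub, norm_smul, Real.norm_eq_abs, mul_assoc]

theorem grad_inner (f : E → ℝ) (x z : E) : ⟪∇ f x, z⟫_ℝ = fderiv ℝ f x z := inner_gradient_left

theorem grad_add {f g : E → ℝ} {x : E} (hf : DifferentiableAt ℝ f x) (hg : DifferentiableAt ℝ g x) :
    ∇ (fun y => f y + g y) x = ∇ f x + ∇ g x := by
  simp only [gradient, ← map_add]; congr 1; exact fderiv_add hf hg
theorem grad_sub {f g : E → ℝ} {x : E} (hf : DifferentiableAt ℝ f x) (hg : DifferentiableAt ℝ g x) :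
    ∇ (fun y => f y - g y) x = ∇ f x - ∇ g x := by
  simp only [gradient, ← map_sub]; congr 1; exact fderiv_sub hf hg
theorem grad_smul (c : ℝ) (f : E → ℝ) (x : E) : ∇ (fun y => c * f y) x = c • ∇ f x := by
  have : fderiv ℝ (fun y => c * f y) x = c • fderiv ℝ f x := by
    have := congrFun (fderiv_const_smul_field (𝕜 := ℝ) c (f := f)) x
    exact this
  rw [gradient, this, gradient, map_smulₛₗ]; simp
theorem grad_mul {f g : E → ℝ} {x : E} (hf : DifferentiableAt ℝ f x) (hg : DifferentiableAt ℝ g x) :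
    ∇ (fun y => f y * g y) x = f x • ∇ g x + g x • ∇ f x := by
  have : fderiv ℝ (fun y => f y * g y) x = f x • fderiv ℝ g x + g x • fderiv ℝ f x := fderiv_mul hf hg
  rw [gradient, this, gradient, gradient, map_add, map_smulₛₗ, map_smulₛₗ]; simp
theorem grad_tr (f : E → ℝ) (z x : E) : ∇ (fun y => f (y + z)) x = ∇ f (x + z) := by
  rw [gradient, gradient, fderiv_comp_add_right]
theorem grad_scale (f : E → ℝ) (y : E) (s : ℝ) (x : E) :
    ∇ (fun x => f (y + s • x)) x = s • ∇ f (y + s • x) := by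
  have : fderiv ℝ (fun x => f (y + s • x)) x = s • fderiv ℝ f (y + s • x) := by
    rw [fderiv_comp_smul (f := fun x => f (y + x)), fderiv_comp_add_left]
  rw [gradient, this, gradient, map_smulₛₗ]; simp
theorem grad_min {f : E → ℝ} {x : E} (h : IsLocalMin f x) : ∇ f x = 0 := by
  simp [gradient, h.fderiv_eq_zero]
theorem grad_max {f : E → ℝ} {x : E} (h : IsLocalMax f x) : ∇ f x = 0 := by
  simp [gradient, h.fderiv_eq_zero]

variable [MeasureSpace E] [BorelSpace E]

theorem meas_grad (f : E → ℝ) : Measurable (∇ f) :=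
  ((InnerProductSpace.toDual ℝ E).symm.continuous.measurable).comp (measurable_fderiv ℝ f)

variable [(volume : Measure E).IsAddHaarMeasure]

theorem Lip.ae {f : E → ℝ} (h : Lip f) : ∀ᵐ x : E, DifferentiableAt ℝ f x :=
  h.choose_spec.ae_differentiableAt

theorem ibd {f : E → ℝ} (hf : Measurable f) {C : ℝ} (h : ∀ x, |f x| ≤ C) (y : E) (r : ℝ) :
    IntegrableOn f (ball y r) :=
  Measure.integrableOn_of_bounded measure_ball_lt_top.ne hf.aestronglyMeasurable
    (Eventually.of_forall h)

theorem ae_tr {P : E → Prop} (h : ∀ᵐ x : E, P x) (z : E) : ∀ᵐ x : E, P (x + z) :=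
  (measurePreserving_add_right volume z).quasiMeasurePreserving.ae h

theorem int_tr_le {F : E → ℝ} (hF : Measurable F) {C : ℝ} (h : ∀ x, |F x| ≤ C) (h0 : ∀ x, 0 ≤ F x)
    {r R : ℝ} {z : E} (hz : r + ‖z‖ ≤ R) : ∫ x in ball 0 r, F (x + z) ≤ ∫ x in ball 0 R, F x := by
  have e : (fun x => x + z) ⁻¹' (ball z r) = ball 0 r := by
    ext x; simp [dist_eq_norm]
  have := (measurePreserving_add_right (volume : Measure E) z).setIntegral_preimage_emb
    (MeasurableEquiv.addRight z).measurableEmbedding F (ball z r)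
  rw [e] at this
  rw [this]
  refine setIntegral_mono_set (ibd hF h 0 R) (Eventually.of_forall h0) (LE.le.eventuallyLE ?_)
  intro x hx
  rw [mem_ball, dist_eq_norm] at hx
  rw [mem_ball_zero_iff]
  have := norm_add_le (x - z) z
  rw [sub_add_cancel] at this; linarith

theorem diffq {f : E → ℝ} {x : E} (h : DifferentiableAt ℝ f x) (z : E) :
    Tendsto (fun m : ℕ => ((m : ℝ) + 1) * (f (x + ((m : ℝ) + 1)⁻¹ • z) - f x)) atTop
      (𝓝 ⟪∇ f x, z⟫_ℝ) := by
  rw [grad_inner]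
  have h1 := h.hasFDerivAt.hasLineDerivAt z
  have h2 : Tendsto (fun m : ℕ => ((m : ℝ) + 1)⁻¹) atTop (𝓝[≠] 0) := by
    refine tendsto_nhdsWithin_iff.2 ⟨?_, Eventually.of_forall fun m => ?_⟩
    · simpa only [one_div] using tendsto_one_div_add_atTop_nhds_zero_nat (𝕜 := ℝ)
    · simp only [mem_compl_iff, mem_singleton_iff]; positivity
  have h3 := (h1.tendsto_slope_zero).comp h2
  refine h3.congr fun m => ?_
  simp [smul_eq_mul]

/-- translation estimate -/
theorem trans_est {f : E → ℝ} (hf : Lip f) {q : ℝ} (hq : 1 ≤ q) {r R : ℝ} (z : E)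
    (hR : r + ‖z‖ ≤ R) : ∫ x in ball 0 r, |f (x + z) - f x| ^ q ≤
      ‖z‖ ^ q * ∫ x in ball (0 : E) R, ‖∇ f x‖ ^ q := by
  obtain ⟨K, hK, hl, hg⟩ := hf.ex
  have q0 : 0 ≤ q := by linarith
  have mf : ∀ z : E, Measurable fun x => |f (x + z) - f x| ^ q := fun z =>
    (((hf.tr z).sub hf).cont.measurable.norm.pow_const q)
  have bf : ∀ z x : E, |(|f (x + z) - f x| ^ q)| ≤ (K * ‖z‖) ^ q := fun z x => by
    rw [abs_of_nonneg (by positivity)]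
    exact Real.rpow_le_rpow (abs_nonneg _) (by simpa using hl (x + z) x) q0
  -- step bound
  have key : ∀ m : ℕ, ∫ x in ball 0 r, |f (x + z) - f x| ^ q ≤
      ∫ x in ball (0 : E) R, |((m : ℝ) + 1) * (f (x + ((m : ℝ) + 1)⁻¹ • z) - f x)| ^ q := by
    intro m
    set M : ℝ := (m : ℝ) + 1 with hM
    have M0 : 0 < M := by positivity
    set w : E := M⁻¹ • z with hw
    have hp : ∀ x, |f (x + z) - f x| ^ q ≤
        M ^ (q - 1) * ∑ j ∈ Finset.range (m + 1), |f (x + (j : ℝ) • w + w) - f (x + (j : ℝ) • w)| ^ q := by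
      intro x
      have h1 : f (x + z) - f x = ∑ j ∈ Finset.range (m + 1),
          (f (x + (j : ℝ) • w + w) - f (x + (j : ℝ) • w)) := by
        have := Finset.sum_range_sub (fun j : ℕ => f (x + (j : ℝ) • w)) (m + 1)
        have e1 : ((m + 1 : ℕ) : ℝ) • w = z := by
          rw [hw, smul_smul]; push_cast; rw [← hM, mul_inv_cancel₀ M0.ne', one_smul]
        rw [e1] at this
        simp only [Nat.cast_zero, zero_smul, add_zero] at this
        rw [← this]
        refine Finset.sum_congr rfl fun j _ => ?_
        rw [Nat.cast_succ, add_smul, one_smul, add_assoc]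
      rw [h1]
      refine (Real.rpow_le_rpow (abs_nonneg _) (Finset.abs_sum_le_sum_abs _ _) q0).trans ?_
      refine (Real.rpow_sum_le_const_mul_sum_rpow _ _ hq).trans_eq ?_
      simp [hM]
    have hi : ∀ j : ℕ, IntegrableOn (fun x => |f (x + (j : ℝ) • w + w) - f (x + (j : ℝ) • w)| ^ q)
        (ball (0 : E) r) := fun j =>
      ibd ((mf w).comp (measurable_add_const _)) (fun x => bf w _) 0 r
    calc ∫ x in ball 0 r, |f (x + z) - f x| ^ q
        ≤ ∫ x in ball 0 r, M ^ (q - 1) * ∑ j ∈ Finset.range (m + 1),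
            |f (x + (j : ℝ) • w + w) - f (x + (j : ℝ) • w)| ^ q :=
          setIntegral_mono (ibd (mf z) (bf z) 0 r)
            ((integrable_finsetSum _ fun j _ => hi j).const_mul _) hp
      _ = M ^ (q - 1) * ∑ j ∈ Finset.range (m + 1), ∫ x in ball 0 r,
            |f (x + (j : ℝ) • w + w) - f (x + (j : ℝ) • w)| ^ q := by
          rw [integral_const_mul, integral_finsetSum _ fun j _ => hi j]
      _ ≤ M ^ (q - 1) * ∑ j ∈ Finset.range (m + 1), ∫ x in ball (0 : E) R, |f (x + w) - f x| ^ q := by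
          refine mul_le_mul_of_nonneg_left (Finset.sum_le_sum fun j hj => ?_) (by positivity)
          refine int_tr_le (mf w) (bf w) (fun x => by positivity) (le_trans ?_ hR)
          rw [hw, norm_smul, norm_smul, norm_inv, Real.norm_of_nonneg M0.le, Real.norm_of_nonneg (by positivity)]
          have : (j : ℝ) ≤ M := by
            have := Finset.mem_range.1 hj
            rw [hM]; exact_mod_cast this.le
          have h2 : (j : ℝ) * (M⁻¹ * ‖z‖) ≤ ‖z‖ := by
            rw [← mul_assoc]
            exact mul_le_of_le_one_left (norm_nonneg z) (by rw [← div_eq_mul_inv]; exact (div_le_one M0).2 this)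
          linarith
      _ = ∫ x in ball (0 : E) R, |M * (f (x + w) - f x)| ^ q := by
          rw [Finset.sum_const, Finset.card_range, nsmul_eq_mul, ← mul_assoc, ← integral_const_mul]
          congr 1; ext x
          rw [abs_mul, abs_of_pos M0, Real.mul_rpow M0.le (abs_nonneg _)]
          congr 1
          push_cast; rw [← hM, ← Real.rpow_add_one M0.ne']; congr 1; ring
  have lim : Tendsto (fun m : ℕ => ∫ x in ball (0 : E) R,
      |((m : ℝ) + 1) * (f (x + ((m : ℝ) + 1)⁻¹ • z) - f x)| ^ q) atTop
      (𝓝 (∫ x in ball (0 : E) R, |⟪∇ f x, z⟫_ℝ| ^ q)) := by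
    refine tendsto_integral_of_dominated_convergence (fun _ => (K * ‖z‖) ^ q) ?_ ?_ ?_ ?_
    · intro m
      exact ((((hf.tr _).sub hf).cont.measurable.const_mul _).norm.pow_const q).aestronglyMeasurable
    · exact integrableOn_const measure_ball_lt_top.ne
    · intro m
      refine Eventually.of_forall fun x => ?_
      rw [Real.norm_of_nonneg (by positivity)]
      refine Real.rpow_le_rpow (abs_nonneg _) ?_ q0
      have M0 : (0 : ℝ) < (m : ℝ) + 1 := by positivity
      have := hl (x + ((m : ℝ) + 1)⁻¹ • z) x
      rw [add_sub_cancel_left, norm_smul, norm_inv, Real.norm_of_nonneg M0.le] at this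
      rw [abs_mul, abs_of_pos M0]
      calc _ ≤ ((m : ℝ) + 1) * (K * (((m : ℝ) + 1)⁻¹ * ‖z‖)) := by gcongr
        _ = _ := by field_simp
    · refine ae_restrict_of_ae (hf.ae.mono fun x hx => ?_)
      exact ((diffq hx z).abs).rpow_const (Or.inr q0)
  refine (ge_of_tendsto lim (Eventually.of_forall key)).trans ?_
  rw [← integral_const_mul]
  refine setIntegral_mono (ibd (C := (K * ‖z‖) ^ q) ?_ ?_ 0 R) (ibd (C := ‖z‖ ^ q * K ^ q) ?_ ?_ 0 R) ?_
  · exact (Measurable.inner (𝕜 := ℝ) (meas_grad f) measurable_const).norm.pow_const q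
  · intro x
    rw [abs_of_nonneg (by positivity)]
    exact Real.rpow_le_rpow (abs_nonneg _) ((abs_real_inner_le_norm _ _).trans
      (mul_le_mul_of_nonneg_right (hg x) (norm_nonneg z))) q0
  · exact ((meas_grad f).norm.pow_const q).const_mul _
  · intro x
    rw [abs_of_nonneg (by positivity)]
    exact mul_le_mul_of_nonneg_left (Real.rpow_le_rpow (norm_nonneg _) (hg x) q0) (by positivity)
  · intro x
    simp only
    rw [← Real.mul_rpow (norm_nonneg _) (norm_nonneg _)]
    refine Real.rpow_le_rpow (abs_nonneg _) ?_ q0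
    rw [mul_comm]; exact abs_real_inner_le_norm _ _


/-! algebra -/
theorem bern {q x y : ℝ} (hq : 1 ≤ q) (hx : 0 ≤ x) (hy : 0 ≤ y) :
    x ^ q + q * x ^ (q - 1) * (y - x) ≤ y ^ q := by
  rcases hx.eq_or_lt with rfl | hx
  · rcases hq.eq_or_lt with rfl | hq
    · simp
    · rw [Real.zero_rpow (by linarith), Real.zero_rpow (by linarith)]; simp; positivity
  · have h1 := one_add_mul_self_le_rpow_one_add (s := y / x - 1) (p := q)
      (by have : 0 ≤ y / x := by positivity
          linarith) hq
    rw [add_sub_cancel, Real.div_rpow hy hx.le, le_div_iff₀ (by positivity)] at h1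
    refine le_of_eq_of_le ?_ h1
    rw [Real.rpow_sub_one hx.ne']; field_simp

noncomputable def Aop (p ε : ℝ) (ξ : E) : E := (‖ξ‖ ^ (p - 2) + ε) • ξ
noncomputable def Gf (p ε : ℝ) (ξ : E) : ℝ := ‖ξ‖ ^ p / p + ε / 2 * ‖ξ‖ ^ 2

theorem rp2 {p x : ℝ} (hp : 2 ≤ p) (hx : 0 ≤ x) : x ^ (p - 2) * x ^ 2 = x ^ p := by
  rcases hx.eq_or_lt with rfl | hx
  · rw [Real.zero_rpow (by linarith : p ≠ 0)]; simp
  · rw [← Real.rpow_natCast, ← Real.rpow_add hx]; congr 1; push_cast; ring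
theorem rp1 {p x : ℝ} (hp : 2 ≤ p) (hx : 0 ≤ x) : x ^ (p - 2) * x = x ^ (p - 1) := by
  rcases hx.eq_or_lt with rfl | hx
  · rw [Real.zero_rpow (by linarith : p - 1 ≠ 0)]; simp
  · rw [← Real.rpow_add_one hx.ne']; congr 1; ring

theorem alg1 {p ε : ℝ} (hp : 2 ≤ p) (hε : 0 ≤ ε) (ξ ζ : E) :
    (‖ξ‖ ^ (p - 2) + ‖ζ‖ ^ (p - 2) + ε) * ‖ξ - ζ‖ ^ 2 ≤ 2 * ⟪Aop p ε ξ - Aop p ε ζ, ξ - ζ⟫_ℝ := by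
  have h : 0 ≤ (‖ξ‖ ^ (p - 2) - ‖ζ‖ ^ (p - 2)) * (‖ξ‖ ^ 2 - ‖ζ‖ ^ 2) := by
    rcases le_total ‖ξ‖ ‖ζ‖ with h | h
    · exact mul_nonneg_of_nonpos_of_nonpos
        (by have := Real.rpow_le_rpow (norm_nonneg _) h (by linarith : 0 ≤ p - 2); linarith)
        (by have := pow_le_pow_left₀ (norm_nonneg _) h 2; linarith)
    · exact mul_nonneg
        (by have := Real.rpow_le_rpow (norm_nonneg _) h (by linarith : 0 ≤ p - 2); linarith)
        (by have := pow_le_pow_left₀ (norm_nonneg _) h 2; linarith)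
  have h0 := mul_nonneg hε (sq_nonneg ‖ξ - ζ‖)
  simp only [Aop, inner_sub_left, inner_sub_right, inner_smul_left, real_inner_self_eq_norm_sq,
    RCLike.conj_to_real, real_inner_comm ξ ζ, norm_sub_sq_real] at *
  nlinarith [h, h0]

theorem alg2 {p ε : ℝ} (hp : 2 ≤ p) (hε : 0 ≤ ε) (ξ ζ : E) :
    ‖Aop p ε ξ - Aop p ε ζ‖ ≤ p * (‖ξ‖ ^ (p - 2) + ‖ζ‖ ^ (p - 2) + ε) * ‖ξ - ζ‖ := by
  wlog h : ‖ζ‖ ≤ ‖ξ‖ generalizing ξ ζ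
  · have := this ζ ξ (by linarith)
    rwa [norm_sub_rev, norm_sub_rev ζ ξ, add_comm (‖ζ‖ ^ (p - 2))] at this
  have e : Aop p ε ξ - Aop p ε ζ = (‖ξ‖ ^ (p - 2) + ε) • (ξ - ζ) + (‖ξ‖ ^ (p - 2) - ‖ζ‖ ^ (p - 2)) • ζ := by
    simp only [Aop]; module
  have hm := Real.rpow_le_rpow (norm_nonneg _) h (by linarith : 0 ≤ p - 2)
  have ha : 0 ≤ ‖ξ‖ ^ (p - 2) := by positivity
  have hb : 0 ≤ ‖ζ‖ ^ (p - 2) := by positivity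
  rw [e]
  refine (norm_add_le _ _).trans ?_
  rw [norm_smul, norm_smul, Real.norm_of_nonneg (by positivity), Real.norm_of_nonneg (by linarith)]
  have b := bern (q := p - 1) (by linarith) (norm_nonneg ξ) (norm_nonneg ζ)
  rw [← rp1 hp (norm_nonneg _), ← rp1 hp (norm_nonneg _), show p - 1 - 1 = p - 2 by ring] at b
  have t := norm_sub_norm_le ξ ζ
  have : (‖ξ‖ ^ (p - 2) - ‖ζ‖ ^ (p - 2)) * ‖ζ‖ ≤ (p - 2) * ‖ξ‖ ^ (p - 2) * (‖ξ‖ - ‖ζ‖) := by nlinarith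
  have t2 := mul_le_mul_of_nonneg_left t (mul_nonneg (by linarith : 0 ≤ p - 2) ha)
  have n0 := norm_nonneg (ξ - ζ)
  have : 0 ≤ ‖ξ - ζ‖ * ((p - 1) * ε + ‖ξ‖ ^ (p - 2) + p * ‖ζ‖ ^ (p - 2)) := by
    have : 0 ≤ p - 1 := by linarith
    positivity
  nlinarith

theorem alg3 {p ε : ℝ} (hp : 2 ≤ p) (ξ ζ : E) :
    Gf p ε ζ + ⟪Aop p ε ζ, ξ - ζ⟫_ℝ + ε / 2 * ‖ξ - ζ‖ ^ 2 ≤ Gf p ε ξ := by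
  have b := bern (q := p) (by linarith) (norm_nonneg ζ) (norm_nonneg ξ)
  rw [← rp1 hp (norm_nonneg _)] at b
  have c := real_inner_le_norm ζ ξ
  have c2 := mul_le_mul_of_nonneg_left c (by positivity : 0 ≤ ‖ζ‖ ^ (p - 2))
  have b2 : ‖ζ‖ ^ p / p + ‖ζ‖ ^ (p - 2) * ‖ζ‖ * (‖ξ‖ - ‖ζ‖) ≤ ‖ξ‖ ^ p / p := by
    rw [← sub_nonneg] at b ⊢
    have := div_nonneg b (by linarith : 0 ≤ p)
    refine this.trans_eq ?_
    field_simp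
  simp only [Gf, Aop, inner_sub_right, inner_smul_left, real_inner_self_eq_norm_sq,
    RCLike.conj_to_real, norm_sub_sq_real, real_inner_comm ξ ζ] at *
  nlinarith

theorem alg4 {p : ℝ} (hp : 2 ≤ p) : ∃ c : ℝ, 0 < c ∧ ∀ (ε : ℝ), 0 ≤ ε → ∀ (ξ ζ : E),
    Gf p ε ζ + ⟪Aop p ε ζ, ξ - ζ⟫_ℝ + c * ‖ξ - ζ‖ ^ p ≤ Gf p ε ξ := by
  refine ⟨1 / 2 * (1 / 2) ^ (p - 2) * (1 / 2) ^ p, by positivity, fun ε hε ξ ζ => ?_⟩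
  set m : E := (1 / 2 : ℝ) • (ξ + ζ) with hm
  have e1 : ξ - m = (1 / 2 : ℝ) • (ξ - ζ) := by rw [hm]; module
  have e2 : m - ζ = (1 / 2 : ℝ) • (ξ - ζ) := by rw [hm]; module
  have h1 := alg3 (ε := ε) hp ξ m
  have h2 := alg3 (ε := ε) hp m ζ
  have h3 := alg1 hp hε m ζ
  have k1 : 0 ≤ ε / 2 * ‖ξ - m‖ ^ 2 := by positivity
  have k2 : 0 ≤ ε / 2 * ‖m - ζ‖ ^ 2 := by positivity
  have k3 : 0 ≤ ε * ‖m - ζ‖ ^ 2 := by positivity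
  have k4 : ‖m - ζ‖ ^ (p - 2) ≤ 2 ^ (p - 2) * (‖m‖ ^ (p - 2) + ‖ζ‖ ^ (p - 2)) := by
    have p2 : 0 ≤ p - 2 := by linarith
    have a1 : 0 ≤ ‖m‖ ^ (p - 2) := by positivity
    have a2 : 0 ≤ ‖ζ‖ ^ (p - 2) := by positivity
    rcases le_total ‖m‖ ‖ζ‖ with h | h
    · calc _ ≤ (2 * ‖ζ‖) ^ (p - 2) := Real.rpow_le_rpow (norm_nonneg _)
            ((norm_sub_le _ _).trans (by linarith)) p2
        _ ≤ _ := by rw [Real.mul_rpow (by norm_num) (norm_nonneg _)]; gcongr; linarith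
    · calc _ ≤ (2 * ‖m‖) ^ (p - 2) := Real.rpow_le_rpow (norm_nonneg _)
            ((norm_sub_le _ _).trans (by linarith)) p2
        _ ≤ _ := by rw [Real.mul_rpow (by norm_num) (norm_nonneg _)]; gcongr; linarith
  have k5 : 1 / 2 * (1 / 2) ^ (p - 2) * (1 / 2) ^ p * ‖ξ - ζ‖ ^ p ≤
      1 / 2 * ((‖m‖ ^ (p - 2) + ‖ζ‖ ^ (p - 2)) * ‖m - ζ‖ ^ 2) := by
    have : (1 / 2 : ℝ) ^ p * ‖ξ - ζ‖ ^ p = ‖m - ζ‖ ^ (p - 2) * ‖m - ζ‖ ^ 2 := by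
      rw [rp2 hp (norm_nonneg _), e2, norm_smul, Real.mul_rpow (by positivity) (by positivity)]
      norm_num
    rw [mul_assoc, this, mul_assoc, ← mul_assoc ((1 / 2 : ℝ) ^ (p - 2))]
    gcongr
    calc (1 / 2 : ℝ) ^ (p - 2) * ‖m - ζ‖ ^ (p - 2)
        ≤ (1 / 2 : ℝ) ^ (p - 2) * (2 ^ (p - 2) * (‖m‖ ^ (p - 2) + ‖ζ‖ ^ (p - 2))) := by gcongr
      _ = _ := by
        rw [← mul_assoc, ← Real.mul_rpow (by norm_num) (by norm_num)]; norm_num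
  have e3 : ⟪Aop p ε m, ξ - m⟫_ℝ + ⟪Aop p ε ζ, m - ζ⟫_ℝ =
      ⟪Aop p ε m - Aop p ε ζ, m - ζ⟫_ℝ + ⟪Aop p ε ζ, ξ - ζ⟫_ℝ := by
    rw [e1, e2]; simp only [inner_sub_left, inner_smul_right]; ring
  nlinarith

theorem cont_A {p ε : ℝ} (hp : 2 ≤ p) : Continuous (Aop p ε : E → E) := by
  unfold Aop
  exact ((continuous_norm.rpow_const fun x => Or.inr (by linarith)).add continuous_const).smul continuous_id
theorem cont_G {p ε : ℝ} (hp : 2 ≤ p) : Continuous (Gf p ε : E → ℝ) := by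
  unfold Gf
  exact ((continuous_norm.rpow_const fun x => Or.inr (by linarith)).div_const _).add
    (continuous_const.mul (continuous_norm.pow 2))
theorem A_le {p ε K : ℝ} (hp : 2 ≤ p) (hε : 0 ≤ ε) {ξ : E} (h : ‖ξ‖ ≤ K) :
    ‖Aop p ε ξ‖ ≤ (K ^ (p - 2) + ε) * K := by
  rw [Aop, norm_smul, Real.norm_of_nonneg (by positivity)]
  have := (norm_nonneg _).trans h
  have := Real.rpow_le_rpow (norm_nonneg _) h (by linarith : 0 ≤ p - 2)
  gcongr
theorem G_nonneg {p ε : ℝ} (hp : 2 ≤ p) (hε : 0 ≤ ε) (ξ : E) : 0 ≤ Gf p ε ξ := by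
  unfold Gf; positivity
theorem G_le {p ε K : ℝ} (hp : 2 ≤ p) (hε : 0 ≤ ε) {ξ : E} (h : ‖ξ‖ ≤ K) :
    |Gf p ε ξ| ≤ K ^ p / p + ε / 2 * K ^ 2 := by
  rw [abs_of_nonneg (G_nonneg hp hε ξ), Gf]
  gcongr

end basics
end AP

namespace AP
set_option linter.unusedSectionVars false
open Filter
open scoped Topology Gradient NNReal
section exist
variable {E : Type*} [NormedAddCommGroup E] [InnerProductSpace ℝ E] [FiniteDimensional ℝ E]
  [MeasureSpace E] [BorelSpace E] [(volume : Measure E).IsAddHaarMeasure] [Nontrivial E]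

def LipK (K : ℝ) (f : E → ℝ) : Prop := ∀ x y, |f x - f y| ≤ K * ‖x - y‖
def Xs (K : ℝ) (g : E → ℝ) : Set (E → ℝ) := {v | LipK K v ∧ ∀ x, x ∉ ball (0 : E) 1 → v x = g x}
noncomputable def En (p ε : ℝ) (v : E → ℝ) : ℝ := ∫ x in ball (0 : E) 1, Gf p ε (∇ v x)

theorem LipK.nn {K : ℝ} {f : E → ℝ} (h : LipK K f) : 0 ≤ K := by
  obtain ⟨x, hx⟩ := exists_ne (0 : E)
  have := (abs_nonneg _).trans (h x 0)
  rw [sub_zero] at this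
  exact nonneg_of_mul_nonneg_left this (norm_pos_iff.2 hx)
theorem LipK.lip {K : ℝ} {f : E → ℝ} (h : LipK K f) : Lip f := Lip.mk' h.nn h
theorem LipK.gr {K : ℝ} {f : E → ℝ} (h : LipK K f) (x : E) : ‖∇ f x‖ ≤ K := grad_le h.nn h x

theorem grad_off {f : E → ℝ} (h0 : ∀ x, x ∉ ball (0 : E) 1 → f x = 0) :
    ∀ᵐ x : E, x ∉ ball (0 : E) 1 → ∇ f x = 0 := by
  have h1 : ∀ᵐ x : E, x ∉ sphere (0 : E) 1 := measure_eq_zero_iff_ae_notMem.1 (Measure.addHaar_sphere volume 0 1)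
  filter_upwards [h1] with x hx hb
  refine grad_min ?_
  have : x ∈ (closedBall (0 : E) 1)ᶜ := by
    simp only [mem_sphere, mem_ball, mem_compl_iff, mem_closedBall, not_le, not_lt] at *
    exact lt_of_le_of_ne hb (Ne.symm hx)
  filter_upwards [isClosed_closedBall.isOpen_compl.mem_nhds this] with y hy
  rw [h0 x hb, h0 y fun h => hy (ball_subset_closedBall h)]

theorem int_off {F : E → ℝ} (h0 : ∀ᵐ x : E, x ∉ ball (0 : E) 1 → F x = 0) {R : ℝ} (hR : 1 ≤ R) :
    ∫ x in ball (0 : E) R, F x = ∫ x in ball (0 : E) 1, F x := by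
  refine setIntegral_eq_of_subset_of_ae_sdiff_eq_zero measurableSet_ball.nullMeasurableSet (ball_subset_ball hR) ?_
  filter_upwards [h0] with x hx hxx using hx hxx.2

theorem poin {f : E → ℝ} (hf : Lip f) (h0 : ∀ x, x ∉ ball (0 : E) 1 → f x = 0) {q : ℝ} (hq : 1 ≤ q) :
    ∫ x in ball (0 : E) 1, |f x| ^ q ≤ 2 ^ q * ∫ x in ball (0 : E) 1, ‖∇ f x‖ ^ q := by
  obtain ⟨e, he⟩ := exists_norm_eq E (by norm_num : (0 : ℝ) ≤ 2)
  have h1 := trans_est hf hq (r := 1) (R := 3) e (by rw [he]; norm_num)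
  rw [he, int_off (F := fun x => ‖∇ f x‖ ^ q) ?_ (by norm_num)] at h1
  · refine le_trans (le_of_eq ?_) h1
    refine setIntegral_congr_fun measurableSet_ball fun x hx => ?_
    rw [h0 (x + e), zero_sub, abs_neg]
    simp only [mem_ball_zero_iff, not_lt] at *
    have := norm_sub_norm_le e (-x)
    rw [norm_neg, sub_neg_eq_add, add_comm e] at this; linarith
  · filter_upwards [grad_off h0] with x hx hb
    rw [hx hb, norm_zero, Real.zero_rpow (by linarith)]

theorem int_grad_zero {f : E → ℝ} (hf : Lip f) (h0 : ∀ x, x ∉ ball (0 : E) 1 → f x = 0) (c : E) :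
    ∫ x in ball (0 : E) 1, ⟪c, ∇ f x⟫_ℝ = 0 := by
  have hc : HasCompactSupport f := HasCompactSupport.intro (isCompact_closedBall (0 : E) 1) fun x hx =>
    h0 x fun h => hx (ball_subset_closedBall h)
  have h1 := LipschitzWith.integral_lineDeriv_mul_eq (μ := (volume : Measure E)) (LipschitzWith.const (1 : ℝ))
    hf.choose_spec hc (-c)
  have h2 : ∀ x : E, lineDeriv ℝ (fun _ : E => (1 : ℝ)) x (-c) = 0 := fun x => by simp [lineDeriv]
  simp only [h2, zero_mul, integral_zero, neg_neg, mul_one] at h1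
  rw [h1, setIntegral_eq_integral_of_ae_compl_eq_zero]
  · refine integral_congr_ae ?_
    filter_upwards [hf.ae] with x hx
    rw [hx.lineDeriv_eq_fderiv, real_inner_comm, grad_inner]
  · filter_upwards [grad_off h0] with x hx hb
    rw [hx hb, inner_zero_right]

theorem sq_int {f : E → ℝ} (hf : Continuous f) (h0 : ∀ x, x ∉ ball (0 : E) 1 → f x = 0) :
    Integrable fun x => |f x| ^ 2 := by
  refine (hf.abs.pow 2).integrable_of_hasCompactSupport
    (HasCompactSupport.intro (isCompact_closedBall (0 : E) 1) fun x hx => ?_)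
  have := h0 x fun h => hx (ball_subset_closedBall h)
  simp [this]

theorem zero_of_grad {f : E → ℝ} (hf : Lip f) (h0 : ∀ x, x ∉ ball (0 : E) 1 → f x = 0)
    (h : ∫ x in ball (0 : E) 1, ‖∇ f x‖ ^ 2 ≤ 0) (x : E) : f x = 0 := by
  obtain ⟨K, hK, hl, hg⟩ := hf.ex
  have h1 := poin hf h0 (q := 2) (by norm_num)
  simp only [Real.rpow_two] at h1
  have h2 : ∫ x in ball (0 : E) 1, |f x| ^ 2 ≤ 0 := by linarith
  have h3 : ∫ x, |f x| ^ 2 ≤ 0 := by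
    rwa [setIntegral_eq_integral_of_forall_compl_eq_zero fun x hx => by rw [h0 x hx]; simp] at h2
  have h4 : (fun x => |f x| ^ 2) = 0 := by
    have c : Continuous fun x => |f x| ^ 2 := hf.cont.abs.pow 2
    have hi : Integrable fun x => |f x| ^ 2 := sq_int hf.cont h0
    have := (integral_eq_zero_iff_of_nonneg (fun x => by positivity) hi).1
      (le_antisymm h3 (integral_nonneg fun x => by positivity))
    exact (Continuous.ae_eq_iff_eq volume c continuous_const).1 this
  have := congrFun h4 x
  simpa using this

variable {p ε : ℝ}

theorem intG (hp : 2 ≤ p) (hε : 0 ≤ ε) {v : E → ℝ} {K : ℝ} (hv : LipK K v) (y : E) (r : ℝ) :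
    IntegrableOn (fun x => Gf p ε (∇ v x)) (ball y r) :=
  ibd ((cont_G hp).measurable.comp (meas_grad v)) (fun x => G_le hp hε (hv.gr x)) y r

theorem meas_sq (u v : E → ℝ) : Measurable fun x => ‖∇ u x - ∇ v x‖ ^ 2 :=
  ((meas_grad u).sub (meas_grad v)).norm.pow_const 2

theorem int_sq {u v : E → ℝ} {K L : ℝ} (hu : LipK K u) (hv : LipK L v) (y : E) (r : ℝ) :
    IntegrableOn (fun x => ‖∇ u x - ∇ v x‖ ^ 2) (ball y r) :=
  ibd (meas_sq u v) (C := (K + L) ^ 2) (fun x => by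
    rw [abs_of_nonneg (by positivity)]
    gcongr
    exact (norm_sub_le _ _).trans (add_le_add (hu.gr x) (hv.gr x))) y r

theorem mid_mem {K : ℝ} {g u v : E → ℝ} (hu : u ∈ Xs K g) (hv : v ∈ Xs K g) :
    (fun x => (1 / 2) * (u x + v x)) ∈ Xs K g := by
  refine ⟨fun x y => ?_, fun x hx => by simp only [hu.2 x hx, hv.2 x hx]; ring⟩
  have h1 := abs_le.1 (hu.1 x y); have h2 := abs_le.1 (hv.1 x y)
  exact abs_le.2 ⟨by linarith, by linarith⟩

theorem strong (hp : 2 ≤ p) (hε : 0 ≤ ε) {K : ℝ} {g u v : E → ℝ} (hu : u ∈ Xs K g) (hv : v ∈ Xs K g) :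
    2 * En p ε (fun x => (1 / 2) * (u x + v x)) + ε / 4 * ∫ x in ball (0 : E) 1, ‖∇ u x - ∇ v x‖ ^ 2 ≤
      En p ε u + En p ε v := by
  unfold En
  rw [← integral_const_mul, ← integral_const_mul, ← integral_add, ← integral_add]
  · refine setIntegral_mono_ae (((intG hp hε (mid_mem hu hv).1 0 1).const_mul 2).add ((int_sq hu.1 hv.1 0 1).const_mul _))
      ((intG hp hε hu.1 0 1).add (intG hp hε hv.1 0 1)) ?_
    filter_upwards [hu.1.lip.ae, hv.1.lip.ae] with x hx hy
    rw [grad_smul, grad_add hx hy]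
    set m := (1 / 2 : ℝ) • (∇ u x + ∇ v x) with hm
    have e1 : ∇ u x - m = (1 / 2 : ℝ) • (∇ u x - ∇ v x) := by rw [hm]; module
    have e2 : ∇ v x - m = (-1 / 2 : ℝ) • (∇ u x - ∇ v x) := by rw [hm]; module
    have h1 := alg3 (ε := ε) hp (∇ u x) m
    have h2 := alg3 (ε := ε) hp (∇ v x) m
    rw [e1, inner_smul_right, norm_smul] at h1
    rw [e2, inner_smul_right, norm_smul] at h2
    norm_num at h1 h2
    nlinarith
  · exact intG hp hε hu.1 0 1
  · exact intG hp hε hv.1 0 1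
  · exact (intG hp hε (mid_mem hu hv).1 0 1).const_mul 2
  · exact (int_sq hu.1 hv.1 0 1).const_mul _

def IsMin (p ε K : ℝ) (g u : E → ℝ) : Prop := u ∈ Xs K g ∧ ∀ v ∈ Xs K g, En p ε u ≤ En p ε v

theorem gsub_sq {u v : E → ℝ} (hu : Lip u) (hv : Lip v) :
    ∫ x in ball (0 : E) 1, ‖∇ (fun x => u x - v x) x‖ ^ 2 = ∫ x in ball (0 : E) 1, ‖∇ u x - ∇ v x‖ ^ 2 := by
  refine integral_congr_ae (ae_restrict_of_ae ?_)
  filter_upwards [hu.ae, hv.ae] with x hx hy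
  rw [grad_sub hx hy]

theorem min_unique (hp : 2 ≤ p) (hε : 0 < ε) {K : ℝ} {g u v : E → ℝ} (hu : IsMin p ε K g u)
    (hv : v ∈ Xs K g) (h : En p ε v ≤ En p ε u) (x : E) : u x = v x := by
  have h1 := strong hp hε.le hu.1 hv
  have h2 := hu.2 _ (mid_mem hu.1 hv)
  have h3 : ∫ x in ball (0 : E) 1, ‖∇ u x - ∇ v x‖ ^ 2 ≤ 0 := by
    by_contra! h3
    have := mul_pos (by positivity : 0 < ε / 4) h3
    linarith
  rw [← gsub_sq hu.1.1.lip hv.1.lip] at h3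
  have := zero_of_grad (hu.1.1.lip.sub hv.1.lip) (fun x hx => by rw [hu.1.2 x hx, hv.2 x hx, sub_self]) h3 x
  linarith

end exist
end AP

namespace AP
set_option linter.unusedSectionVars false
open Filter
open scoped Topology Gradient NNReal
section exist
variable {E : Type*} [NormedAddCommGroup E] [InnerProductSpace ℝ E] [FiniteDimensional ℝ E]
  [MeasureSpace E] [BorelSpace E] [(volume : Measure E).IsAddHaarMeasure] [Nontrivial E]
variable {p ε : ℝ}

theorem ptw_small {a K : ℝ} (ha : 0 < a) (hK : 0 < K) : ∃ δ : ℝ, 0 < δ ∧ ∀ f : E → ℝ, LipK K f →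
    (∀ x, x ∉ ball (0 : E) 1 → f x = 0) → ∫ x in ball (0 : E) 1, ‖∇ f x‖ ^ 2 ≤ δ → ∀ x, |f x| ≤ a := by
  have hv : ∀ x : E, volume.real (ball x (a / (2 * K))) = volume.real (ball (0 : E) (a / (2 * K))) :=
    fun x => congrArg ENNReal.toReal (Measure.addHaar_ball_center volume x _)
  have v0 : 0 < volume.real (ball (0 : E) (a / (2 * K))) := by
    exact ENNReal.toReal_pos (measure_ball_pos _ _ (by positivity)).ne' measure_ball_lt_top.ne
  generalize volume.real (ball (0 : E) (a / (2 * K))) = V at hv v0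
  refine ⟨(a / 2) ^ 2 * V / 8, by positivity, fun f hf h0 hd x => ?_⟩
  by_contra! hx
  have h1 := poin hf.lip h0 (q := 2) (by norm_num)
  simp only [Real.rpow_two] at h1
  have hh : ∫ x in ball (0 : E) 1, |f x| ^ 2 = ∫ x, |f x| ^ 2 :=
    setIntegral_eq_integral_of_forall_compl_eq_zero fun x hx => by rw [h0 x hx]; simp
  rw [hh] at h1
  have hi : Integrable fun x => |f x| ^ 2 := sq_int hf.lip.cont h0
  have h2 : ∫ y in ball x (a / (2 * K)), (a / 2) ^ 2 ≤ ∫ y in ball x (a / (2 * K)), |f y| ^ 2 := by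
    refine setIntegral_mono_on (integrableOn_const measure_ball_lt_top.ne) hi.integrableOn
      measurableSet_ball fun y hy => ?_
    have := hf x y
    rw [mem_ball', dist_eq_norm] at hy
    have h3 : K * ‖x - y‖ ≤ a / 2 := by
      calc _ ≤ K * (a / (2 * K)) := by gcongr
        _ = _ := by field_simp
    have h4 := abs_sub_abs_le_abs_sub (f x) (f y)
    have h5 : a / 2 ≤ |f y| := by linarith
    gcongr
  have h3 := setIntegral_le_integral (s := ball x (a / (2 * K))) hi (Eventually.of_forall fun x => by positivity)
  rw [setIntegral_const, hv, smul_eq_mul] at h2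
  have : 0 < (a / 2) ^ 2 * V := by positivity
  linarith

theorem lsc_grad {K δ : ℝ} {F : ℕ → E → ℝ} {f : E → ℝ} (hF : ∀ m, LipK K (F m)) (hf : LipK K f)
    (h0 : ∀ m x, x ∉ ball (0 : E) 1 → F m x = 0) (hl : ∀ x, Tendsto (fun m => F m x) atTop (𝓝 (f x)))
    (hd : ∀ m, ∫ x in ball (0 : E) 1, ‖∇ (F m) x‖ ^ 2 ≤ δ) :
    ∫ x in ball (0 : E) 1, ‖∇ f x‖ ^ 2 ≤ Module.finrank ℝ E * δ := by
  have K0 := hf.nn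
  have s1 : ∀ z : E, ∫ x in ball (0 : E) 1, |f (x + z) - f x| ^ 2 ≤ ‖z‖ ^ 2 * δ := by
    intro z
    have lim : Tendsto (fun m => ∫ x in ball (0 : E) 1, |F m (x + z) - F m x| ^ 2) atTop
        (𝓝 (∫ x in ball (0 : E) 1, |f (x + z) - f x| ^ 2)) := by
      refine tendsto_integral_of_dominated_convergence (fun _ => (K * ‖z‖) ^ 2) (fun m => ?_)
        (integrableOn_const measure_ball_lt_top.ne) (fun m => Eventually.of_forall fun x => ?_)
        (Eventually.of_forall fun x => ?_)
      · exact ((((hF m).lip.tr z).sub (hF m).lip).cont.abs.pow 2).aestronglyMeasurable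
      · rw [Real.norm_of_nonneg (by positivity)]
        gcongr
        simpa using hF m (x + z) x
      · exact (((hl _).sub (hl _)).abs).pow 2
    refine le_of_tendsto lim (Eventually.of_forall fun m => ?_)
    have h1 := trans_est (hF m).lip (q := 2) (by norm_num) (r := 1) (R := 1 + ‖z‖) z le_rfl
    simp only [Real.rpow_two] at h1
    rw [int_off (F := fun x => ‖∇ (F m) x‖ ^ 2) ?_ (by linarith [norm_nonneg z])] at h1
    · exact h1.trans (mul_le_mul_of_nonneg_left (hd m) (by positivity))
    · filter_upwards [grad_off (h0 m)] with x hx hb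
      rw [hx hb]; simp
  have s2 : ∀ z : E, ∫ x in ball (0 : E) 1, ⟪∇ f x, z⟫_ℝ ^ 2 ≤ ‖z‖ ^ 2 * δ := by
    intro z
    have lim : Tendsto (fun m : ℕ => ∫ x in ball (0 : E) 1,
        (((m : ℝ) + 1) * (f (x + ((m : ℝ) + 1)⁻¹ • z) - f x)) ^ 2) atTop
        (𝓝 (∫ x in ball (0 : E) 1, ⟪∇ f x, z⟫_ℝ ^ 2)) := by
      refine tendsto_integral_of_dominated_convergence (fun _ => (K * ‖z‖) ^ 2) (fun m => ?_)
        (integrableOn_const measure_ball_lt_top.ne) (fun m => Eventually.of_forall fun x => ?_)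
        (ae_restrict_of_ae (hf.lip.ae.mono fun x hx => (diffq hx z).pow 2))
      · exact ((((hf.lip.tr _).sub hf.lip).cont.const_mul _).pow 2).aestronglyMeasurable
      · rw [Real.norm_of_nonneg (by positivity), ← sq_abs]
        gcongr
        have M0 : (0 : ℝ) < (m : ℝ) + 1 := by positivity
        have := hf (x + ((m : ℝ) + 1)⁻¹ • z) x
        rw [add_sub_cancel_left, norm_smul, norm_inv, Real.norm_of_nonneg M0.le] at this
        rw [abs_mul, abs_of_pos M0]
        calc _ ≤ ((m : ℝ) + 1) * (K * (((m : ℝ) + 1)⁻¹ * ‖z‖)) := by gcongr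
          _ = _ := by field_simp
    refine le_of_tendsto lim (Eventually.of_forall fun m => ?_)
    have M0 : (0 : ℝ) < (m : ℝ) + 1 := by positivity
    have h1 := s1 (((m : ℝ) + 1)⁻¹ • z)
    rw [norm_smul, norm_inv, Real.norm_of_nonneg M0.le] at h1
    simp only [mul_pow]
    rw [integral_const_mul]
    simp only [sq_abs] at h1
    calc _ ≤ ((m : ℝ) + 1) ^ 2 * ((((m : ℝ) + 1)⁻¹ * ‖z‖) ^ 2 * δ) := by gcongr
      _ = _ := by field_simp
  let b := stdOrthonormalBasis ℝ E
  have e : ∀ x, ‖∇ f x‖ ^ 2 = ∑ i, ⟪∇ f x, b i⟫_ℝ ^ 2 := fun x => by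
    rw [← b.sum_sq_norm_inner_left]; simp
  simp only [e]
  rw [integral_finsetSum]
  · refine (Finset.sum_le_sum fun i _ => s2 (b i)).trans_eq ?_
    simp
  · intro i _
    refine ibd (C := K ^ 2) ((Measurable.inner (𝕜 := ℝ) (meas_grad f) measurable_const).pow_const 2) (fun x => ?_) 0 1
    rw [abs_of_nonneg (by positivity), ← sq_abs]
    gcongr
    refine (abs_real_inner_le_norm _ _).trans ?_
    simpa using hf.gr x

theorem exists_min (hp : 2 ≤ p) (hε : 0 < ε) {K : ℝ} (hK : 0 < K) {g : E → ℝ} (hg : LipK K g) :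
    ∃ u, IsMin p ε K g u := by
  have hb : BddBelow (En p ε '' Xs K g) := ⟨0, by
    rintro _ ⟨v, -, rfl⟩
    exact integral_nonneg fun x => G_nonneg hp hε.le _⟩
  have hne : (En p ε '' Xs K g).Nonempty := ⟨_, g, ⟨hg, fun _ _ => rfl⟩, rfl⟩
  set m := sInf (En p ε '' Xs K g) with hm
  have hmle : ∀ v ∈ Xs K g, m ≤ En p ε v := fun v hv => csInf_le hb ⟨v, hv, rfl⟩
  have hseq : ∀ n : ℕ, ∃ v ∈ Xs K g, En p ε v < m + 1 / ((n : ℝ) + 1) := fun n => by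
    obtain ⟨_, ⟨v, hv, rfl⟩, h⟩ := exists_lt_of_csInf_lt hne
      (lt_add_of_pos_right m (by positivity : (0 : ℝ) < 1 / ((n : ℝ) + 1)))
    exact ⟨v, hv, h⟩
  choose V hV hVm using hseq
  have h2K : ∀ i j, LipK (2 * K) (fun x => V i x - V j x) := fun i j x y => by
    have h1 := abs_le.1 ((hV i).1 x y); have h2 := abs_le.1 ((hV j).1 x y)
    exact abs_le.2 ⟨by linarith, by linarith⟩
  have hz : ∀ i j x, x ∉ ball (0 : E) 1 → V i x - V j x = 0 := fun i j x hx => by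
    rw [(hV i).2 x hx, (hV j).2 x hx, sub_self]
  have hc : ∀ n i j : ℕ, n ≤ i → n ≤ j →
      ∫ x in ball (0 : E) 1, ‖∇ (fun x => V i x - V j x) x‖ ^ 2 ≤ 8 / ε * (1 / ((n : ℝ) + 1)) := by
    intro n i j hi hj
    have h1 := strong hp hε.le (hV i) (hV j)
    have h2 := hmle _ (mid_mem (hV i) (hV j))
    have h3 : 1 / ((i : ℝ) + 1) ≤ 1 / ((n : ℝ) + 1) := by gcongr
    have h4 : 1 / ((j : ℝ) + 1) ≤ 1 / ((n : ℝ) + 1) := by gcongr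
    rw [gsub_sq (hV i).1.lip (hV j).1.lip, div_mul_eq_mul_div, le_div_iff₀ hε]
    linarith [hVm i, hVm j]
  have hlim : Tendsto (fun n : ℕ => 8 / ε * (1 / ((n : ℝ) + 1))) atTop (𝓝 0) := by
    simpa using tendsto_one_div_add_atTop_nhds_zero_nat (𝕜 := ℝ).const_mul (8 / ε)
  have hcau : ∀ x, ∃ y, Tendsto (fun n => V n x) atTop (𝓝 y) := fun x => by
    refine cauchySeq_tendsto_of_complete (Metric.cauchySeq_iff.2 fun a ha => ?_)
    obtain ⟨δ, hδ, hs⟩ := ptw_small (E := E) (K := 2 * K) (half_pos ha) (by positivity)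
    obtain ⟨n, hn⟩ := (hlim.eventually (gt_mem_nhds hδ)).exists
    refine ⟨n, fun i hi j hj => ?_⟩
    have := hs _ (h2K i j) (hz i j) ((hc n i j hi hj).trans hn.le) x
    rw [Real.dist_eq]; linarith
  choose u hu using hcau
  have uK : LipK K u := fun x y =>
    le_of_tendsto ((hu x).sub (hu y)).abs (Eventually.of_forall fun n => (hV n).1 x y)
  have uX : u ∈ Xs K g := ⟨uK, fun x hx =>
    tendsto_nhds_unique (hu x) (tendsto_const_nhds.congr fun n => ((hV n).2 x hx).symm)⟩
  have hconv : ∀ n : ℕ, ∫ x in ball (0 : E) 1, ‖∇ (V n) x - ∇ u x‖ ^ 2 ≤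
      Module.finrank ℝ E * (8 / ε * (1 / ((n : ℝ) + 1))) := fun n => by
    rw [← gsub_sq (hV n).1.lip uK.lip]
    refine lsc_grad (K := 2 * K) (F := fun m x => V n x - V (n + m) x) (fun m => h2K _ _) (fun x y => ?_)
      (fun m => hz _ _) (fun x => ?_) (fun m => hc n _ _ le_rfl (by omega))
    · have h1 := abs_le.1 ((hV n).1 x y); have h2 := abs_le.1 (uK x y)
      exact abs_le.2 ⟨by linarith, by linarith⟩
    · exact tendsto_const_nhds.sub ((hu x).comp (tendsto_add_atTop_nat n |>.congr fun m => by omega))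
  refine ⟨u, uX, fun v hv => le_trans ?_ (hmle v hv)⟩
  set C := (K ^ (p - 2) + ε) * K with hC
  have C0 : 0 < C := by positivity
  -- energy
  have hen : ∀ t : ℝ, 0 < t → ∀ n, En p ε u ≤ En p ε (V n) + C * t * volume.real (ball (0 : E) 1) +
      C / (4 * t) * ∫ x in ball (0 : E) 1, ‖∇ (V n) x - ∇ u x‖ ^ 2 := by
    intro t ht n
    have hi1 := intG (ε := ε) hp hε.le (hV n).1 0 1
    have hi2 : IntegrableOn (fun _ : E => C * t) (ball (0 : E) 1) := integrableOn_const measure_ball_lt_top.ne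
    have hi3 := (int_sq (hV n).1 uK 0 1).const_mul (C / (4 * t))
    have : C * t * volume.real (ball (0 : E) 1) = ∫ x in ball (0 : E) 1, C * t := by
      rw [setIntegral_const, smul_eq_mul, mul_comm]
    rw [En, En, this, ← integral_const_mul, ← integral_add hi1 hi2, ← integral_add (by exact hi1.add hi2) hi3]
    refine setIntegral_mono (intG hp hε.le uK 0 1) ((hi1.add hi2).add hi3) fun x => ?_
    have h1 := alg3 (ε := ε) hp (∇ (V n) x) (∇ u x)
    have h2 := (abs_le.1 (abs_real_inner_le_norm (Aop p ε (∇ u x)) (∇ (V n) x - ∇ u x))).1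
    have h3 := mul_le_mul_of_nonneg_right (A_le hp hε.le (uK.gr x)) (norm_nonneg (∇ (V n) x - ∇ u x))
    have h4 : 0 ≤ ε / 2 * ‖∇ (V n) x - ∇ u x‖ ^ 2 := by positivity
    have h5 : C * ‖∇ (V n) x - ∇ u x‖ ≤ C * t + C / (4 * t) * ‖∇ (V n) x - ∇ u x‖ ^ 2 := by
      have : C * t + C / (4 * t) * ‖∇ (V n) x - ∇ u x‖ ^ 2 - C * ‖∇ (V n) x - ∇ u x‖ =
        C / (4 * t) * (2 * t - ‖∇ (V n) x - ∇ u x‖) ^ 2 := by field_simp; ring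
      have : 0 ≤ C / (4 * t) * (2 * t - ‖∇ (V n) x - ∇ u x‖) ^ 2 := by positivity
      linarith
    rw [← hC] at h3
    linarith
  have hen2 : ∀ t : ℝ, 0 < t → En p ε u ≤ m + C * t * volume.real (ball (0 : E) 1) := by
    intro t ht
    have l1 : Tendsto (fun n : ℕ => (m + 1 / ((n : ℝ) + 1)) + C * t * volume.real (ball (0 : E) 1) +
      C / (4 * t) * (Module.finrank ℝ E * (8 / ε * (1 / ((n : ℝ) + 1))))) atTop
        (𝓝 ((m + 0) + C * t * volume.real (ball (0 : E) 1) + C / (4 * t) * (Module.finrank ℝ E * 0))) :=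
      ((tendsto_const_nhds.add (tendsto_one_div_add_atTop_nhds_zero_nat (𝕜 := ℝ))).add_const _).add
        ((hlim.const_mul _).const_mul _)
    simp only [mul_zero, add_zero] at l1
    refine ge_of_tendsto l1 (Eventually.of_forall fun n => (hen t ht n).trans ?_)
    have := mul_le_mul_of_nonneg_left (hconv n) (by positivity : 0 ≤ C / (4 * t))
    linarith [hVm n]
  have l2 : Tendsto (fun t : ℝ => m + C * t * volume.real (ball (0 : E) 1)) (𝓝[>] 0) (𝓝 (m + C * 0 * volume.real (ball (0 : E) 1))) :=
    (Continuous.tendsto (by fun_prop) 0).mono_left nhdsWithin_le_nhds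
  simp only [mul_zero, zero_mul, add_zero] at l2
  exact ge_of_tendsto l2 (eventually_nhdsWithin_of_forall fun t ht => hen2 t ht)

end exist
end AP

namespace AP
set_option linter.unusedSectionVars false
open Filter
open scoped Topology Gradient NNReal
section exist
variable {E : Type*} [NormedAddCommGroup E] [InnerProductSpace ℝ E] [FiniteDimensional ℝ E]
  [MeasureSpace E] [BorelSpace E] [(volume : Measure E).IsAddHaarMeasure] [Nontrivial E]
variable {p ε : ℝ}

theorem cross {x y : E} (hx : x ∈ ball (0 : E) 1) (hy : y ∉ ball (0 : E) 1) :
    ∃ z ∈ sphere (0 : E) 1, ‖x - z‖ + ‖z - y‖ = ‖x - y‖ := by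
  have hc : ContinuousOn (fun t : ℝ => ‖x + t • (y - x)‖) (Icc 0 1) := by fun_prop
  have h1 := intermediate_value_Icc zero_le_one hc
  simp only [zero_smul, add_zero, one_smul, add_sub_cancel] at h1
  rw [mem_ball_zero_iff] at hx hy
  obtain ⟨t, ht, h⟩ := h1 ⟨hx.le, not_lt.1 hy⟩
  refine ⟨x + t • (y - x), by simpa using h, ?_⟩
  have e1 : x - (x + t • (y - x)) = t • (x - y) := by module
  have e2 : x + t • (y - x) - y = (1 - t) • (x - y) := by module
  rw [e1, e2, norm_smul, norm_smul, Real.norm_of_nonneg ht.1, Real.norm_of_nonneg (by linarith [ht.2])]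
  ring

open Classical in
theorem glue {K : ℝ} {a b : E → ℝ} (ha : LipK K a) (hb : LipK K b) (h : ∀ x ∈ sphere (0 : E) 1, a x = b x) :
    LipK K (fun x => if x ∈ ball (0 : E) 1 then a x else b x) := by
  have key : ∀ x y : E, x ∈ ball (0 : E) 1 → y ∉ ball (0 : E) 1 → |a x - b y| ≤ K * ‖x - y‖ := by
    intro x y hx hy
    obtain ⟨z, hz, e⟩ := cross hx hy
    have h1 := ha x z
    have h2 := hb z y
    rw [← h z hz] at h2
    have := abs_sub_le (a x) (a z) (b y)
    rw [← e]; linarith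
  intro x y
  by_cases hx : x ∈ ball (0 : E) 1 <;> by_cases hy : y ∈ ball (0 : E) 1
  · simpa only [if_pos hx, if_pos hy] using ha x y
  · simpa only [if_pos hx, if_neg hy] using key x y hx hy
  · simp only [if_neg hx, if_pos hy]
    rw [abs_sub_comm, norm_sub_rev]; exact key y x hy hx
  · simpa only [if_neg hx, if_neg hy] using hb x y

theorem grad_congr {f g : E → ℝ} {x : E} (h : f =ᶠ[𝓝 x] g) : ∇ f x = ∇ g x := by
  rw [gradient, gradient, h.fderiv_eq]

theorem grad_touch {f g : E → ℝ} {x : E} (hf : DifferentiableAt ℝ f x) (hg : DifferentiableAt ℝ g x)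
    (h : f x = g x) (hle : ∀ᶠ y in 𝓝 x, f y ≤ g y) : ∇ g x = ∇ f x := by
  have : IsLocalMin (fun y => g y - f y) x := by
    filter_upwards [hle] with y hy
    rw [h, sub_self]; linarith
  have := grad_min this
  rw [grad_sub hg hf] at this
  exact sub_eq_zero.1 this

theorem lip_affine (c : ℝ) (β s : E) : LipK ‖β‖ (fun x => c + ⟪β, x - s⟫_ℝ) := fun x y => by
  have : c + ⟪β, x - s⟫_ℝ - (c + ⟪β, y - s⟫_ℝ) = ⟪β, x - y⟫_ℝ := by
    simp only [inner_sub_right]; ring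
  rw [this]; exact abs_real_inner_le_norm _ _

theorem grad_affine (c : ℝ) (β s x : E) : ∇ (fun x => c + ⟪β, x - s⟫_ℝ) x = β := by
  refine HasGradientAt.gradient ?_
  rw [hasGradientAt_iff_hasFDerivAt]
  have := (((InnerProductSpace.toDual ℝ E β).hasFDerivAt (x := x - s)).comp x ((hasFDerivAt_id x).sub_const s)).const_add c
  exact this

theorem LipK.mono {K L : ℝ} {f : E → ℝ} (h : LipK K f) (hKL : K ≤ L) : LipK L f := fun x y =>
  (h x y).trans (mul_le_mul_of_nonneg_right hKL (norm_nonneg _))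

theorem LipK.mx {K : ℝ} {f g : E → ℝ} (hf : LipK K f) (hg : LipK K g) : LipK K (fun x => max (f x) (g x)) :=
  fun x y => (abs_max_sub_max_le_max _ _ _ _).trans (max_le (hf x y) (hg x y))
theorem LipK.mn {K : ℝ} {f g : E → ℝ} (hf : LipK K f) (hg : LipK K g) : LipK K (fun x => min (f x) (g x)) :=
  fun x y => (abs_min_sub_min_le_max _ _ _ _).trans (max_le (hf x y) (hg x y))
theorem LipK.sh {K : ℝ} {f : E → ℝ} (hf : LipK K f) (z : E) (c : ℝ) : LipK K (fun x => f (x + z) + c) :=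
  fun x y => by simpa using hf (x + z) (y + z)

open Classical in
theorem min_lower (hp : 2 ≤ p) (hε : 0 < ε) {K : ℝ} {g u : E → ℝ} (hu : IsMin p ε K g u) {s β : E}
    (hβ : ‖β‖ ≤ K) (h : ∀ x ∈ sphere (0 : E) 1, g s + ⟪β, x - s⟫_ℝ ≤ g x) {x : E} (hx : x ∈ ball (0 : E) 1) :
    g s + ⟪β, x - s⟫_ℝ ≤ u x := by
  have sb : ∀ x ∈ sphere (0 : E) 1, x ∉ ball (0 : E) 1 := fun x hx hb => by
    rw [mem_sphere] at hx; rw [mem_ball] at hb; linarith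
  set b : E → ℝ := fun x => g s + ⟪β, x - s⟫_ℝ with hbd
  have hb : LipK K b := (lip_affine (g s) β s).mono hβ
  set v : E → ℝ := fun x => if x ∈ ball (0 : E) 1 then max (u x) (b x) else u x with hv
  have vX : v ∈ Xs K g := by
    refine ⟨glue (hu.1.1.mx hb) hu.1.1 fun x hx => ?_, fun x hx => ?_⟩
    · rw [max_eq_left]; rw [hu.1.2 x (sb x hx)]; exact h x hx
    · simp only [hv, if_neg hx]; exact hu.1.2 x hx
  have hE : En p ε v ≤ En p ε u := by
    have hi1 := intG (ε := ε) hp hε.le vX.1 0 1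
    have hi2 : IntegrableOn (fun x => ⟪Aop p ε β, ∇ (fun x => v x - u x) x⟫_ℝ) (ball (0 : E) 1) := by
      obtain ⟨L, hL, -, hg⟩ := (vX.1.lip.sub hu.1.1.lip).ex
      refine ibd (C := ‖Aop p ε β‖ * L) (Measurable.inner (𝕜 := ℝ) measurable_const (meas_grad _)) (fun x => ?_) 0 1
      exact (abs_real_inner_le_norm _ _).trans (mul_le_mul_of_nonneg_left (hg x) (norm_nonneg _))
    have h0 := int_grad_zero (vX.1.lip.sub hu.1.1.lip)
      (fun x hx => by rw [vX.2 x hx, hu.1.2 x hx, sub_self]) (Aop p ε β)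
    have : En p ε v = ∫ x in ball (0 : E) 1, (Gf p ε (∇ v x) - ⟪Aop p ε β, ∇ (fun x => v x - u x) x⟫_ℝ) := by
      rw [integral_sub hi1 hi2, h0, sub_zero, En]
    rw [this]
    refine setIntegral_mono_ae_restrict (hi1.sub hi2) (intG hp hε.le hu.1.1 0 1) ?_
    filter_upwards [ae_restrict_mem measurableSet_ball, ae_restrict_of_ae hu.1.1.lip.ae,
      ae_restrict_of_ae vX.1.lip.ae] with x hx hd hd'
    rw [grad_sub hd' hd]
    have hbn := isOpen_ball.mem_nhds hx
    rcases lt_or_ge (u x) (b x) with hlt | hge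
    · have : v =ᶠ[𝓝 x] b := by
        filter_upwards [hbn, hu.1.1.lip.cont.continuousAt.eventually_lt hb.lip.cont.continuousAt hlt] with y hy hy2
        simp only [hv, if_pos hy, max_eq_right hy2.le]
      rw [grad_congr this, grad_affine]
      have := alg3 (ε := ε) hp (∇ u x) β
      have k : 0 ≤ ε / 2 * ‖-(β - ∇ u x)‖ ^ 2 := by positivity
      rw [← neg_sub, inner_neg_right] at this
      linarith
    · have : ∇ v x = ∇ u x := grad_touch hd hd' (by simp only [hv, if_pos hx, max_eq_left hge]) (by
        filter_upwards [hbn] with y hy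
        simp only [hv, if_pos hy]; exact le_max_left _ _)
      rw [this, sub_self, inner_zero_right, sub_zero]
  have := min_unique hp hε hu vX hE x
  rw [this]; simp only [hv, if_pos hx]; exact le_max_right _ _

theorem IsMin.neg {K : ℝ} {g u : E → ℝ} (hu : IsMin p ε K g u) :
    IsMin p ε K (fun x => -1 * g x) (fun x => -1 * u x) := by
  have e : ∀ v : E → ℝ, En p ε (fun x => -1 * v x) = En p ε v := fun v => by
    simp only [En, grad_smul, Gf]; simp
  have m : ∀ {v f : E → ℝ}, v ∈ Xs K f → (fun x => -1 * v x) ∈ Xs K (fun x => -1 * f x) := fun {v f} hv =>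
    ⟨fun x y => by rw [← mul_sub, abs_mul]; simpa using hv.1 x y, fun x hx => by simp only [hv.2 x hx]⟩
  refine ⟨m hu.1, fun v hv => ?_⟩
  have := m hv
  simp only [← mul_assoc] at this
  norm_num at this
  have h2 := hu.2 _ this
  rw [e, ← e v]
  simpa using h2

def BSC (K : ℝ) (g : E → ℝ) : Prop := LipK K g ∧ ∀ s ∈ sphere (0 : E) 1,
  (∃ β : E, ‖β‖ ≤ K ∧ ∀ x ∈ sphere (0 : E) 1, g s + ⟪β, x - s⟫_ℝ ≤ g x) ∧
  (∃ β : E, ‖β‖ ≤ K ∧ ∀ x ∈ sphere (0 : E) 1, g x ≤ g s + ⟪β, x - s⟫_ℝ)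

theorem lip_bdry (hp : 2 ≤ p) (hε : 0 < ε) {K K0 : ℝ} {g u : E → ℝ} (hu : IsMin p ε K g u) (hK : K0 ≤ K)
    (hb : BSC K0 g) (x : E) {y : E} (hy : y ∉ ball (0 : E) 1) : |u x - u y| ≤ K0 * ‖x - y‖ := by
  by_cases hx : x ∈ ball (0 : E) 1
  · have key : ∀ s ∈ sphere (0 : E) 1, |u x - g s| ≤ K0 * ‖x - s‖ := by
      intro s hs
      obtain ⟨⟨β, h1, h2⟩, β', h3, h4⟩ := hb.2 s hs
      have a1 := min_lower hp hε hu (h1.trans hK) h2 hx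
      have a2 := min_lower hp hε hu.neg (s := s) (β := -β') (by rw [norm_neg]; exact h3.trans hK)
        (fun x hx => by have := h4 x hx; rw [inner_neg_left]; linarith) hx
      rw [inner_neg_left] at a2
      have b1 := (abs_le.1 (abs_real_inner_le_norm β (x - s))).1
      have b2 := (abs_le.1 (abs_real_inner_le_norm β' (x - s))).2
      have c1 := mul_le_mul_of_nonneg_right h1 (norm_nonneg (x - s))
      have c2 := mul_le_mul_of_nonneg_right h3 (norm_nonneg (x - s))
      exact abs_le.2 ⟨by linarith, by linarith⟩
    obtain ⟨z, hz, e⟩ := cross hx hy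
    rw [hu.1.2 y hy]
    have := abs_sub_le (u x) (g z) (g y)
    rw [← e]; linarith [key z hz, hb.1 z y]
  · rw [hu.1.2 y hy, hu.1.2 x hx]; exact hb.1 x y

theorem lip_min (hp : 2 ≤ p) (hε : 0 < ε) {K K0 : ℝ} {g u : E → ℝ} (hu : IsMin p ε K g u) (hK : K0 ≤ K)
    (hb : BSC K0 g) : LipK K0 u := by
  have bd := fun x y hy => lip_bdry hp hε hu hK hb x (y := y) hy
  suffices H : ∀ x τ : E, u (x + τ) - K0 * ‖τ‖ ≤ u x by
    intro x y
    have h1 := H y (x - y)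
    have h2 := H x (y - x)
    rw [add_sub_cancel] at h1 h2
    rw [norm_sub_rev] at h2
    exact abs_le.2 ⟨by linarith, by linarith⟩
  intro x₀ τ
  set c := K0 * ‖τ‖ with hc
  have uL := hu.1.1
  have bd1 : ∀ x, x ∉ ball (0 : E) 1 ∨ x + τ ∉ ball (0 : E) 1 → u (x + τ) - c ≤ u x := by
    rintro x (h | h)
    · have := (abs_le.1 (bd (x + τ) x h)).2
      rw [add_sub_cancel_left] at this; linarith
    · have := (abs_le.1 (bd x (x + τ) h)).1
      rw [sub_add_cancel_left, norm_neg] at this; linarith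
  set v1 : E → ℝ := fun x => max (u x) (u (x + τ) + -c) with hv1
  set v2 : E → ℝ := fun x => min (u x) (u (x + -τ) + c) with hv2
  have X1 : v1 ∈ Xs K g := ⟨uL.mx (uL.sh τ _), fun x hx => by
    rw [← hu.1.2 x hx]; exact max_eq_left (by linarith [bd1 x (Or.inl hx)])⟩
  have X2 : v2 ∈ Xs K g := ⟨uL.mn (uL.sh (-τ) _), fun x hx => by
    rw [← hu.1.2 x hx]
    have := bd1 (x + -τ) (Or.inr (by rwa [neg_add_cancel_right]))
    rw [neg_add_cancel_right] at this
    exact min_eq_left (by linarith)⟩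
  set S : Set E := {x | u x < u (x + τ) + -c} with hS
  have Sm : MeasurableSet S := (isOpen_lt uL.lip.cont (uL.sh τ (-c)).lip.cont).measurableSet
  set H : E → ℝ := S.indicator fun x => Gf p ε (∇ u (x + τ)) - Gf p ε (∇ u x) with hH
  have mG : Measurable fun x => Gf p ε (∇ u x) := (cont_G hp).measurable.comp (meas_grad u)
  have Hm : Measurable H := ((mG.comp (measurable_add_const τ)).sub mG).indicator Sm
  have Hb : ∀ x, |H x| ≤ (K ^ p / p + ε / 2 * K ^ 2) + (K ^ p / p + ε / 2 * K ^ 2) := fun x => by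
    have b1 := G_le (ε := ε) hp hε.le (uL.gr x)
    have b2 := G_le (ε := ε) hp hε.le (uL.gr (x + τ))
    by_cases hx : x ∈ S
    · rw [hH, indicator_of_mem hx]; exact (abs_sub _ _).trans (by linarith)
    · rw [hH, indicator_of_notMem hx, abs_zero]
      linarith [abs_nonneg (Gf p ε (∇ u x))]
  have H0 : ∀ x, x ∉ ball (0 : E) 1 ∨ x + τ ∉ ball (0 : E) 1 → H x = 0 := fun x hx =>
    indicator_of_notMem (by have := bd1 x hx; simp only [hS, mem_ofPred_eq, not_lt]; linarith) _
  have E1 : En p ε v1 = En p ε u + ∫ x, H x := by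
    rw [← setIntegral_eq_integral_of_forall_compl_eq_zero (s := ball (0 : E) 1) fun x hx => H0 x (Or.inl hx),
      En, En, ← integral_add (intG hp hε.le uL 0 1) (ibd Hm Hb 0 1)]
    refine integral_congr_ae (ae_restrict_of_ae ?_)
    filter_upwards [uL.lip.ae, X1.1.lip.ae] with x hd hd1
    by_cases hx : x ∈ S
    · rw [hH, indicator_of_mem hx, add_sub_cancel]
      have : v1 =ᶠ[𝓝 x] fun y => u (y + τ) + -c := by
        filter_upwards [uL.lip.cont.continuousAt.eventually_lt (uL.sh τ (-c)).lip.cont.continuousAt hx] with y hy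
        exact max_eq_right hy.le
      rw [grad_congr this, ← grad_tr u τ x]
      congr 1
      rw [gradient, gradient, fderiv_add_const]
    · rw [hH, indicator_of_notMem hx, add_zero, grad_touch hd hd1 (max_eq_left (not_lt.1 hx)).symm
        (Eventually.of_forall fun y => le_max_left _ _)]
  have hHi : IntegrableOn (fun x => - H (x + -τ)) (ball (0 : E) 1) :=
    ibd (f := fun x => - H (x + -τ)) (Hm.comp (measurable_add_const (-τ))).neg (fun x => by rw [abs_neg]; exact Hb _) 0 1
  have E2 : En p ε v2 = En p ε u + ∫ x, - H (x + -τ) := by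
    rw [← setIntegral_eq_integral_of_forall_compl_eq_zero (s := ball (0 : E) 1) fun x hx => by
        rw [H0 _ (Or.inr (by rwa [neg_add_cancel_right])), neg_zero],
      En, En, ← integral_add (intG hp hε.le uL 0 1)
        hHi]
    refine integral_congr_ae (ae_restrict_of_ae ?_)
    filter_upwards [uL.lip.ae, X2.1.lip.ae] with x hd hd1
    by_cases hx : x + -τ ∈ S
    · rw [hH, indicator_of_mem hx, neg_add_cancel_right]
      have hx' : u (x + -τ) + c < u x := by
        simp only [hS, mem_ofPred_eq, neg_add_cancel_right] at hx; linarith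
      have : v2 =ᶠ[𝓝 x] fun y => u (y + -τ) + c := by
        filter_upwards [(uL.sh (-τ) c).lip.cont.continuousAt.eventually_lt uL.lip.cont.continuousAt hx'] with y hy
        exact min_eq_right hy.le
      rw [grad_congr this, ← grad_tr u (-τ) x]
      have e : ∇ (fun y => u (y + -τ) + c) x = ∇ (fun y => u (y + -τ)) x := by
        rw [gradient, gradient, fderiv_add_const]
      rw [e]; ring
    · rw [hH, indicator_of_notMem hx, neg_zero, add_zero, grad_touch hd1 hd (min_eq_left ?_)
        (Eventually.of_forall fun y => min_le_left _ _)]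
      simp only [hS, mem_ofPred_eq, neg_add_cancel_right] at hx; linarith
  rw [integral_neg, integral_add_right_eq_self (fun x => H x) (-τ)] at E2
  have h2 := hu.2 v2 X2
  have := min_unique hp hε hu X1 (by linarith) x₀
  rw [this]
  exact le_trans (by linarith) (le_max_right _ _)

def Sol (p ε : ℝ) (h : E → ℝ) : Prop := Lip h ∧ ∀ φ : E → ℝ, Lip φ → (∀ x, x ∉ ball (0 : E) 1 → φ x = 0) →
  ∫ x in ball (0 : E) 1, ⟪Aop p ε (∇ h x), ∇ φ x⟫_ℝ = 0

theorem int_A (hp : 2 ≤ p) (hε : 0 ≤ ε) {h φ : E → ℝ} (hh : Lip h) (hφ : Lip φ) (y : E) (r : ℝ) :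
    IntegrableOn (fun x => ⟪Aop p ε (∇ h x), ∇ φ x⟫_ℝ) (ball y r) := by
  obtain ⟨K, hK, -, hg⟩ := hh.ex
  obtain ⟨L, hL, -, hl⟩ := hφ.ex
  refine ibd (C := ((K ^ (p - 2) + ε) * K) * L) (Measurable.inner (𝕜 := ℝ)
    ((cont_A hp).measurable.comp (meas_grad h)) (meas_grad φ)) (fun x => ?_) y r
  exact (abs_real_inner_le_norm _ _).trans (mul_le_mul (A_le hp hε (hg x)) (hl x) (norm_nonneg _) (by positivity))

theorem exist_R (hp : 2 ≤ p) (hε : 0 < ε) {K : ℝ} {g : E → ℝ} (hb : BSC K g) :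
    ∃ h : E → ℝ, Sol p ε h ∧ ∀ x, x ∉ ball (0 : E) 1 → h x = g x := by
  have K0 := hb.1.nn
  obtain ⟨h, hm⟩ := exists_min (p := p) hp hε (by linarith : 0 < K + 1) (hb.1.mono (by linarith : K ≤ K + 1))
  have hL := lip_min hp hε hm (by linarith) hb
  have key : ∀ φ : E → ℝ, Lip φ → (∀ x, x ∉ ball (0 : E) 1 → φ x = 0) →
      0 ≤ ∫ x in ball (0 : E) 1, ⟪Aop p ε (∇ h x), ∇ φ x⟫_ℝ := by
    intro φ hφ h0
    obtain ⟨L, hL0, hl, hg⟩ := hφ.ex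
    set C := p * (K ^ (p - 2) + (K + 1) ^ (p - 2) + ε) * L ^ 2 with hC
    have main : ∀ t : ℝ, 0 < t → t * L ≤ 1 → - (C * volume.real (ball (0 : E) 1) * t) ≤
        ∫ x in ball (0 : E) 1, ⟪Aop p ε (∇ h x), ∇ φ x⟫_ℝ := by
      intro t ht htL
      have X1 : (fun x => h x + t * φ x) ∈ Xs (K + 1) g := by
        refine ⟨fun x y => ?_, fun x hx => by simp only [h0 x hx, mul_zero, add_zero, hm.1.2 x hx]⟩
        have h1 := hL x y
        have h2 : |t * (φ x - φ y)| ≤ ‖x - y‖ := by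
          rw [abs_mul, abs_of_pos ht]
          calc _ ≤ t * (L * ‖x - y‖) := by gcongr; exact hl x y
            _ = (t * L) * ‖x - y‖ := by ring
            _ ≤ 1 * ‖x - y‖ := by gcongr
            _ = _ := one_mul _
        calc _ = |(h x - h y) + t * (φ x - φ y)| := by congr 1; ring
          _ ≤ _ := (abs_add_le _ _).trans (by linarith)
      have h1 := hm.2 _ X1
      have hiA := (int_A (ε := ε) hp hε.le hL.lip hφ 0 1).const_mul t
      have hic : IntegrableOn (fun _ : E => C * t ^ 2) (ball (0 : E) 1) := integrableOn_const measure_ball_lt_top.ne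
      have hiG := intG (ε := ε) hp hε.le hL 0 1
      have h2 : En p ε (fun x => h x + t * φ x) ≤ ∫ x in ball (0 : E) 1,
          ((Gf p ε (∇ h x) + t * ⟪Aop p ε (∇ h x), ∇ φ x⟫_ℝ) + C * t ^ 2) := by
        refine setIntegral_mono_ae (intG hp hε.le X1.1 0 1) ((hiG.add hiA).add hic) ?_
        filter_upwards [hL.lip.ae, hφ.ae] with x hd hd2
        rw [grad_add hd (hd2.const_mul t), grad_smul]
        set ξ := ∇ h x
        set e := ∇ φ x
        have hξ : ‖ξ‖ ≤ K := hL.gr x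
        have he : ‖e‖ ≤ L := hg x
        have hte : ‖ξ + t • e‖ ≤ K + 1 := by
          refine (norm_add_le _ _).trans (add_le_add hξ ?_)
          rw [norm_smul, Real.norm_of_nonneg ht.le]
          exact (mul_le_mul_of_nonneg_left he ht.le).trans htL
        have a3 := alg3 (ε := ε) hp ξ (ξ + t • e)
        have a2 := alg2 (ε := ε) hp hε.le (ξ + t • e) ξ
        have k0 : 0 ≤ ε / 2 * ‖-(t • e)‖ ^ 2 := by positivity
        rw [add_sub_cancel_left, norm_smul, Real.norm_of_nonneg ht.le] at a2
        rw [sub_add_cancel_left, inner_neg_right] at a3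
        have b := real_inner_le_norm (Aop p ε (ξ + t • e) - Aop p ε ξ) (t • e)
        rw [inner_sub_left, norm_smul, Real.norm_of_nonneg ht.le, inner_smul_right (Aop p ε ξ)] at b
        have c : ‖Aop p ε (ξ + t • e) - Aop p ε ξ‖ * (t * ‖e‖) ≤ C * t ^ 2 := by
          have r1 := Real.rpow_le_rpow (norm_nonneg _) hξ (by linarith : 0 ≤ p - 2)
          have r2 := Real.rpow_le_rpow (norm_nonneg _) hte (by linarith : 0 ≤ p - 2)
          calc _ ≤ (p * ((K + 1) ^ (p - 2) + K ^ (p - 2) + ε) * (t * L)) * (t * L) := by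
                refine mul_le_mul (a2.trans ?_) (by gcongr) (by positivity) (by positivity)
                gcongr
            _ = _ := by rw [hC]; ring
        linarith
      rw [integral_add (by exact hiG.add hiA) hic, integral_add hiG hiA, integral_const_mul, setIntegral_const,
        smul_eq_mul] at h2
      unfold En at h1 h2
      have h3 : 0 ≤ t * ((∫ x in ball (0 : E) 1, ⟪Aop p ε (∇ h x), ∇ φ x⟫_ℝ) + C * volume.real (ball (0 : E) 1) * t) := by
        linarith
      have := nonneg_of_mul_nonneg_right h3 ht
      linarith
    have l2 : Tendsto (fun t : ℝ => -(C * volume.real (ball (0 : E) 1) * t)) (𝓝[>] 0)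
        (𝓝 (-(C * volume.real (ball (0 : E) 1) * 0))) :=
      (Continuous.tendsto (by fun_prop) 0).mono_left nhdsWithin_le_nhds
    rw [mul_zero, neg_zero] at l2
    refine le_of_tendsto l2 ?_
    have : ∀ᶠ t : ℝ in 𝓝[>] 0, t * L ≤ 1 := by
      have : Tendsto (fun t : ℝ => t * L) (𝓝[>] 0) (𝓝 (0 * L)) :=
        (Continuous.tendsto (by fun_prop) 0).mono_left nhdsWithin_le_nhds
      rw [zero_mul] at this
      exact (this.eventually (gt_mem_nhds one_pos)).mono fun t ht => ht.le
    filter_upwards [this, self_mem_nhdsWithin] with t ht ht0 using main t ht0 ht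
  refine ⟨h, ⟨hL.lip, fun φ hφ h0 => le_antisymm ?_ (key φ hφ h0)⟩, hm.1.2⟩
  have := key _ (hφ.smul (-1)) (fun x hx => by rw [h0 x hx, mul_zero])
  simp only [grad_smul, inner_smul_right, integral_const_mul] at this
  linarith

end exist
end AP

namespace AP
set_option linter.unusedSectionVars false
open Filter
open scoped Topology Gradient NNReal
section dg
variable {E : Type*} [NormedAddCommGroup E] [InnerProductSpace ℝ E] [FiniteDimensional ℝ E]
  [MeasureSpace E] [BorelSpace E] [(volume : Measure E).IsAddHaarMeasure] [Nontrivial E]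
variable {p ε : ℝ}

theorem le_of_eps {X A B : ℝ} (h : ∀ s : ℝ, 0 < s → X ≤ A + s * B) : X ≤ A := by
  have l2 : Tendsto (fun t : ℝ => A + t * B) (𝓝[>] 0) (𝓝 (A + 0 * B)) :=
    (Continuous.tendsto (by fun_prop) 0).mono_left nhdsWithin_le_nhds
  rw [zero_mul, add_zero] at l2
  exact ge_of_tendsto l2 (eventually_nhdsWithin_of_forall fun t ht => h t ht)

noncomputable def eta (ρ R : ℝ) (x : E) : ℝ := max 0 (min 1 ((R - ‖x‖) * (R - ρ)⁻¹))

theorem eta_lip {ρ R : ℝ} (h : ρ < R) : LipK (R - ρ)⁻¹ (eta ρ R : E → ℝ) := by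
  have h0 : 0 < (R - ρ)⁻¹ := inv_pos.2 (by linarith)
  have c : ∀ c : ℝ, LipK (R - ρ)⁻¹ (fun _ : E => c) := fun c x y => by simp; positivity
  refine (c 0).mx ((c 1).mn fun x y => ?_)
  rw [← sub_mul, abs_mul, abs_of_pos h0, mul_comm]
  gcongr
  have := abs_norm_sub_norm_le x y
  rw [abs_sub_comm] at this
  simpa using this
theorem eta_bd (ρ R : ℝ) (x : E) : 0 ≤ eta ρ R x ∧ eta ρ R x ≤ 1 :=
  ⟨le_max_left _ _, max_le zero_le_one (min_le_left _ _)⟩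
theorem eta_one {ρ R : ℝ} (h : ρ < R) {x : E} (hx : x ∈ ball (0 : E) ρ) : eta ρ R x = 1 := by
  rw [mem_ball_zero_iff] at hx
  have : 1 ≤ (R - ‖x‖) * (R - ρ)⁻¹ := by
    rw [← div_eq_mul_inv, le_div_iff₀ (by linarith)]; linarith
  rw [eta, min_eq_left this, max_eq_right zero_le_one]
theorem eta_zero {ρ R : ℝ} (h : ρ < R) {x : E} (hx : x ∉ ball (0 : E) R) : eta ρ R x = 0 := by
  rw [mem_ball_zero_iff, not_lt] at hx
  refine max_eq_left ((min_le_right _ _).trans ?_)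
  exact mul_nonpos_of_nonpos_of_nonneg (by linarith) (inv_nonneg.2 (by linarith))

noncomputable def aw (p ε : ℝ) (h : E → ℝ) (v x : E) : ℝ := ‖∇ h x‖ ^ (p - 2) + ‖∇ h (x + v)‖ ^ (p - 2) + ε
theorem aw_meas (h : E → ℝ) (v : E) : Measurable (aw p ε h v) :=
  (((meas_grad h).norm.pow_const _).add
    (((meas_grad h).comp (measurable_add_const v)).norm.pow_const _)).add_const _
theorem aw_ge (hε : 0 ≤ ε) (h : E → ℝ) (v x : E) : ε ≤ aw p ε h v x ∧ 0 ≤ aw p ε h v x := by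
  have h1 : 0 ≤ ‖∇ h x‖ ^ (p - 2) := by positivity
  have h2 : 0 ≤ ‖∇ h (x + v)‖ ^ (p - 2) := by positivity
  unfold aw; constructor <;> linarith
theorem aw_le (hp : 2 ≤ p) {h : E → ℝ} {v x : E} {K : ℝ} (h1 : ‖∇ h x‖ ≤ K) (h2 : ‖∇ h (x + v)‖ ≤ K) :
    aw p ε h v x ≤ 2 * K ^ (p - 2) + ε := by
  have a1 := Real.rpow_le_rpow (norm_nonneg _) h1 (by linarith : 0 ≤ p - 2)
  have a2 := Real.rpow_le_rpow (norm_nonneg _) h2 (by linarith : 0 ≤ p - 2)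
  unfold aw; linarith

noncomputable def dq (h : E → ℝ) (e : E) (τ : ℝ) (x : E) : ℝ := τ⁻¹ * (h (x + τ • e) - h x)
theorem dq_lip {h : E → ℝ} (hh : Lip h) (e : E) (τ : ℝ) : Lip (dq h e τ) := ((hh.tr _).sub hh).smul _
theorem dq_bd {h : E → ℝ} {K τ : ℝ} (hl : ∀ x y, |h x - h y| ≤ K * ‖x - y‖) {e : E}
    (he : ‖e‖ = 1) (hτ : 0 < τ) (x : E) : |dq h e τ x| ≤ K := by
  have := hl (x + τ • e) x
  rw [add_sub_cancel_left, norm_smul, he, Real.norm_of_nonneg hτ.le, mul_one] at this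
  rw [dq, abs_mul, abs_of_pos (inv_pos.2 hτ), inv_mul_le_iff₀ hτ]; linarith
noncomputable def Pk (h : E → ℝ) (e : E) (τ k : ℝ) (x : E) : ℝ := max (dq h e τ x - k) 0
theorem Pk_lip {h : E → ℝ} (hh : Lip h) (e : E) (τ k : ℝ) : Lip (Pk h e τ k) :=
  ((dq_lip hh e τ).sub (Lip.cst k)).max (Lip.cst 0)
theorem Pk_bd {h : E → ℝ} {K τ : ℝ} (hl : ∀ x y, |h x - h y| ≤ K * ‖x - y‖) {e : E}
    (he : ‖e‖ = 1) (hτ : 0 < τ) (k : ℝ) (x : E) : 0 ≤ Pk h e τ k x ∧ Pk h e τ k x ≤ K + |k| := by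
  have := abs_le.1 (dq_bd hl he hτ x)
  have h2 := abs_le.1 (le_refl |k|)
  have := abs_nonneg k
  exact ⟨le_max_right _ _, max_le (by linarith) (by linarith)⟩

theorem Sol.tr (hp : 2 ≤ p) {h φ : E → ℝ} (hs : Sol p ε h) (hφ : Lip φ) {R : ℝ} {v : E} (hR : R + ‖v‖ ≤ 1)
    (h0 : ∀ x, x ∉ ball (0 : E) R → φ x = 0) :
    ∫ x in ball (0 : E) 1, ⟪Aop p ε (∇ h (x + v)), ∇ φ x⟫_ℝ = 0 := by
  have z : ∀ x, x ∉ ball (0 : E) 1 → φ x = 0 := fun x hx => h0 x fun hb => hx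
    (ball_subset_ball (by linarith [norm_nonneg v]) hb)
  have z' : ∀ x, x ∉ ball (0 : E) 1 → φ (x + -v) = 0 := fun x hx => h0 _ fun hb => hx (by
    rw [mem_ball_zero_iff] at *
    have := norm_add_le (x + -v) v
    rw [neg_add_cancel_right] at this; linarith)
  have h1 := hs.2 _ (hφ.tr (-v)) z'
  rw [setIntegral_eq_integral_of_ae_compl_eq_zero, ← integral_add_right_eq_self _ v] at h1
  · rw [setIntegral_eq_integral_of_ae_compl_eq_zero, ← h1]
    · simp only [grad_tr, add_neg_cancel_right]
    · filter_upwards [grad_off z] with x hx hb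
      rw [hx hb, inner_zero_right]
  · filter_upwards [grad_off z'] with x hx hb
    rw [hx hb, inner_zero_right]

theorem grad_dq {h : E → ℝ} {e : E} {τ : ℝ} {x : E} (h1 : DifferentiableAt ℝ h x)
    (h2 : DifferentiableAt ℝ h (x + τ • e)) : ∇ (dq h e τ) x = τ⁻¹ • (∇ h (x + τ • e) - ∇ h x) := by
  unfold dq
  rw [grad_smul, grad_sub ((differentiableAt_comp_add_right _).2 h2) h1, grad_tr]

theorem cacc (hp : 2 ≤ p) (hε : 0 ≤ ε) {h : E → ℝ} (hs : Sol p ε h) {e : E} (he : ‖e‖ = 1) {τ ρ R : ℝ} (k : ℝ)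
    (hτ : 0 < τ) (hρ : ρ < R) (hR : R + τ ≤ 1) :
    ∫ x in ball (0 : E) ρ, aw p ε h (τ • e) x * ‖∇ (Pk h e τ k) x‖ ^ 2 ≤
      16 * p ^ 2 / (R - ρ) ^ 2 * ∫ x in ball (0 : E) R, aw p ε h (τ • e) x * Pk h e τ k x ^ 2 := by
  obtain ⟨K, hK, hl, hg⟩ := hs.1.ex
  set P := Pk h e τ k with hP
  have PL : Lip P := Pk_lip hs.1 e τ k
  have Pb := Pk_bd hl he hτ k
  set η : E → ℝ := eta ρ R with hη
  have ηL := (eta_lip hρ : LipK _ (eta ρ R : E → ℝ))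
  have ηb := (eta_bd ρ R : ∀ x : E, _)
  have ηab : ∀ x, |η x| ≤ 1 := fun x => by rw [abs_of_nonneg (ηb x).1]; exact (ηb x).2
  set a := aw p ε h (τ • e) with ha
  have a0 : ∀ x, 0 ≤ a x := fun x => (aw_ge hε h _ x).2
  have aC : ∀ x, a x ≤ 2 * K ^ (p - 2) + ε := fun x => aw_le hp (hg x) (hg _)
  have am : Measurable a := aw_meas h _
  have C0 : 0 ≤ 2 * K ^ (p - 2) + ε := (a0 0).trans (aC 0)
  obtain ⟨Q, hQ, -, hgP⟩ := PL.ex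
  have nτ : ‖τ • e‖ = τ := by rw [norm_smul, he, Real.norm_of_nonneg hτ.le, mul_one]
  set φ : E → ℝ := fun x => (η x * η x) * P x with hφd
  have hηη : Lip fun x => η x * η x := ηL.lip.mul ηL.lip ηab ηab
  have hφ : Lip φ := hηη.mul PL (a := 1) (b := K + |k|)
    (fun x => by rw [abs_mul]; exact mul_le_one₀ (ηab x) (abs_nonneg _) (ηab x))
    (fun x => by rw [abs_of_nonneg (Pb x).1]; exact (Pb x).2)
  have φ0 : ∀ x, x ∉ ball (0 : E) R → φ x = 0 := fun x hx => by
    simp only [hφd, hη, eta_zero hρ hx, zero_mul]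
  have φ1 : ∀ x, x ∉ ball (0 : E) 1 → φ x = 0 := fun x hx => φ0 x fun hb => hx (ball_subset_ball (by linarith) hb)
  have e1 := hs.2 φ hφ φ1
  have e2 := hs.tr hp hφ (v := τ • e) (by rw [nτ]; exact hR) φ0
  have i1 := int_A hp hε hs.1 hφ 0 1
  have i2 : IntegrableOn (fun x => ⟪Aop p ε (∇ h (x + τ • e)), ∇ φ x⟫_ℝ) (ball (0 : E) 1) := by
    have := int_A hp hε (hs.1.tr (τ • e)) hφ 0 1
    simpa only [grad_tr] using this
  have mX : Measurable fun x => ‖∇ P x‖ ^ 2 := (meas_grad P).norm.pow_const 2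
  have i3 : IntegrableOn (fun x => η x ^ 2 * (a x * ‖∇ P x‖ ^ 2)) (ball (0 : E) 1) := by
    refine ibd (C := 1 * ((2 * K ^ (p - 2) + ε) * Q ^ 2)) ((ηL.lip.cont.measurable.pow_const 2).mul (am.mul mX)) (fun x => ?_) 0 1
    have := a0 x
    change |η x ^ 2 * (a x * ‖∇ P x‖ ^ 2)| ≤ _
    rw [abs_of_nonneg (by positivity)]
    have h1 := ηab x
    have h2 := aC x
    have h3 := hgP x
    rw [← sq_abs]
    gcongr
    exact pow_le_one₀ (abs_nonneg _) h1
  have i4 : IntegrableOn (fun x => a x * P x ^ 2 * ‖∇ η x‖ ^ 2) (ball (0 : E) 1) := by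
    refine ibd (C := (2 * K ^ (p - 2) + ε) * (K + |k|) ^ 2 * ((R - ρ)⁻¹) ^ 2)
      ((am.mul (PL.cont.measurable.pow_const 2)).mul ((meas_grad η).norm.pow_const 2)) (fun x => ?_) 0 1
    have := a0 x
    change |a x * P x ^ 2 * ‖∇ η x‖ ^ 2| ≤ _
    rw [abs_of_nonneg (by positivity)]
    have h1 := (Pb x)
    have h2 := aC x
    have h3 := ηL.gr x
    gcongr
    · exact h1.1
    · exact h1.2
  have key : ∫ x in ball (0 : E) 1, (τ / 4 * (η x ^ 2 * (a x * ‖∇ P x‖ ^ 2)) - τ * 4 * p ^ 2 * (a x * P x ^ 2 * ‖∇ η x‖ ^ 2))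
      ≤ ∫ x in ball (0 : E) 1, (⟪Aop p ε (∇ h (x + τ • e)), ∇ φ x⟫_ℝ - ⟪Aop p ε (∇ h x), ∇ φ x⟫_ℝ) := by
    refine setIntegral_mono_ae ((i3.const_mul _).sub (i4.const_mul _)) (i2.sub i1) ?_
    filter_upwards [hs.1.ae, ae_tr hs.1.ae (τ • e), PL.ae, ηL.lip.ae] with x d1 d2 d3 d4
    have d2' : DifferentiableAt ℝ (fun y => h (y + τ • e)) x := (differentiableAt_comp_add_right _).2 d2
    rw [← inner_sub_left]
    set q := Aop p ε (∇ h (x + τ • e)) - Aop p ε (∇ h x) with hq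
    have gφ : ∇ φ x = (η x * η x) • ∇ P x + P x • (η x • ∇ η x + η x • ∇ η x) := by
      have := grad_mul (f := fun y => η y * η y) (d4.mul d4) d3
      rw [hφd, this, grad_mul d4 d4]
    rcases le_or_gt (dq h e τ x) k with hle | hlt
    · have P0 : P x = 0 := max_eq_right (by linarith)
      have X0 : ∇ P x = 0 := grad_min (by
        filter_upwards with y
        rw [P0]; exact (Pb y).1)
      rw [gφ, X0, P0]; simp
    · have hX : ∇ P x = τ⁻¹ • (∇ h (x + τ • e) - ∇ h x) := by
        rw [← grad_dq d1 d2]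
        have : P =ᶠ[𝓝 x] fun y => dq h e τ y - k := by
          filter_upwards [continuousAt_const.eventually_lt (dq_lip hs.1 e τ).cont.continuousAt hlt] with y hy
          exact max_eq_left (by linarith)
        rw [grad_congr this, gradient, gradient, fderiv_sub_const]
      have hX' : ∇ h (x + τ • e) - ∇ h x = τ • ∇ P x := by
        rw [hX, smul_smul, mul_inv_cancel₀ hτ.ne', one_smul]
      have b1 := alg1 hp hε (∇ h (x + τ • e)) (∇ h x)
      have b2 := alg2 hp hε (∇ h (x + τ • e)) (∇ h x)
      rw [hX', ← hq, norm_smul, Real.norm_of_nonneg hτ.le, add_comm (‖∇ h (x + τ • e)‖ ^ _)] at b1 b2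
      rw [inner_smul_right] at b1
      change a x * _ ≤ _ at b1
      change _ ≤ p * a x * _ at b2
      have b3 := (abs_le.1 (abs_real_inner_le_norm q (∇ η x))).1
      have b1' : a x * τ * ‖∇ P x‖ ^ 2 ≤ 2 * ⟪q, ∇ P x⟫_ℝ := by
        have : 0 ≤ τ * (2 * ⟪q, ∇ P x⟫_ℝ - a x * τ * ‖∇ P x‖ ^ 2) := by nlinarith
        have := nonneg_of_mul_nonneg_right this hτ
        linarith
      have b4 : -(p * a x * τ * (‖∇ P x‖ * ‖∇ η x‖)) ≤ ⟪q, ∇ η x⟫_ℝ := by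
        have := mul_le_mul_of_nonneg_right b2 (norm_nonneg (∇ η x))
        linarith
      rw [gφ]
      simp only [inner_add_right, inner_smul_right]
      have c1 := mul_le_mul_of_nonneg_left b1' (sq_nonneg (η x))
      have c2 := mul_le_mul_of_nonneg_left b4 (mul_nonneg (ηb x).1 (Pb x).1)
      have c3 : 0 ≤ τ * a x * (1 / 2 * (η x * ‖∇ P x‖) - 2 * p * P x * ‖∇ η x‖) ^ 2 :=
        mul_nonneg (mul_nonneg hτ.le (a0 x)) (sq_nonneg _)
      nlinarith
  rw [integral_sub i2 i1, e1, e2, integral_sub (i3.const_mul _) (i4.const_mul _), integral_const_mul,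
    integral_const_mul] at key
  have k1 : ∫ x in ball (0 : E) ρ, a x * ‖∇ P x‖ ^ 2 ≤ ∫ x in ball (0 : E) 1, η x ^ 2 * (a x * ‖∇ P x‖ ^ 2) := by
    have : ∫ x in ball (0 : E) ρ, a x * ‖∇ P x‖ ^ 2 = ∫ x in ball (0 : E) ρ, η x ^ 2 * (a x * ‖∇ P x‖ ^ 2) :=
      setIntegral_congr_fun measurableSet_ball fun x hx => by simp only [hη, eta_one hρ hx]; ring
    rw [this]
    exact setIntegral_mono_set i3 (Eventually.of_forall fun x => mul_nonneg (sq_nonneg _) (mul_nonneg (a0 x) (sq_nonneg _)))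
      (LE.le.eventuallyLE (ball_subset_ball (by linarith)))
  have k2 : ∫ x in ball (0 : E) 1, a x * P x ^ 2 * ‖∇ η x‖ ^ 2 ≤ ((R - ρ) ^ 2)⁻¹ * ∫ x in ball (0 : E) R, a x * P x ^ 2 := by
    have z : ∀ x ∈ ball (0 : E) 1 \ ball (0 : E) R, a x * P x ^ 2 * ‖∇ η x‖ ^ 2 = 0 := fun x hx => by
      have : ∇ η x = 0 := grad_min (by
        filter_upwards with y
        rw [hη, eta_zero hρ hx.2]; exact (ηb y).1)
      rw [this]; simp
    rw [setIntegral_eq_of_subset_of_forall_sdiff_eq_zero measurableSet_ball (ball_subset_ball (by linarith : R ≤ 1)) z,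
      ← integral_const_mul]
    refine setIntegral_mono (i4.mono_set (ball_subset_ball (by linarith)))
      ((ibd (C := (2 * K ^ (p - 2) + ε) * (K + |k|) ^ 2) (am.mul (PL.cont.measurable.pow_const 2)) (fun x => ?_) 0 R).const_mul _)
      fun x => ?_
    · have := a0 x
      change |a x * P x ^ 2| ≤ _
      rw [abs_of_nonneg (by positivity)]
      have h2 := aC x
      gcongr
      · exact (Pb x).1
      · exact (Pb x).2
    · have h3 := ηL.gr x
      have := a0 x
      have : ‖∇ η x‖ ^ 2 ≤ ((R - ρ) ^ 2)⁻¹ := by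
        rw [← inv_pow]; gcongr
      rw [mul_comm]
      gcongr
  have k3 := mul_le_mul_of_nonneg_left k2 (by positivity : 0 ≤ 16 * p ^ 2)
  have k4 : ∫ x in ball (0 : E) 1, η x ^ 2 * (a x * ‖∇ P x‖ ^ 2) ≤
      16 * p ^ 2 * ∫ x in ball (0 : E) 1, a x * P x ^ 2 * ‖∇ η x‖ ^ 2 := by
    have : 0 ≤ τ * (16 * p ^ 2 * (∫ x in ball (0 : E) 1, a x * P x ^ 2 * ‖∇ η x‖ ^ 2) -
      ∫ x in ball (0 : E) 1, η x ^ 2 * (a x * ‖∇ P x‖ ^ 2)) := by linarith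
    have := nonneg_of_mul_nonneg_right this hτ
    linarith
  calc _ ≤ _ := k1.trans (k4.trans k3)
    _ = _ := by ring

end dg
end AP

namespace AP
set_option linter.unusedSectionVars false
open Filter
open scoped Topology Gradient NNReal
section dg2
variable {E : Type*} [NormedAddCommGroup E] [InnerProductSpace ℝ E] [FiniteDimensional ℝ E]
  [MeasureSpace E] [BorelSpace E] [(volume : Measure E).IsAddHaarMeasure] [Nontrivial E]
variable {p ε : ℝ}

noncomputable def clamp (k l t : ℝ) : ℝ := max k (min t l)
theorem clamp_bd {k l : ℝ} (h : k < l) (t : ℝ) : k ≤ clamp k l t ∧ clamp k l t ≤ l :=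
  ⟨le_max_left _ _, max_le h.le (min_le_right _ _)⟩
theorem clamp_cont (k l : ℝ) : Continuous (clamp k l) := by unfold clamp; fun_prop

theorem clamp_meas {w : E → ℝ} (hw : Measurable w) (k l : ℝ) : Measurable fun x => clamp k l (w x) :=
  (clamp_cont k l).measurable.comp hw

theorem grad_clamp {h : E → ℝ} (hh : Lip h) (e : E) (τ : ℝ) {k l : ℝ} (hkl : k < l) (x : E) :
    ∇ (fun y => clamp k l (dq h e τ y)) x = 0 ∨
    (k < dq h e τ x ∧ dq h e τ x < l ∧ ∇ (fun y => clamp k l (dq h e τ y)) x = ∇ (Pk h e τ k) x) := by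
  have hc := (dq_lip hh e τ).cont
  rcases le_or_gt (dq h e τ x) k with h1 | h1
  · left
    refine grad_min (Eventually.of_forall fun y => ?_)
    beta_reduce
    rw [show clamp k l (dq h e τ x) = k by
      rw [clamp, min_eq_left (by linarith), max_eq_left h1]]
    exact (clamp_bd hkl _).1
  rcases le_or_gt l (dq h e τ x) with h2 | h2
  · left
    refine grad_max (Eventually.of_forall fun y => ?_)
    beta_reduce
    rw [show clamp k l (dq h e τ x) = l by
      rw [clamp, min_eq_right h2, max_eq_right hkl.le]]
    exact (clamp_bd hkl _).2
  right
  refine ⟨h1, h2, ?_⟩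
  have : (fun y => clamp k l (dq h e τ y)) =ᶠ[𝓝 x] fun y => Pk h e τ k y + k := by
    filter_upwards [continuousAt_const.eventually_lt hc.continuousAt h1,
      hc.continuousAt.eventually_lt continuousAt_const h2] with y y1 y2
    rw [clamp, min_eq_left y2.le, max_eq_right y1.le, Pk, max_eq_left (by linarith)]; ring
  rw [grad_congr this, gradient, gradient, fderiv_add_const]

def bad (h w : E → ℝ) (e : E) (k l τ : ℝ) : Set E :=
  {x | k < dq h e τ x ∧ dq h e τ x < l ∧ ¬(k ≤ w x ∧ w x ≤ l)}
def mid (w : E → ℝ) (k l : ℝ) : Set E := {x | k ≤ w x ∧ w x ≤ l}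
theorem mid_meas {w : E → ℝ} (hw : Measurable w) (k l : ℝ) : MeasurableSet (mid w k l) :=
  (measurableSet_le measurable_const hw).inter (measurableSet_le hw measurable_const)
theorem bad_meas {h w : E → ℝ} (hh : Lip h) (hw : Measurable w) (e : E) (k l τ : ℝ) :
    MeasurableSet (bad h w e k l τ) := by
  have := (dq_lip hh e τ).cont.measurable
  exact (measurableSet_lt measurable_const this).inter
    ((measurableSet_lt this measurable_const).inter (mid_meas hw k l).compl)

theorem ind_bd (A : Set E) (x : E) : 0 ≤ A.indicator (fun _ => (1 : ℝ)) x ∧ |A.indicator (fun _ => (1 : ℝ)) x| ≤ 1 := by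
  by_cases h : x ∈ A <;> simp [h]
theorem ind_meas {A : Set E} (h : MeasurableSet A) : Measurable (A.indicator fun _ => (1 : ℝ)) :=
  measurable_const.indicator h
theorem ind_int {A : Set E} (h : MeasurableSet A) (R : ℝ) :
    ∫ x in ball (0 : E) R, A.indicator (fun _ => (1 : ℝ)) x = volume.real (A ∩ ball (0 : E) R) := by
  rw [integral_indicator h, setIntegral_const, measureReal_restrict_apply h]; simp

theorem young {c s a t : ℝ} (hc : 0 < c) (hs : 0 < s) (h : c ≤ a) : t ≤ s / c * (a * t ^ 2) + 1 / (4 * s) := by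
  have h1 : s * t ^ 2 ≤ s / c * (a * t ^ 2) := by
    have : s * t ^ 2 = s / c * (c * t ^ 2) := by field_simp
    rw [this]; gcongr
  have h2 : s * t ^ 2 + 1 / (4 * s) - t = s * (t - 1 / (2 * s)) ^ 2 := by field_simp; ring
  have h3 : 0 ≤ s * (t - 1 / (2 * s)) ^ 2 := by positivity
  linarith

theorem dg_step (hp : 2 ≤ p) (hε : 0 < ε) {h : E → ℝ} (hs : Sol p ε h) {e : E} (he : ‖e‖ = 1)
    {G g k l : ℝ} (hkl : k < l) (hG : ∀ᵐ x : E, x ∈ ball (0 : E) 1 → ‖∇ h x‖ ≤ G) (hg0 : 0 ≤ g)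
    (hg : ∀ᵐ x : E, x ∈ ball (0 : E) 1 → k ≤ ⟪∇ h x, e⟫_ℝ → ⟪∇ h x, e⟫_ℝ ≤ l → g ≤ ‖∇ h x‖)
    {r R s s' τ : ℝ} {z : E} (hrR : r < R) (hR : R ≤ 1) (h0 : 0 < s) (h0' : 0 < s')
    (hz : ‖z‖ ≤ (R - r) / 4) (hτ : 0 < τ) (hτ' : τ ≤ (R - r) / 4) :
    ∫ x in ball (0 : E) r, |clamp k l (dq h e τ (x + z)) - clamp k l (dq h e τ x)| ≤
      ‖z‖ * ((s / (g ^ (p - 2) + ε) + s' / ε) * (64 * p ^ 2 / (R - r) ^ 2 * ((2 * G ^ (p - 2) + ε) *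
        ∫ x in ball (0 : E) R, Pk h e τ k x ^ 2))
        + volume.real (mid (fun x => ⟪∇ h x, e⟫_ℝ) k l ∩ ball 0 R) / (4 * s)
        + 1 / (4 * s') * ∫ x in ball (0 : E) R, (bad h (fun x => ⟪∇ h x, e⟫_ℝ) e k l τ).indicator (fun _ => 1) x) := by
  set w : E → ℝ := fun x => ⟪∇ h x, e⟫_ℝ with hw
  have wm : Measurable w := (meas_grad h).inner measurable_const
  set T : E → ℝ := fun x => clamp k l (dq h e τ x) with hT
  have TL : Lip T := (Lip.cst k).max ((dq_lip hs.1 e τ).min (Lip.cst l))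
  have t := trans_est TL le_rfl (r := r) (R := r + ‖z‖) z le_rfl
  simp only [Real.rpow_one] at t
  refine t.trans (mul_le_mul_of_nonneg_left ?_ (norm_nonneg _))
  obtain ⟨K, hK, hl, hgr⟩ := hs.1.ex
  set P := Pk h e τ k with hP
  have PL : Lip P := Pk_lip hs.1 e τ k
  have Pb := Pk_bd hl he hτ k
  set a := aw p ε h (τ • e) with ha
  have a0 : ∀ x, 0 ≤ a x := fun x => (aw_ge hε.le h _ x).2
  have aC : ∀ x, a x ≤ 2 * K ^ (p - 2) + ε := fun x => aw_le hp (hgr x) (hgr _)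
  have am : Measurable a := aw_meas h _
  have C0 : 0 ≤ 2 * K ^ (p - 2) + ε := (a0 0).trans (aC 0)
  obtain ⟨Q, hQ, -, hgP⟩ := PL.ex
  obtain ⟨Q', hQ', -, hgT⟩ := TL.ex
  have nτ : ‖τ • e‖ = τ := by rw [norm_smul, he, Real.norm_of_nonneg hτ.le, mul_one]
  set b := (bad h w e k l τ).indicator (fun _ => (1 : ℝ)) with hb
  set m := (mid w k l).indicator (fun _ => (1 : ℝ)) with hm
  have bm : Measurable b := ind_meas (bad_meas hs.1 wm e k l τ)
  have mm : Measurable m := ind_meas (mid_meas wm k l)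
  have ib : ∀ R, IntegrableOn b (ball (0 : E) R) := fun R => ibd bm (fun x => (ind_bd _ x).2) 0 R
  have im : ∀ R, IntegrableOn m (ball (0 : E) R) := fun R => ibd mm (fun x => (ind_bd _ x).2) 0 R
  have ia : ∀ R, IntegrableOn (fun x => a x * ‖∇ P x‖ ^ 2) (ball (0 : E) R) := fun R =>
    ibd (C := (2 * K ^ (p - 2) + ε) * Q ^ 2) (am.mul ((meas_grad P).norm.pow_const 2)) (fun x => by
      have := a0 x
      change |a x * ‖∇ P x‖ ^ 2| ≤ _
      rw [abs_of_nonneg (by positivity)]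
      exact mul_le_mul (aC x) (pow_le_pow_left₀ (norm_nonneg _) (hgP x) 2) (sq_nonneg _) C0) 0 R
  have iP : ∀ R, IntegrableOn (fun x => P x ^ 2) (ball (0 : E) R) := fun R =>
    ibd (C := (K + |k|) ^ 2) (PL.cont.measurable.pow_const 2) (fun x => by
      rw [abs_of_nonneg (sq_nonneg _)]
      exact pow_le_pow_left₀ (Pb x).1 (Pb x).2 2) 0 R
  set lam := g ^ (p - 2) + ε with hlam
  have lam0 : 0 < lam := by positivity
  have st1 : ∫ x in ball (0 : E) (r + ‖z‖), ‖∇ T x‖ ≤ ∫ x in ball (0 : E) (r + ‖z‖),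
      ((s / lam + s' / ε) * (a x * ‖∇ P x‖ ^ 2) + 1 / (4 * s) * m x + 1 / (4 * s') * b x) := by
    refine setIntegral_mono_on_ae (ibd (meas_grad T).norm (C := Q') (fun x => by simpa using hgT x) 0 _)
      ((((ia _).const_mul _).add ((im _).const_mul _)).add ((ib _).const_mul _)) measurableSet_ball ?_
    filter_upwards [hg] with x hgx hx
    have hx1 : x ∈ ball (0 : E) 1 := ball_subset_ball (by linarith) hx
    have n1 : 0 ≤ a x * ‖∇ P x‖ ^ 2 := mul_nonneg (a0 x) (sq_nonneg _)
    have n2 := (ind_bd (mid w k l) x).1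
    have n3 := (ind_bd (bad h w e k l τ) x).1
    have n4 : 0 ≤ s / lam * (a x * ‖∇ P x‖ ^ 2) := by positivity
    have n5 : 0 ≤ s' / ε * (a x * ‖∇ P x‖ ^ 2) := by positivity
    have n6 : 0 ≤ 1 / (4 * s) * m x := by positivity
    have n7 : 0 ≤ 1 / (4 * s') * b x := by positivity
    rw [add_mul]
    rcases grad_clamp hs.1 e τ hkl x with h1 | ⟨h1, h2, h3⟩
    · rw [h1, norm_zero]; linarith
    · rw [h3]
      by_cases hmx : x ∈ mid w k l
      · have m1 : m x = 1 := by rw [hm, indicator_of_mem hmx]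
        have := young (t := ‖∇ P x‖) lam0 h0 (a := a x) (by
          have h4 := Real.rpow_le_rpow hg0 (hgx hx1 hmx.1 hmx.2) (by linarith : 0 ≤ p - 2)
          have h5 : 0 ≤ ‖∇ h (x + τ • e)‖ ^ (p - 2) := by positivity
          rw [ha, aw, hlam]; linarith)
        rw [m1, mul_one]; linarith
      · have b1 : b x = 1 := by
          rw [hb, indicator_of_mem]
          exact ⟨h1, h2, hmx⟩
        have := young (t := ‖∇ P x‖) hε h0' (a := a x) (aw_ge hε.le h _ x).1
        rw [b1, mul_one]; linarith
  rw [integral_add (by exact ((ia _).const_mul _).add ((im _).const_mul _)) ((ib _).const_mul _),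
    integral_add ((ia _).const_mul _) ((im _).const_mul _), integral_const_mul, integral_const_mul,
    integral_const_mul] at st1
  refine st1.trans ?_
  have sub : ball (0 : E) (r + ‖z‖) ⊆ ball (0 : E) R := ball_subset_ball (by linarith)
  have c := cacc hp hε.le hs he k hτ (ρ := r + ‖z‖) (R := R - (R - r) / 4) (by linarith) (by linarith)
  have c2 : ∫ x in ball (0 : E) (R - (R - r) / 4), a x * P x ^ 2 ≤ (2 * G ^ (p - 2) + ε) * ∫ x in ball (0 : E) R, P x ^ 2 := by
    have G0 : 0 ≤ 2 * G ^ (p - 2) + ε := by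
      by_contra hcon
      have : ∀ᵐ x : E, x ∉ ball (0 : E) 1 := by
        filter_upwards [hG] with x hx hb
        have := (norm_nonneg _).trans (hx hb)
        exact hcon (by positivity)
      have h2 : volume (ball (0 : E) 1) = 0 := by
        have := measure_eq_zero_iff_ae_notMem.2 this
        exact this
      exact (measure_ball_pos volume (0 : E) one_pos).ne' h2
    rw [← integral_const_mul]
    calc _ ≤ ∫ x in ball (0 : E) (R - (R - r) / 4), (2 * G ^ (p - 2) + ε) * P x ^ 2 := by
          refine setIntegral_mono_on_ae (ibd (C := (2 * K ^ (p - 2) + ε) * (K + |k|) ^ 2) (am.mul (PL.cont.measurable.pow_const 2)) (fun x => ?_) 0 _)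
            ((iP _).const_mul _) measurableSet_ball ?_
          · have := a0 x
            change |a x * P x ^ 2| ≤ _
            rw [abs_of_nonneg (by positivity)]
            exact mul_le_mul (aC x) (pow_le_pow_left₀ (Pb x).1 (Pb x).2 2) (sq_nonneg _) C0
          · filter_upwards [hG, ae_tr hG (τ • e)] with x h1 h2 hx
            rw [mem_ball_zero_iff] at hx
            refine mul_le_mul_of_nonneg_right (aw_le hp (h1 ?_) (h2 ?_)) (sq_nonneg _)
            · rw [mem_ball_zero_iff]; linarith
            · rw [mem_ball_zero_iff]
              have := norm_add_le x (τ • e)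
              rw [nτ] at this; linarith
      _ ≤ _ := setIntegral_mono_set ((iP _).const_mul _) (Eventually.of_forall fun x => by positivity)
          (LE.le.eventuallyLE (ball_subset_ball (by linarith)))
  have c3 : ∫ x in ball (0 : E) (r + ‖z‖), a x * ‖∇ P x‖ ^ 2 ≤
      64 * p ^ 2 / (R - r) ^ 2 * ((2 * G ^ (p - 2) + ε) * ∫ x in ball (0 : E) R, P x ^ 2) := by
    refine c.trans ?_
    have n0 : 0 ≤ ∫ x in ball (0 : E) (R - (R - r) / 4), a x * P x ^ 2 :=
      integral_nonneg fun x => mul_nonneg (a0 x) (sq_nonneg _)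
    refine mul_le_mul ?_ c2 n0 (by positivity)
    have q1 : (R - r) / 2 ≤ R - (R - r) / 4 - (r + ‖z‖) := by linarith
    have q0 : 0 < R - r := by linarith
    calc 16 * p ^ 2 / (R - (R - r) / 4 - (r + ‖z‖)) ^ 2 ≤ 16 * p ^ 2 / ((R - r) / 2) ^ 2 := by gcongr
      _ = _ := by field_simp; ring
  have c4 : 1 / (4 * s) * ∫ x in ball (0 : E) (r + ‖z‖), m x ≤ volume.real (mid w k l ∩ ball 0 R) / (4 * s) := by
    rw [← ind_int (mid_meas wm k l) R, one_div, inv_mul_eq_div]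
    refine div_le_div_of_nonneg_right ?_ (by positivity)
    exact setIntegral_mono_set (im _) (Eventually.of_forall fun x => (ind_bd (mid w k l) x).1) (LE.le.eventuallyLE sub)
  have c5 : ∫ x in ball (0 : E) (r + ‖z‖), b x ≤ ∫ x in ball (0 : E) R, b x :=
    setIntegral_mono_set (ib _) (Eventually.of_forall fun x => (ind_bd (bad h w e k l τ) x).1) (LE.le.eventuallyLE sub)
  exact add_le_add (add_le_add (mul_le_mul_of_nonneg_left c3 (by positivity)) c4)
    (mul_le_mul_of_nonneg_left c5 (by positivity))

def DG (w : E → ℝ) (k0 k1 K : ℝ) : Prop := ∀ (k l D r R s : ℝ) (z : E), k0 ≤ k → k < l → l ≤ k1 → 0 < D →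
  r < R → R ≤ 1 → 0 < s → ‖z‖ ≤ (R - r) / 4 → (∀ᵐ x : E, x ∈ ball (0 : E) 1 → w x ≤ k + D) →
  ∫ x in ball (0 : E) r, |clamp k l (w (x + z)) - clamp k l (w x)| ≤
    ‖z‖ * (s * K * D ^ 2 * volume.real ({x | k ≤ w x} ∩ ball 0 R) / (R - r) ^ 2
      + volume.real (mid w k l ∩ ball 0 R) / (4 * s))

theorem sol_DG (hp : 2 ≤ p) (hε : 0 < ε) {h : E → ℝ} (hs : Sol p ε h) {e : E} (he : ‖e‖ = 1)
    {G g k0 k1 K0 : ℝ} (hG : ∀ᵐ x : E, x ∈ ball (0 : E) 1 → ‖∇ h x‖ ≤ G) (hg0 : 0 ≤ g)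
    (hg : ∀ᵐ x : E, x ∈ ball (0 : E) 1 → k0 ≤ ⟪∇ h x, e⟫_ℝ → ⟪∇ h x, e⟫_ℝ ≤ k1 → g ≤ ‖∇ h x‖)
    (hK0 : 2 * G ^ (p - 2) + ε ≤ K0 * (g ^ (p - 2) + ε)) :
    DG (fun x => ⟪∇ h x, e⟫_ℝ) k0 k1 (64 * p ^ 2 * K0) := by
  intro k l D r R s z hk hkl hl1 hD hrR hR h0 hz hwD
  set w : E → ℝ := fun x => ⟪∇ h x, e⟫_ℝ with hw
  have wm : Measurable w := (meas_grad h).inner measurable_const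
  obtain ⟨K, hK, hl, hgr⟩ := hs.1.ex
  set t : ℕ → ℝ := fun m => ((m : ℝ) + 1)⁻¹ with ht
  have t0 : ∀ m, 0 < t m := fun m => by positivity
  have tl : Tendsto t atTop (𝓝 0) := by
    simpa [ht, one_div] using (tendsto_one_div_add_atTop_nhds_zero_nat (𝕜 := ℝ))
  have tw : ∀ᵐ x, Tendsto (fun m => dq h e (t m) x) atTop (𝓝 (w x)) := by
    filter_upwards [hs.1.ae] with x hx
    simpa only [dq, ht, inv_inv] using diffq hx e
  have aeB : ∀ {P : E → Prop} {r : ℝ}, (∀ᵐ x, P x) → ∀ᵐ x ∂volume.restrict (ball (0 : E) r), P x :=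
    fun h => ae_restrict_of_ae h
  have kl : ∀ t, |clamp k l t| ≤ |k| + |l| := fun t => by
    have := clamp_bd hkl t
    rw [abs_le]
    constructor <;> linarith [neg_abs_le k, le_abs_self l, abs_nonneg k, abs_nonneg l]
  have dqm : ∀ m, Measurable (dq h e (t m)) := fun m => (dq_lip hs.1 e _).cont.measurable
  have l1 : Tendsto (fun m => ∫ x in ball (0 : E) r, |clamp k l (dq h e (t m) (x + z)) - clamp k l (dq h e (t m) x)|)
      atTop (𝓝 (∫ x in ball (0 : E) r, |clamp k l (w (x + z)) - clamp k l (w x)|)) := by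
    refine tendsto_integral_of_dominated_convergence (fun _ => (|k| + |l|) + (|k| + |l|)) (fun m => ?_)
      (integrableOn_const measure_ball_lt_top.ne) (fun m => Eventually.of_forall fun x => ?_) (aeB ?_)
    · exact ((((clamp_meas (dqm m) k l).comp (measurable_add_const z)).sub
        (clamp_meas (dqm m) k l)).norm).aestronglyMeasurable
    · rw [Real.norm_eq_abs, abs_abs]
      exact (abs_sub _ _).trans (add_le_add (kl _) (kl _))
    · filter_upwards [tw, ae_tr tw z] with x h1 h2
      exact ((((clamp_cont k l).tendsto _).comp h2).sub (((clamp_cont k l).tendsto _).comp h1)).abs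
  have l2 : Tendsto (fun m => ∫ x in ball (0 : E) R, Pk h e (t m) k x ^ 2) atTop
      (𝓝 (∫ x in ball (0 : E) R, max (w x - k) 0 ^ 2)) := by
    refine tendsto_integral_of_dominated_convergence (fun _ => (K + |k|) ^ 2) (fun m => ?_)
      (integrableOn_const measure_ball_lt_top.ne) (fun m => Eventually.of_forall fun x => ?_) (aeB ?_)
    · exact ((Pk_lip hs.1 e (t m) k).cont.pow 2).aestronglyMeasurable
    · rw [Real.norm_eq_abs, abs_of_nonneg (sq_nonneg _)]
      have := Pk_bd hl he (t0 m) k x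
      exact pow_le_pow_left₀ this.1 this.2 2
    · filter_upwards [tw] with x h1
      exact ((h1.sub_const k).max tendsto_const_nhds).pow 2
  have l3 : Tendsto (fun m => ∫ x in ball (0 : E) R, (bad h w e k l (t m)).indicator (fun _ => (1 : ℝ)) x) atTop
      (𝓝 (∫ x in ball (0 : E) R, (0 : ℝ))) := by
    refine tendsto_integral_of_dominated_convergence (fun _ => 1) (fun m => ?_)
      (integrableOn_const measure_ball_lt_top.ne) (fun m => Eventually.of_forall fun x => (ind_bd _ x).2) (aeB ?_)
    · exact (ind_meas (bad_meas hs.1 wm e k l (t m))).aestronglyMeasurable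
    · filter_upwards [tw] with x h1
      refine tendsto_const_nhds.congr' ?_
      by_cases hm : k ≤ w x ∧ w x ≤ l
      · filter_upwards with m
        rw [indicator_of_notMem]; exact fun h => h.2.2 hm
      · rw [not_and_or, not_le, not_le] at hm
        rcases hm with hm | hm
        · filter_upwards [h1.eventually_lt_const hm] with m h2
          rw [indicator_of_notMem]; exact fun h => by linarith [h.1]
        · filter_upwards [h1.eventually_const_lt hm] with m h2
          rw [indicator_of_notMem]; exact fun h => by linarith [h.2.1]
  have sm : MeasurableSet {x | k ≤ w x} := measurableSet_le measurable_const wm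
  set V := volume.real ({x | k ≤ w x} ∩ ball (0 : E) R) with hV
  have V0 : 0 ≤ V := measureReal_nonneg
  have lV : ∫ x in ball (0 : E) R, max (w x - k) 0 ^ 2 ≤ D ^ 2 * V := by
    rw [hV, ← ind_int sm, ← integral_const_mul]
    have hbd : ∀ x, |w x| ≤ K := fun x => by
      have := abs_real_inner_le_norm (∇ h x) e
      rw [he, mul_one] at this
      exact this.trans (hgr x)
    refine setIntegral_mono_on_ae (ibd (C := (K + |k|) ^ 2) (((wm.sub_const k).max measurable_const).pow_const 2) (fun x => ?_) 0 R)
      ((ibd (ind_meas sm) (fun x => (ind_bd _ x).2) 0 R).const_mul _) measurableSet_ball ?_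
    · have h1 := abs_le.1 (hbd x)
      have h2 := neg_abs_le k
      have h3 := abs_nonneg k
      change |max (w x - k) 0 ^ 2| ≤ _
      rw [abs_of_nonneg (sq_nonneg _)]
      exact pow_le_pow_left₀ (le_max_right _ _) (max_le (by linarith) (by linarith)) 2
    · filter_upwards [hwD] with x hx hb
      have hx := hx (ball_subset_ball hR hb)
      by_cases hm : k ≤ w x
      · rw [indicator_of_mem (by exact hm), mul_one]
        exact pow_le_pow_left₀ (le_max_right _ _) (max_le (by linarith) hD.le) 2
      · rw [indicator_of_notMem (by exact hm), max_eq_right (by linarith)]; simp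
  have q0 : 0 < R - r := by linarith
  set lam := g ^ (p - 2) + ε with hlam
  have lam0 : 0 < lam := by positivity
  set Λ := 2 * G ^ (p - 2) + ε with hΛ
  have G0 : 0 ≤ G := by
    by_contra hcon
    have : ∀ᵐ x : E, x ∉ ball (0 : E) 1 := by
      filter_upwards [hG] with x hx hb
      exact hcon ((norm_nonneg _).trans (hx hb))
    exact (measure_ball_pos volume (0 : E) one_pos).ne' (measure_eq_zero_iff_ae_notMem.2 this)
  have Λ0 : 0 ≤ Λ := by positivity
  refine le_of_eps (B := ‖z‖ * (1 / ε * (64 * p ^ 2 / (R - r) ^ 2 * (Λ * (D ^ 2 * V))))) fun s' h0' => ?_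
  have lim := ((((l2.const_mul Λ).const_mul (64 * p ^ 2 / (R - r) ^ 2)).const_mul (s / lam + s' / ε)).add_const
    (volume.real (mid w k l ∩ ball 0 R) / (4 * s))).add (l3.const_mul (1 / (4 * s')))
  have := le_of_tendsto_of_tendsto l1 (lim.const_mul ‖z‖) (by
    filter_upwards [tl.eventually_lt_const (by linarith : 0 < (R - r) / 4)] with m hm
    exact dg_step hp hε hs he hkl hG hg0 (by
      filter_upwards [hg] with x hx hb h1 h2
      exact hx hb (hk.trans h1) (h2.trans hl1)) hrR hR h0 h0' hz (t0 m) hm.le)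
  refine this.trans ?_
  rw [integral_zero, mul_zero, add_zero]
  calc _ ≤ ‖z‖ * ((s / lam + s' / ε) * (64 * p ^ 2 / (R - r) ^ 2 * (Λ * (D ^ 2 * V))) + volume.real (mid w k l ∩ ball 0 R) / (4 * s)) := by
        gcongr
    _ = ‖z‖ * (s * (Λ / lam) * (64 * p ^ 2 / (R - r) ^ 2 * (D ^ 2 * V)) + volume.real (mid w k l ∩ ball 0 R) / (4 * s))
        + s' * (‖z‖ * (1 / ε * (64 * p ^ 2 / (R - r) ^ 2 * (Λ * (D ^ 2 * V))))) := by ring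
    _ ≤ ‖z‖ * (s * K0 * (64 * p ^ 2 / (R - r) ^ 2 * (D ^ 2 * V)) + volume.real (mid w k l ∩ ball 0 R) / (4 * s))
        + s' * (‖z‖ * (1 / ε * (64 * p ^ 2 / (R - r) ^ 2 * (Λ * (D ^ 2 * V))))) := by
        gcongr
        rw [div_le_iff₀ lam0]; exact hK0
    _ = _ := by ring

end dg2
end AP

namespace AP
set_option linter.unusedSectionVars false
open Filter
open scoped Topology Gradient NNReal
section dg3
variable {E : Type*} [NormedAddCommGroup E] [InnerProductSpace ℝ E] [FiniteDimensional ℝ E]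
  [MeasureSpace E] [BorelSpace E] [(volume : Measure E).IsAddHaarMeasure] [Nontrivial E]

theorem fin_sub {A : Set E} {R : ℝ} (h : A ⊆ ball (0 : E) R) : volume A ≠ ⊤ :=
  ((measure_mono h).trans_lt measure_ball_lt_top).ne
theorem fin_ball (A : Set E) (R : ℝ) : volume (A ∩ ball (0 : E) R) ≠ ⊤ := fin_sub inter_subset_right
theorem vr_mono {A B : Set E} {R : ℝ} (h : A ⊆ B) (hB : B ⊆ ball (0 : E) R) : volume.real A ≤ volume.real B :=
  measureReal_mono h (fin_sub hB)
theorem ball_vpos {r : ℝ} (hr : 0 < r) : 0 < volume.real (ball (0 : E) r) :=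
  ENNReal.toReal_pos (measure_ball_pos volume (0 : E) hr).ne' measure_ball_lt_top.ne
theorem ball_mul {r : ℝ} (hr : 0 < r) (s : ℝ) :
    volume.real (ball (0 : E) (r * s)) = r ^ Module.finrank ℝ E * volume.real (ball (0 : E) s) := by
  rw [measureReal_def, Measure.addHaar_ball_mul_of_pos _ _ hr, ENNReal.toReal_mul, ENNReal.toReal_ofReal (by positivity),
    measureReal_def]

theorem dint {T : E → ℝ} (hT : Measurable T) {C : ℝ} (hC : ∀ x, |T x| ≤ C) {S : Set E} (hS : MeasurableSet S)
    {r σ b c : ℝ} (hSr : S ⊆ ball 0 r) (hb : ∀ z ∈ ball (0 : E) σ, ∫ x in ball (0 : E) r, |T (x + z) - T x| ≤ b)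
    (hc : ∀ x ∈ S, c ≤ ∫ z in ball (0 : E) σ, |T (x + z) - T x|) :
    c * volume.real S ≤ b * volume.real (ball (0 : E) σ) := by
  have hbd : ∀ x z, |T (x + z) - T x| ≤ C + C := fun x z => (abs_sub _ _).trans (add_le_add (hC _) (hC _))
  have fS : IsFiniteMeasure (volume.restrict S) :=
    ⟨by rw [Measure.restrict_apply_univ]; exact (measure_mono hSr).trans_lt measure_ball_lt_top⟩
  have fB : IsFiniteMeasure (volume.restrict (ball (0 : E) σ)) :=
    ⟨by rw [Measure.restrict_apply_univ]; exact measure_ball_lt_top⟩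
  have mm : Measurable fun q : E × E => |T (q.1 + q.2) - T q.1| :=
    ((hT.comp (measurable_fst.add measurable_snd)).sub (hT.comp measurable_fst)).abs
  have ii : Integrable (Function.uncurry fun x z => |T (x + z) - T x|)
      ((volume.restrict S).prod (volume.restrict (ball (0 : E) σ))) :=
    Integrable.of_bound mm.aestronglyMeasurable (C + C) (Eventually.of_forall fun q => by
      rw [Real.norm_eq_abs, Function.uncurry, abs_abs]; exact hbd _ _)
  have sw := integral_integral_swap ii
  have l1 : c * volume.real S ≤ ∫ x in S, ∫ z in ball (0 : E) σ, |T (x + z) - T x| := by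
    have : c * volume.real S = ∫ x in S, c := by rw [setIntegral_const, smul_eq_mul, mul_comm]
    rw [this]
    exact setIntegral_mono_on (integrable_const _) ii.integral_prod_left hS hc
  have l2 : ∫ z in ball (0 : E) σ, ∫ x in S, |T (x + z) - T x| ≤ b * volume.real (ball (0 : E) σ) := by
    have : b * volume.real (ball (0 : E) σ) = ∫ z in ball (0 : E) σ, b := by
      rw [setIntegral_const, smul_eq_mul, mul_comm]
    rw [this]
    refine setIntegral_mono_on ii.integral_prod_right (integrable_const _) measurableSet_ball fun z hz =>
      le_trans ?_ (hb z hz)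
    refine setIntegral_mono_set (ibd (C := C + C) ?_ (fun x => ?_) 0 r) (Eventually.of_forall fun x => abs_nonneg _)
      (LE.le.eventuallyLE hSr)
    · exact ((hT.comp (measurable_add_const z)).sub hT).abs
    · rw [abs_abs]; exact hbd _ _
  linarith

theorem low {T : E → ℝ} (hT : Measurable T) {C : ℝ} (hC : ∀ x, |T x| ≤ C) {U : Set E} (hU : MeasurableSet U)
    {σ c : ℝ} (hUσ : U ⊆ ball 0 σ) (x : E) (hc : ∀ z ∈ U, c ≤ |T (x + z) - T x|) :
    c * volume.real U ≤ ∫ z in ball (0 : E) σ, |T (x + z) - T x| := by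
  have hi : IntegrableOn (fun z => |T (x + z) - T x|) (ball (0 : E) σ) :=
    ibd (C := C + C) ((hT.comp (measurable_const_add x)).sub_const _).abs (fun z => by
      rw [abs_abs]; exact (abs_sub _ _).trans (add_le_add (hC _) (hC _))) 0 σ
  have : c * volume.real U = ∫ x in U, c := by rw [setIntegral_const, smul_eq_mul, mul_comm]
  rw [this]
  exact (setIntegral_mono_on (integrableOn_const (fin_sub hUσ))
    (hi.mono_set hUσ) hU hc).trans (setIntegral_mono_set hi (Eventually.of_forall fun x => abs_nonneg _)
      (LE.le.eventuallyLE hUσ))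

theorem clamp_abs {k l : ℝ} (h : k < l) (t : ℝ) : |clamp k l t| ≤ |k| + |l| := by
  have := clamp_bd h t
  rw [abs_le]
  constructor <;> linarith [neg_abs_le k, le_abs_self l, abs_nonneg k, abs_nonneg l]
theorem clamp_lo {k l t : ℝ} (h : k < l) (ht : t ≤ k) : clamp k l t = k := by
  rw [clamp, min_eq_left (by linarith), max_eq_left ht]
theorem clamp_hi {k l t : ℝ} (h : k < l) (ht : l ≤ t) : clamp k l t = l := by
  rw [clamp, min_eq_right ht, max_eq_right h.le]

theorem dg_avg {w : E → ℝ} (wm : Measurable w) {k0 k1 K k l D r R σ : ℝ} (hw : DG w k0 k1 K) (hk : k0 ≤ k)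
    (hkl : k < l) (hl : l ≤ k1) (hD : 0 < D) (hrR : r < R) (hR : R ≤ 1) (hσ0 : 0 < σ) (hσ : σ ≤ (R - r) / 4)
    (hK : 0 ≤ K)
    (hwD : ∀ᵐ x : E, x ∈ ball (0 : E) 1 → w x ≤ k + D)
    (hA : 2 * volume.real ({x | k ≤ w x} ∩ ball 0 R) ≤ volume.real (ball (0 : E) σ)) :
    volume.real ({x | l ≤ w x} ∩ ball 0 r) ≤
      2 * σ / (l - k) * (D / (R - r)) * (K + 1 / 4) * volume.real ({x | k ≤ w x} ∩ ball 0 R) := by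
  set A := {x | k ≤ w x} ∩ ball (0 : E) R with hAd
  have Tm := clamp_meas wm k l
  have q0 : 0 < R - r := by linarith
  have sm : ∀ k, MeasurableSet {x | k ≤ w x} := fun k => measurableSet_le measurable_const wm
  have bp : 0 < volume.real (ball (0 : E) σ) := ball_vpos hσ0
  have key := dint Tm (fun x => clamp_abs hkl (w x)) ((sm l).inter measurableSet_ball) inter_subset_right (r := r) (σ := σ)
    (b := σ * ((D / (R - r)) * (K + 1 / 4) * volume.real A))
    (c := (l - k) * (volume.real (ball (0 : E) σ) / 2)) ?_ ?_
  · have e : 2 * σ / (l - k) * (D / (R - r)) * (K + 1 / 4) * volume.real A =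
      σ * ((D / (R - r)) * (K + 1 / 4) * volume.real A) * 2 / (l - k) := by ring
    rw [e, le_div_iff₀ (by linarith)]
    refine le_of_mul_le_mul_right ?_ bp
    linarith
  · intro z hz
    rw [mem_ball_zero_iff] at hz
    refine (hw k l D r R ((R - r) / D) z hk hkl hl hD hrR hR (by positivity) (hz.le.trans hσ) hwD).trans ?_
    have m1 : volume.real (mid w k l ∩ ball 0 R) ≤ volume.real A :=
      vr_mono (inter_subset_inter_left _ fun x hx => hx.1) inter_subset_right
    have : (R - r) / D * K * D ^ 2 * volume.real A / (R - r) ^ 2 + volume.real (mid w k l ∩ ball 0 R) / (4 * ((R - r) / D))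
        ≤ (D / (R - r)) * (K + 1 / 4) * volume.real A := by
      calc _ ≤ (R - r) / D * K * D ^ 2 * volume.real A / (R - r) ^ 2 + volume.real A / (4 * ((R - r) / D)) := by gcongr
        _ = _ := by field_simp
    exact mul_le_mul hz.le this (by positivity) hσ0.le
  · intro x hx
    set U := ball (0 : E) σ \ ((fun z => x + z) ⁻¹' {y | k ≤ w y}) with hU
    have Um : MeasurableSet U := measurableSet_ball.diff (measurable_const_add x (sm k))
    have hUA : volume.real (ball (0 : E) σ) ≤ volume.real U + volume.real A := by
      have h1 : ball (0 : E) σ ⊆ U ∪ (fun z => x + z) ⁻¹' A := fun z hz => by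
        by_cases h : k ≤ w (x + z)
        · right
          refine ⟨h, ?_⟩
          have hx2 := hx.2
          rw [mem_ball_zero_iff] at hx2 hz ⊢
          have := norm_add_le x z
          linarith
        · exact Or.inl ⟨hz, h⟩
      have h2 : volume.real ((fun z => x + z) ⁻¹' A) = volume.real A := by
        rw [measureReal_def, measureReal_def, measure_preimage_add]
      have f2 : volume ((fun z => x + z) ⁻¹' A) ≠ ⊤ := by rw [measure_preimage_add]; exact fin_ball _ _
      have f1 : volume U ≠ ⊤ := fin_sub sdiff_subset
      rw [← h2]
      exact (measureReal_mono h1 (measure_union_ne_top f1 f2)).trans (measureReal_union_le _ _)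
    refine le_trans ?_ (low Tm (fun x => clamp_abs hkl (w x)) Um sdiff_subset x (c := l - k) fun z hz => ?_)
    · have : 0 < l - k := by linarith
      exact mul_le_mul_of_nonneg_left (by linarith) this.le
    · rw [clamp_hi hkl hx.1, clamp_lo hkl (not_le.1 hz.2).le, abs_sub_comm]
      exact le_abs_self _

theorem dg1 {K : ℝ} (hK : 0 ≤ K) : ∃ ν : ℝ, 0 < ν ∧ ∀ (w : E → ℝ), Measurable w → ∀ k0 D κ : ℝ, 0 < D → D ≤ 8 * κ →
    DG w k0 (k0 + κ) K → (∀ᵐ x : E, x ∈ ball (0 : E) 1 → w x ≤ k0 + D) →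
    volume.real ({x | k0 ≤ w x} ∩ ball (0 : E) (1 / 16)) ≤ ν →
    ∀ᵐ x : E, x ∈ ball (0 : E) (1 / 32) → w x ≤ k0 + κ := by
  set n := Module.finrank ℝ E with hn
  have n1 : n ≠ 0 := (Module.finrank_pos (R := ℝ) (M := E)).ne'
  set q : ℝ := (4⁻¹ : ℝ) ^ n with hq
  have q0 : 0 < q := by positivity
  have q1 : q < 1 := pow_lt_one₀ (by norm_num) (by norm_num) n1
  set c : ℝ := min (1 / 256) (q / (2048 * (K + 1 / 4))) with hc
  have c0 : 0 < c := lt_min (by norm_num) (by positivity)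
  have c1 : c ≤ 1 / 256 := min_le_left _ _
  have c2 : 2048 * (K + 1 / 4) * c ≤ q := by
    have : c ≤ q / (2048 * (K + 1 / 4)) := min_le_right _ _
    rw [le_div_iff₀ (by positivity)] at this; linarith
  refine ⟨volume.real (ball (0 : E) c) / 2, half_pos (ball_vpos c0), ?_⟩
  intro w wm k0 D κ hD hDκ hw hwD hν
  set ν := volume.real (ball (0 : E) c) / 2 with hνd
  have κ0 : 0 < κ := by linarith
  set kk : ℕ → ℝ := fun j => k0 + κ * (1 - 2⁻¹ ^ j) with hkk
  set rr : ℕ → ℝ := fun j => 1 / 32 + 1 / 32 * 2⁻¹ ^ j with hrr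
  have b : ∀ j, volume.real ({x | kk j ≤ w x} ∩ ball (0 : E) (rr j)) ≤ ν * q ^ j := by
    intro j
    induction j with
    | zero => simpa [hkk, hrr, show (32⁻¹ + 32⁻¹ : ℝ) = 16⁻¹ by norm_num] using hν
    | succ j ih =>
      set t : ℝ := 2⁻¹ ^ j with ht
      have t0 : 0 < t := by positivity
      have t1 : t ≤ 1 := pow_le_one₀ (by norm_num) (by norm_num)
      have ts : (2⁻¹ : ℝ) ^ (j + 1) = t / 2 := by rw [pow_succ]; ring
      have tt : (4⁻¹ : ℝ) ^ j = t * t := by rw [ht, ← mul_pow]; norm_num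
      have e1 : kk (j + 1) - kk j = κ * t / 2 := by simp only [hkk, ts]; ring
      have e2 : rr j - rr (j + 1) = t / 64 := by simp only [hrr, ts]; ring
      have kj : k0 ≤ kk j := by simp only [hkk]; nlinarith
      have := dg_avg wm hw kj (l := kk (j + 1)) (D := D) (r := rr (j + 1)) (R := rr j) (σ := t * t * c)
        (by nlinarith) (by simp only [hkk, ts]; nlinarith) hD (by linarith)
        (by simp only [hrr]; linarith) (by positivity) (by rw [e2]; nlinarith) hK
        (by filter_upwards [hwD] with x hx hb; linarith [hx hb]) (by
          rw [← tt, ball_mul (by positivity)]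
          have e3 : ((4⁻¹ : ℝ) ^ j) ^ n = q ^ j := by rw [hq, ← pow_mul, ← pow_mul, mul_comm]
          rw [e3]
          have ih := ih
          rw [hνd] at ih
          linarith)
      rw [e1, e2] at this
      refine this.trans ?_
      have e4 : 2 * (t * t * c) / (κ * t / 2) * (D / (t / 64)) * (K + 1 / 4) = 2048 * (K + 1 / 4) * c * (D / (8 * κ)) := by
        field_simp; ring
      rw [e4, pow_succ]
      have e5 : D / (8 * κ) ≤ 1 := by rw [div_le_one (by positivity)]; exact hDκ
      have e6 : 2048 * (K + 1 / 4) * c * (D / (8 * κ)) ≤ q := (mul_le_of_le_one_right (by positivity) e5).trans c2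
      calc _ ≤ q * (ν * q ^ j) := mul_le_mul e6 ih measureReal_nonneg q0.le
        _ = _ := by ring
  have z : volume.real ({x | k0 + κ < w x} ∩ ball (0 : E) (1 / 32)) ≤ 0 := by
    refine ge_of_tendsto' (x := atTop) (f := fun j : ℕ => ν * q ^ j) ?_ fun j => le_trans ?_ (b j)
    · simpa using (tendsto_pow_atTop_nhds_zero_of_lt_one q0.le q1).const_mul ν
    · have t0 : (0 : ℝ) < 2⁻¹ ^ j := by positivity
      refine vr_mono (inter_subset_inter (fun x hx => ?_) (ball_subset_ball ?_)) inter_subset_right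
      · change k0 + κ * (1 - 2⁻¹ ^ j) ≤ w x
        have : k0 + κ < w x := hx
        nlinarith
      · simp only [hrr]; linarith
  have z2 := (measureReal_eq_zero_iff (fin_ball _ _)).1 (le_antisymm z measureReal_nonneg)
  rw [measure_eq_zero_iff_ae_notMem] at z2
  filter_upwards [z2] with x hx hb
  by_contra hcon
  exact hx ⟨not_le.1 hcon, hb⟩

theorem dgL {K ν : ℝ} (hK : 0 ≤ K) (hν : 0 < ν) : ∃ η : ℝ, 0 < η ∧ η < 1 ∧ ∀ (w : E → ℝ), Measurable w → ∀ k0 D : ℝ, 0 < D →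
    DG w k0 (k0 + D) K → (∀ᵐ x : E, x ∈ ball (0 : E) 1 → w x ≤ k0 + D) →
    ν ≤ volume.real ({x | w x ≤ k0} ∩ ball (0 : E) (1 / 16)) →
    ∀ᵐ x : E, x ∈ ball (0 : E) (1 / 32) → w x ≤ k0 + (1 - η) * D := by
  obtain ⟨ν', hν', H⟩ := dg1 (E := E) hK
  set ω := volume.real (ball (0 : E) 1) with hω
  have ω0 : 0 < ω := ball_vpos one_pos
  set σ := ν * ν' / (2 * (K + 1) * ω ^ 2) with hσ
  have σ0 : 0 < σ := by positivity
  obtain ⟨m, hm⟩ := exists_nat_gt (ω / (8 * σ * ν * ν' / ω / 2))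
  refine ⟨2⁻¹ ^ (2 * m + 1), by positivity, pow_lt_one₀ (by norm_num) (by norm_num) (by omega), ?_⟩
  intro w wm k0 D hD hw hwD hlow
  set kk : ℕ → ℝ := fun j => k0 + D * (1 - 2⁻¹ ^ j) with hkk
  have k1 : ∀ j, kk j + D * 2⁻¹ ^ j = k0 + D := fun j => by simp only [hkk]; ring
  have hwD' : ∀ j, ∀ᵐ x : E, x ∈ ball (0 : E) 1 → w x ≤ kk j + D * 2⁻¹ ^ j := fun j => by rw [k1]; exact hwD
  have tp : ∀ j, (0 : ℝ) < 2⁻¹ ^ j := fun j => by positivity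
  have kmono : ∀ {i j}, i ≤ j → kk i ≤ kk j := fun {i j} hij => by
    have : (2⁻¹ : ℝ) ^ j ≤ 2⁻¹ ^ i := pow_le_pow_of_le_one (by norm_num) (by norm_num) hij
    simp only [hkk]; nlinarith
  have kge : ∀ j, k0 ≤ kk j := fun j => by
    have : (2⁻¹ : ℝ) ^ j ≤ 1 := pow_le_one₀ (by norm_num) (by norm_num)
    simp only [hkk]; nlinarith
  have kle : ∀ j, kk j ≤ k0 + D := fun j => by have := k1 j; have := tp j; nlinarith
  have ks : ∀ j, kk (j + 1) - kk j = D * 2⁻¹ ^ j / 2 := fun j => by simp only [hkk, pow_succ]; ring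
  have kst : ∀ j, kk j < kk (j + 1) := fun j => by have := ks j; have := tp j; nlinarith
  have sm : ∀ k, MeasurableSet {x | k ≤ w x} := fun k => measurableSet_le measurable_const wm
  have main : volume.real ({x | kk (2 * m) ≤ w x} ∩ ball (0 : E) (1 / 16)) ≤ ν' := by
    by_contra hcon
    rw [not_le] at hcon
    have c : ∀ j, j < 2 * m → 8 * σ * ν * ν' / ω / 2 ≤ volume.real (mid w (kk j) (kk (j + 1)) ∩ ball (0 : E) 1) := by
      intro j hj
      set V := volume.real (mid w (kk j) (kk (j + 1)) ∩ ball (0 : E) 1) with hV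
      set k := kk j with hk
      set l := kk (j + 1) with hl
      set Dj := D * 2⁻¹ ^ j with hDj
      have Dp : 0 < Dj := by positivity
      have hkl : k < l := kst j
      have b8 : volume.real (ball (0 : E) (1 / 8)) ≤ ω := vr_mono (ball_subset_ball (by norm_num)) Subset.rfl
      have Vω : volume.real ({x | k ≤ w x} ∩ ball (0 : E) 1) ≤ ω := vr_mono inter_subset_right Subset.rfl
      have S1 : ν' ≤ volume.real ({x | l ≤ w x} ∩ ball (0 : E) (1 / 16)) := hcon.le.trans
        (vr_mono (inter_subset_inter_left _ fun x (hx : kk (2 * m) ≤ w x) => (kmono (by omega)).trans hx) inter_subset_right)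
      have key := dint (clamp_meas wm k l) (fun x => clamp_abs hkl (w x)) ((sm l).inter measurableSet_ball)
        inter_subset_right (r := 1 / 16) (σ := 1 / 8)
        (b := 1 / 8 * (Dj * (2 * (K + 1) * ω * σ + V / (4 * σ)))) (c := (l - k) * ν) ?_ ?_
      · have e1 : (l - k) * ν * ν' ≤ 1 / 8 * (Dj * (2 * (K + 1) * ω * σ + V / (4 * σ))) * ω := by
          refine le_trans ?_ (key.trans ?_)
          · exact mul_le_mul_of_nonneg_left S1 (mul_nonneg (by linarith) hν.le)
          · exact mul_le_mul_of_nonneg_left b8 (by positivity)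
        have e2 : 2 * (K + 1) * ω * σ = ν * ν' / ω := by rw [hσ]; field_simp
        rw [ks j, ← hDj, e2] at e1
        have e3 : Dj * (ν * ν' / 2) ≤ Dj * (1 / 8 * (ν * ν' + V / (4 * σ) * ω)) := by
          calc _ = Dj / 2 * ν * ν' := by ring
            _ ≤ _ := e1
            _ = _ := by field_simp
        have e4 := le_of_mul_le_mul_left e3 Dp
        have e5 : 3 * (ν * ν') ≤ V / (4 * σ) * ω := by linarith
        rw [div_mul_eq_mul_div, le_div_iff₀ (by positivity)] at e5
        rw [div_div, div_le_iff₀ (by positivity)]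
        nlinarith [mul_pos (mul_pos hν hν') σ0]
      · intro z hz
        rw [mem_ball_zero_iff] at hz
        refine (hw k l Dj (1 / 16) 1 (σ / Dj) z (kge j) hkl (kle _) Dp (by norm_num) le_rfl (by positivity)
          (by linarith) (hwD' j)).trans (mul_le_mul hz.le ?_ (by positivity) (by norm_num))
        have : σ / Dj * K * Dj ^ 2 * volume.real ({x | k ≤ w x} ∩ ball 0 1) / (1 - 1 / 16) ^ 2 ≤ Dj * (2 * (K + 1) * ω * σ) := by
          calc _ ≤ σ / Dj * (K + 1) * Dj ^ 2 * ω / (1 - 1 / 16) ^ 2 := by gcongr; linarith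
            _ = Dj * ((256 / 225) * (K + 1) * ω * σ) := by field_simp; norm_num
            _ ≤ _ := by gcongr; norm_num
        rw [mul_add]
        refine add_le_add this (le_of_eq ?_)
        field_simp
        rfl
      · intro x hx
        set U := (fun z => x + z) ⁻¹' ({y | w y ≤ k0} ∩ ball (0 : E) (1 / 16)) with hU
        have Um : MeasurableSet U := measurable_const_add x ((measurableSet_le wm measurable_const).inter measurableSet_ball)
        have hUb : U ⊆ ball (0 : E) (1 / 8) := fun z hz => by
          have h1 := hx.2
          have h2 := hz.2
          rw [mem_ball_zero_iff] at h1 h2 ⊢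
          have := norm_sub_le (x + z) x
          rw [add_sub_cancel_left] at this
          linarith
        have h2 : volume.real U = volume.real ({y | w y ≤ k0} ∩ ball (0 : E) (1 / 16)) := by
          rw [measureReal_def, measureReal_def, hU, measure_preimage_add]
        refine le_trans ?_ (low (clamp_meas wm k l) (fun x => clamp_abs hkl (w x)) Um hUb x (c := l - k) fun z hz => ?_)
        · rw [h2]; exact mul_le_mul_of_nonneg_left hlow (by linarith)
        · rw [clamp_hi hkl hx.1, clamp_lo hkl ((show w (x + z) ≤ k0 from hz.1).trans (kge j)), abs_sub_comm]
          exact le_abs_self _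
    have dis : volume.real (⋃ i ∈ Finset.range m, (mid w (kk (2 * i)) (kk (2 * i + 1)) ∩ ball (0 : E) 1)) =
        ∑ i ∈ Finset.range m, volume.real (mid w (kk (2 * i)) (kk (2 * i + 1)) ∩ ball (0 : E) 1) := by
      refine measureReal_biUnion_finset ?_ (fun i _ => (mid_meas wm _ _).inter measurableSet_ball) (fun i _ => fin_ball _ _)
      have aux : ∀ i j, i < j → Disjoint (mid w (kk (2 * i)) (kk (2 * i + 1)) ∩ ball (0 : E) 1)
          (mid w (kk (2 * j)) (kk (2 * j + 1)) ∩ ball (0 : E) 1) := fun i j hij => by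
        rw [Set.disjoint_left]
        intro x hx hx'
        have h1 := hx.1.2
        have h2 := hx'.1.1
        have h3 := kst (2 * i + 1)
        have h4 := kmono (show 2 * i + 1 + 1 ≤ 2 * j by omega)
        linarith
      intro i _ j _ hij
      rcases lt_or_gt_of_ne hij with h | h
      · exact aux i j h
      · exact (aux j i h).symm
    have le1 : ∑ i ∈ Finset.range m, volume.real (mid w (kk (2 * i)) (kk (2 * i + 1)) ∩ ball (0 : E) 1) ≤ ω := by
      rw [← dis]
      exact vr_mono (iUnion₂_subset fun i _ => inter_subset_right) Subset.rfl
    have le2 : (m : ℝ) * (8 * σ * ν * ν' / ω / 2) ≤ ω := by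
      refine le_trans ?_ le1
      have := Finset.card_nsmul_le_sum (Finset.range m)
        (fun i => volume.real (mid w (kk (2 * i)) (kk (2 * i + 1)) ∩ ball (0 : E) 1)) _
        (fun i hi => c (2 * i) (by have := Finset.mem_range.1 hi; omega))
      rwa [Finset.card_range, nsmul_eq_mul] at this
    rw [div_lt_iff₀ (by positivity)] at hm
    linarith
  set Dm := D * 2⁻¹ ^ (2 * m) with hDm
  have Dp : 0 < Dm := by positivity
  have fin := H w wm (kk (2 * m)) Dm (Dm / 2) Dp (by linarith) (by
    intro k l D r R s z a1 a2 a3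
    exact hw k l D r R s z ((kge _).trans a1) a2 (a3.trans (by linarith [k1 (2 * m)]))) (hwD' _) main
  filter_upwards [fin] with x hx hb
  refine (hx hb).trans_eq ?_
  simp only [hkk, hDm, pow_succ]; ring

end dg3
end AP

namespace AP
set_option linter.unusedSectionVars false
open Filter
open scoped Topology Gradient NNReal
section reg
variable {E : Type*} [NormedAddCommGroup E] [InnerProductSpace ℝ E] [FiniteDimensional ℝ E]
  [MeasureSpace E] [BorelSpace E] [(volume : Measure E).IsAddHaarMeasure] [Nontrivial E]
variable {p ε : ℝ}

theorem ae_sc {P : E → Prop} (h : ∀ᵐ x : E, P x) (y : E) {s : ℝ} (hs : s ≠ 0) : ∀ᵐ x : E, P (y + s • x) := by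
  have h1 : ∀ᵐ x : E, P (y + x) := (measurePreserving_add_left volume y).quasiMeasurePreserving.ae h
  rw [ae_iff] at h1 ⊢
  have : {a : E | ¬P (y + s • a)} = (fun x => s • x) ⁻¹' {a | ¬P (y + a)} := rfl
  rw [this, Measure.addHaar_preimage_smul _ hs, h1, mul_zero]

noncomputable def sc (h : E → ℝ) (y : E) (s : ℝ) (x : E) : ℝ := s⁻¹ * h (y + s • x)
theorem grad_sc (h : E → ℝ) (y : E) {s : ℝ} (hs : s ≠ 0) (x : E) : ∇ (sc h y s) x = ∇ h (y + s • x) := by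
  unfold sc
  rw [grad_smul, grad_scale, smul_smul, inv_mul_cancel₀ hs, one_smul]

theorem mem_sc {y x : E} {s : ℝ} (hs : 0 < s) (hx : x ∈ ball (0 : E) 1) : y + s • x ∈ ball y s := by
  rw [mem_ball_zero_iff] at hx
  rw [mem_ball, dist_eq_norm, add_sub_cancel_left, norm_smul, Real.norm_of_nonneg hs.le]
  nlinarith
theorem sub_sc {y : E} {s : ℝ} (hy : ‖y‖ + s ≤ 1) : ball y s ⊆ ball (0 : E) 1 :=
  ball_subset_ball' (by rw [dist_zero_right]; linarith)

theorem Sol.sc {h : E → ℝ} (hs : Sol p ε h) {y : E} {s : ℝ} (h0 : 0 < s) (hy : ‖y‖ + s ≤ 1) : Sol p ε (sc h y s) := by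
  refine ⟨(hs.1.scale y s).smul _, fun φ hφ φ0 => ?_⟩
  set ψ : E → ℝ := fun x => φ (-(s⁻¹ • y) + s⁻¹ • x) with hψ
  have e1 : ∀ x, -(s⁻¹ • y) + s⁻¹ • (y + s • x) = x := fun x => by
    rw [smul_add, smul_smul, inv_mul_cancel₀ h0.ne', one_smul, neg_add_cancel_left]
  have ψL : Lip ψ := hφ.scale _ _
  have ψ0 : ∀ x, x ∉ ball (0 : E) 1 → ψ x = 0 := fun x hx => φ0 _ fun hb => hx (by
    have := sub_sc hy (mem_sc h0 hb)
    rwa [smul_add, smul_neg, smul_smul, mul_inv_cancel₀ h0.ne', one_smul, smul_smul, mul_inv_cancel₀ h0.ne', one_smul,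
      add_neg_cancel_left] at this)
  have h1 := hs.2 ψ ψL ψ0
  rw [setIntegral_eq_integral_of_ae_compl_eq_zero] at h1 ⊢
  · have h2 := Measure.integral_comp_smul (μ := (volume : Measure E)) (fun x => ⟪Aop p ε (∇ h (y + x)), ∇ ψ (y + x)⟫_ℝ) s
    rw [integral_add_left_eq_self (μ := (volume : Measure E)) (fun x => ⟪Aop p ε (∇ h x), ∇ ψ x⟫_ℝ) y, h1, smul_zero] at h2
    have h3 : ∀ x, ∇ ψ (y + s • x) = s⁻¹ • ∇ φ x := fun x => by rw [hψ, grad_scale, e1]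
    simp only [h3, inner_smul_right, integral_const_mul] at h2
    simp only [grad_sc h y h0.ne']
    exact (mul_eq_zero.1 h2).resolve_left (inv_ne_zero h0.ne')
  · filter_upwards [grad_off φ0] with x hx hb
    rw [hx hb, inner_zero_right]
  · filter_upwards [grad_off ψ0] with x hx hb
    rw [hx hb, inner_zero_right]

def Ds (E : Type*) [NormedAddCommGroup E] [InnerProductSpace ℝ E] [FiniteDimensional ℝ E] : Set E :=
  range (stdOrthonormalBasis ℝ E) ∪ range (fun i => -stdOrthonormalBasis ℝ E i)
theorem Ds_fin : (Ds E).Finite := (finite_range _).union (finite_range _)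
theorem Ds_norm {e : E} (he : e ∈ Ds E) : ‖e‖ = 1 := by
  rcases he with ⟨i, rfl⟩ | ⟨i, rfl⟩ <;> simp
theorem Ds_neg {e : E} (he : e ∈ Ds E) : -e ∈ Ds E := by
  rcases he with ⟨i, rfl⟩ | ⟨i, rfl⟩
  · exact Or.inr ⟨i, rfl⟩
  · exact Or.inl ⟨i, by simp⟩
theorem Ds_bd {ξ : E} {g : ℝ} (h : ∀ e ∈ Ds E, ⟪ξ, e⟫_ℝ ≤ g) : ‖ξ‖ ≤ Module.finrank ℝ E * g := by
  rw [← (stdOrthonormalBasis ℝ E).sum_repr' ξ]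
  refine (norm_sum_le _ _).trans ((Finset.sum_le_card_nsmul _ _ g fun i _ => ?_).trans_eq (by simp))
  rw [norm_smul, OrthonormalBasis.norm_eq_one, mul_one, Real.norm_eq_abs, real_inner_comm, abs_le]
  have h1 := h _ (Or.inl ⟨i, rfl⟩)
  have h2 := h _ (Or.inr ⟨i, rfl⟩)
  rw [inner_neg_right] at h2
  constructor <;> linarith
theorem ae_Ds {P : E → E → Prop} (h : ∀ e ∈ Ds E, ∀ᵐ x : E, P e x) : ∀ᵐ x : E, ∀ e ∈ Ds E, P e x :=
  (ae_ball_iff Ds_fin.countable).2 h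

/-- componentwise bound of the gradient -/
def cb (h : E → ℝ) (g : ℝ) : Prop := ∀ e ∈ Ds E, ∀ᵐ x : E, x ∈ ball (0 : E) 1 → ⟪∇ h x, e⟫_ℝ ≤ g

noncomputable def KK (E : Type*) [NormedAddCommGroup E] [InnerProductSpace ℝ E] (p : ℝ) : ℝ :=
  64 * p ^ 2 * (2 * (4 * (Module.finrank ℝ E : ℝ)) ^ (p - 2) + 1)
theorem KK_nn : 0 ≤ KK E p := by unfold KK; positivity

theorem cb_DG (hp : 2 ≤ p) (hε : 0 < ε) {h : E → ℝ} (hs : Sol p ε h) {g : ℝ} (hg : 0 < g) (hc : cb h g) {e : E}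
    (he : e ∈ Ds E) {k0 k1 : ℝ}
    (hk : ∀ᵐ x : E, x ∈ ball (0 : E) 1 → k0 ≤ ⟪∇ h x, e⟫_ℝ → ⟪∇ h x, e⟫_ℝ ≤ k1 → g / 4 ≤ ‖∇ h x‖) :
    DG (fun x => ⟪∇ h x, e⟫_ℝ) k0 k1 (KK E p) := by
  refine sol_DG hp hε hs (Ds_norm he) (G := Module.finrank ℝ E * g) (g := g / 4) ?_ (by positivity) hk ?_
  · filter_upwards [ae_Ds hc] with x hx hb
    exact Ds_bd fun e he => hx e he hb
  · have : (Module.finrank ℝ E * g : ℝ) ^ (p - 2) = (4 * (Module.finrank ℝ E : ℝ)) ^ (p - 2) * (g / 4) ^ (p - 2) := by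
      rw [← Real.mul_rpow (by positivity) (by positivity)]; congr 1; ring
    rw [this]
    have a : 0 ≤ (4 * (Module.finrank ℝ E : ℝ)) ^ (p - 2) := by positivity
    have b : 0 ≤ (g / 4) ^ (p - 2) := by positivity
    nlinarith [mul_nonneg a hε.le]

theorem ab_norm {e ξ : E} (he : e ∈ Ds E) {t : ℝ} (h : t ≤ |⟪ξ, e⟫_ℝ|) : t ≤ ‖ξ‖ := by
  have := abs_real_inner_le_norm ξ e
  rw [Ds_norm he, mul_one] at this
  exact h.trans this

/-- restriction to the smaller ball through scaling -/
theorem sc_ae {h : E → ℝ} {P : E → Prop} {s r : ℝ} (h0 : 0 < s) :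
    (∀ᵐ x : E, x ∈ ball (0 : E) r → P (∇ (sc h 0 s) x)) ↔ ∀ᵐ x : E, x ∈ ball (0 : E) (s * r) → P (∇ h x) := by
  constructor <;> intro H
  · filter_upwards [ae_sc H 0 (inv_ne_zero h0.ne')] with x hx hb
    rw [grad_sc _ _ h0.ne', zero_add, zero_add, smul_smul, mul_inv_cancel₀ h0.ne', one_smul] at hx
    refine hx ?_
    rw [mem_ball_zero_iff] at hb ⊢
    rw [norm_smul, norm_inv, Real.norm_of_nonneg h0.le, inv_mul_lt_iff₀ h0]; exact hb
  · filter_upwards [ae_sc H 0 h0.ne'] with x hx hb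
    rw [grad_sc _ _ h0.ne']
    refine hx ?_
    rw [mem_ball_zero_iff] at hb ⊢
    rw [zero_add, norm_smul, Real.norm_of_nonneg h0.le]
    exact mul_lt_mul_of_pos_left hb h0

theorem meas_comp (h : E → ℝ) (e : E) : Measurable fun x => ⟪∇ h x, e⟫_ℝ := (meas_grad h).inner measurable_const

def Osc (h : E → ℝ) (r D : ℝ) : Prop := ∀ e ∈ Ds E, ∃ a : ℝ, ∀ᵐ x : E, x ∈ ball (0 : E) r → a ≤ ⟪∇ h x, e⟫_ℝ ∧ ⟪∇ h x, e⟫_ℝ ≤ a + D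

/-- one step alternatives -/
theorem alternatives (hp : 2 ≤ p) : ∃ θ : ℝ, 1 / 2 < θ ∧ θ < 1 ∧ ∃ ν : ℝ, 0 < ν ∧
    (∀ (ε : ℝ) (h : E → ℝ) (g : ℝ), 0 < ε → Sol p ε h → 0 < g → cb h g →
      ((∀ᵐ x : E, x ∈ ball (0 : E) (1 / 32) → g / 4 ≤ ‖∇ h x‖) ∨ cb (sc h 0 (1 / 32)) (θ * g)) ∧
      (∀ D, 0 < D → (∀ᵐ x : E, x ∈ ball (0 : E) 1 → g / 4 ≤ ‖∇ h x‖) → Osc h 1 D → Osc h (1 / 32) (θ * D)) ∧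
      (∀ e ∈ Ds E, volume.real ({x | g / 2 ≤ ⟪∇ h x, e⟫_ℝ} ∩ ball (0 : E) (1 / 16)) ≤ ν →
        ∀ᵐ x : E, x ∈ ball (0 : E) (1 / 32) → ⟪∇ h x, e⟫_ℝ ≤ 3 / 4 * g)) := by
  obtain ⟨ν₁, hν₁, H1⟩ := dg1 (E := E) (KK_nn (p := p) (E := E))
  set V := volume.real (ball (0 : E) (1 / 16)) with hV
  have V0 : 0 < V := ball_vpos (by norm_num)
  set ν := min ν₁ (V / 2) with hν
  have ν0 : 0 < ν := lt_min hν₁ (half_pos V0)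
  obtain ⟨η, η0, η1, H2⟩ := dgL (E := E) (KK_nn (p := p) (E := E)) ν0
  refine ⟨1 - η / 2, by linarith, by linarith, ν, ν0, ?_⟩
  intro ε h g hε hs hg hc
  have mu : (0 : ℝ) < 1 / 32 := by norm_num
  refine ⟨?_, ?_, ?_⟩
  · by_cases hA : ∃ e ∈ Ds E, volume.real ({x | ⟪∇ h x, e⟫_ℝ ≤ g / 2} ∩ ball (0 : E) (1 / 16)) ≤ ν
    · left
      obtain ⟨e, he, hA⟩ := hA
      have := H1 (fun x => ⟪∇ h x, -e⟫_ℝ) (meas_comp h _) (-(g / 2)) (3 / 2 * g) (g / 4) (by positivity) (by linarith)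
        (cb_DG hp hε hs hg hc (Ds_neg he) (Eventually.of_forall fun x _ h1 h2 => ab_norm (Ds_neg he)
          (le_trans (by linarith) (neg_le_abs _))))
        (by filter_upwards [hc _ (Ds_neg he)] with x hx hb; linarith [hx hb])
        (by simpa only [inner_neg_right, neg_le_neg_iff] using hA.trans (min_le_left _ _))
      filter_upwards [this] with x hx hb
      have := hx hb
      rw [inner_neg_right] at this
      exact ab_norm he (le_trans (by linarith) (le_abs_self _))
    · right
      intro e he
      have hA' : ν ≤ volume.real ({x | ⟪∇ h x, e⟫_ℝ ≤ g / 2} ∩ ball (0 : E) (1 / 16)) := by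
        by_contra hcon
        exact hA ⟨e, he, (not_le.1 hcon).le⟩
      have := H2 (fun x => ⟪∇ h x, e⟫_ℝ) (meas_comp h _) (g / 2) (g / 2) (by positivity)
        (cb_DG hp hε hs hg hc he (Eventually.of_forall fun x _ h1 h2 => ab_norm he
          (le_trans (by linarith) (le_abs_self _))))
        (by filter_upwards [hc _ he] with x hx hb; linarith [hx hb]) hA'
      refine (sc_ae (P := fun ξ => ⟪ξ, e⟫_ℝ ≤ _) mu).2 ?_
      rw [mul_one]
      filter_upwards [this] with x hx hb
      linarith [hx hb]
  · intro D hD hnd ho e he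
    obtain ⟨a, ha⟩ := ho e he
    have dgA : ∀ e ∈ Ds E, ∀ k0 k1, DG (fun x => ⟪∇ h x, e⟫_ℝ) k0 k1 (KK E p) := fun e he k0 k1 =>
      cb_DG hp hε hs hg hc he (by filter_upwards [hnd] with x hx hb _ _; exact hx hb)
    have cov : V ≤ volume.real ({x | ⟪∇ h x, e⟫_ℝ ≤ a + D / 2} ∩ ball (0 : E) (1 / 16)) +
        volume.real ({x | ⟪∇ h x, -e⟫_ℝ ≤ -(a + D / 2)} ∩ ball (0 : E) (1 / 16)) := by
      refine (measureReal_mono (fun x hx => ?_) (measure_union_ne_top (fin_ball _ _) (fin_ball _ _))).trans (measureReal_union_le _ _)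
      rcases le_total (⟪∇ h x, e⟫_ℝ) (a + D / 2) with h1 | h1
      · exact Or.inl ⟨h1, hx⟩
      · exact Or.inr ⟨by simpa only [inner_neg_right, mem_setOf_eq, neg_le_neg_iff] using h1, hx⟩
    have νV : ν ≤ V / 2 := min_le_right _ _
    rcases le_total (V / 2) (volume.real ({x | ⟪∇ h x, e⟫_ℝ ≤ a + D / 2} ∩ ball (0 : E) (1 / 16))) with h1 | h1
    · have := H2 (fun x => ⟪∇ h x, e⟫_ℝ) (meas_comp h _) (a + D / 2) (D / 2) (by positivity) (dgA e he _ _)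
        (by filter_upwards [ha] with x hx hb; linarith [(hx hb).2]) (νV.trans h1)
      refine ⟨a, ?_⟩
      filter_upwards [this, ha] with x hx hx' hb
      exact ⟨(hx' (ball_subset_ball (by norm_num) hb)).1, by linarith [hx hb]⟩
    · have := H2 (fun x => ⟪∇ h x, -e⟫_ℝ) (meas_comp h _) (-(a + D / 2)) (D / 2) (by positivity) (dgA _ (Ds_neg he) _ _)
        (by filter_upwards [ha] with x hx hb; rw [inner_neg_right]; linarith [(hx hb).1]) (νV.trans (by linarith))
      refine ⟨a + η / 2 * D, ?_⟩
      filter_upwards [this, ha] with x hx hx' hb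
      have := hx hb
      rw [inner_neg_right] at this
      exact ⟨by linarith, by linarith [(hx' (ball_subset_ball (by norm_num) hb)).2]⟩
  · intro e he hA
    have := H1 (fun x => ⟪∇ h x, e⟫_ℝ) (meas_comp h _) (g / 2) (g / 2) (g / 4) (by positivity) (by linarith)
      (cb_DG hp hε hs hg hc he (Eventually.of_forall fun x _ h1 h2 => ab_norm he
          (le_trans (by linarith) (le_abs_self _))))
      (by filter_upwards [hc _ he] with x hx hb; linarith [hx hb]) (hA.trans (min_le_left _ _))
    filter_upwards [this] with x hx hb
    linarith [hx hb]

theorem osc_sc {h : E → ℝ} {s r D : ℝ} (h0 : 0 < s) : Osc (sc h 0 s) r D ↔ Osc h (s * r) D := by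
  refine forall₂_congr fun e he => exists_congr fun a => ?_
  exact sc_ae (P := fun ξ => a ≤ ⟪ξ, e⟫_ℝ ∧ ⟪ξ, e⟫_ℝ ≤ a + D) h0

theorem osc_decay (hp : 2 ≤ p) : ∃ θ : ℝ, 1 / 2 < θ ∧ θ < 1 ∧ ∀ (ε : ℝ) (m : ℕ) (h : E → ℝ) (g : ℝ), 0 < ε → Sol p ε h → 0 < g →
    cb h g → Osc h ((1 / 32) ^ m) (4 * θ ^ m * g) := by
  obtain ⟨θ, θ0, θ1, ν, hν, H⟩ := alternatives (E := E) hp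
  refine ⟨θ, θ0, θ1, ?_⟩
  intro ε m
  have mu : (0 : ℝ) < 1 / 32 := by norm_num
  have nd : ∀ (m : ℕ) (h : E → ℝ) (g D : ℝ), 0 < ε → Sol p ε h → 0 < g → cb h g → 0 < D →
      (∀ᵐ x : E, x ∈ ball (0 : E) 1 → g / 4 ≤ ‖∇ h x‖) → Osc h 1 D → Osc h ((1 / 32) ^ m) (θ ^ m * D) := by
    intro m
    induction m with
    | zero => intro h g D _ _ _ _ _ _ ho; simpa using ho
    | succ m ih =>
      intro h g D hε hs hg hc hD hn ho
      have h1 := (H ε h g hε hs hg hc).2.1 D hD hn ho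
      have := ih (sc h 0 (1 / 32)) g (θ * D) hε (hs.sc mu (by norm_num)) hg
        (fun e he => (sc_ae (P := fun ξ => ⟪ξ, e⟫_ℝ ≤ g) mu).2 (by
          filter_upwards [hc e he] with x hx hb; exact hx (ball_subset_ball (by norm_num) hb))) (by positivity)
        ((sc_ae (P := fun ξ => g / 4 ≤ ‖ξ‖) mu).2 (by
          filter_upwards [hn] with x hx hb; exact hx (ball_subset_ball (by norm_num) hb)))
        ((osc_sc mu).2 (by rwa [mul_one]))
      rw [osc_sc mu, ← pow_succ'] at this
      have e : θ ^ (m + 1) * D = θ ^ m * (θ * D) := by ring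
      rw [e]; exact this
  have o1 : ∀ (h : E → ℝ) (g : ℝ), cb h g → Osc h 1 (2 * g) := fun h g hc e he => ⟨-g, by
    filter_upwards [hc e he, hc _ (Ds_neg he)] with x h1 h2 hb
    have h2 := h2 hb
    rw [inner_neg_right] at h2
    exact ⟨by linarith, by linarith [h1 hb]⟩⟩
  have omono : ∀ (h : E → ℝ) (r D D' : ℝ), D ≤ D' → Osc h r D → Osc h r D' := fun h r D D' hD ho e he => by
    obtain ⟨a, ha⟩ := ho e he
    refine ⟨a, ?_⟩
    filter_upwards [ha] with x hx hb
    exact ⟨(hx hb).1, by linarith [(hx hb).2]⟩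
  induction m with
  | zero =>
    intro h g _ _ hg hc
    rw [pow_zero, pow_zero]
    exact omono _ _ _ _ (by linarith) (o1 h g hc)
  | succ m ih =>
    intro h g hε hs hg hc
    have tm : 0 < θ ^ m := by positivity
    rcases (H ε h g hε hs hg hc).1 with hA | hB
    · have hc' : cb (sc h 0 (1 / 32)) g := fun e he => (sc_ae (P := fun ξ => ⟪ξ, e⟫_ℝ ≤ g) mu).2 (by
          filter_upwards [hc e he] with x hx hb; exact hx (ball_subset_ball (by norm_num) hb))
      have := nd m (sc h 0 (1 / 32)) g (2 * g) hε (hs.sc mu (by norm_num)) hg hc' (by positivity)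
        ((sc_ae (P := fun ξ => g / 4 ≤ ‖ξ‖) mu).2 (by rwa [mul_one])) (o1 _ _ hc')
      rw [osc_sc mu, ← pow_succ'] at this
      refine omono _ _ _ _ ?_ this
      rw [pow_succ]
      nlinarith [mul_pos tm hg]
    · have := ih (sc h 0 (1 / 32)) (θ * g) hε (hs.sc mu (by norm_num)) (by positivity) hB
      rw [osc_sc mu, ← pow_succ'] at this
      refine omono _ _ _ _ (le_of_eq ?_) this
      ring

end reg
end AP

namespace AP
set_option linter.unusedSectionVars false
open Filter
open scoped Topology Gradient NNReal
section sup
variable {E : Type*} [NormedAddCommGroup E] [InnerProductSpace ℝ E] [FiniteDimensional ℝ E]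
  [MeasureSpace E] [BorelSpace E] [(volume : Measure E).IsAddHaarMeasure] [Nontrivial E]
variable {p ε : ℝ}

theorem cv (f : E → ℝ) (y : E) {s : ℝ} (hs : 0 < s) (r : ℝ) :
    ∫ x in ball (0 : E) r, f (y + s • x) = (s ^ Module.finrank ℝ E)⁻¹ * ∫ x in ball y (s * r), f x := by
  rw [← integral_indicator measurableSet_ball, ← integral_indicator measurableSet_ball]
  have h2 := Measure.integral_comp_smul (μ := (volume : Measure E)) (fun x => (ball y (s * r)).indicator f (y + x)) s
  rw [integral_add_left_eq_self (μ := (volume : Measure E)) (fun x => (ball y (s * r)).indicator f x) y,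
    abs_of_pos (by positivity), smul_eq_mul] at h2
  rw [← h2]
  refine integral_congr_ae (Eventually.of_forall fun x => ?_)
  have : (x ∈ ball (0 : E) r) ↔ y + s • x ∈ ball y (s * r) := by
    rw [mem_ball_zero_iff, mem_ball, dist_eq_norm, add_sub_cancel_left, norm_smul, Real.norm_of_nonneg hs.le,
      mul_lt_mul_iff_right₀ hs]
  by_cases hx : x ∈ ball (0 : E) r
  · beta_reduce; rw [indicator_of_mem hx, indicator_of_mem (this.1 hx)]
  · beta_reduce; rw [indicator_of_notMem hx, indicator_of_notMem (fun h => hx (this.2 h))]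

theorem ae_at {P : E → Prop} {h : E → ℝ} {y : E} {s r : ℝ} (h0 : 0 < s)
    (H : ∀ᵐ x : E, x ∈ ball (0 : E) r → P (∇ (sc h y s) x)) : ∀ᵐ x : E, x ∈ ball y (s * r) → P (∇ h x) := by
  filter_upwards [ae_sc H (-(s⁻¹ • y)) (inv_ne_zero h0.ne')] with x hx hb
  rw [grad_sc _ _ h0.ne', smul_add, smul_neg, smul_smul, smul_smul, mul_inv_cancel₀ h0.ne', one_smul, one_smul,
    add_neg_cancel_left] at hx
  refine hx ?_
  rw [mem_ball, dist_eq_norm] at hb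
  rw [mem_ball_zero_iff, ← smul_neg, ← smul_add, neg_add_eq_sub, norm_smul, norm_inv, Real.norm_of_nonneg h0.le,
    inv_mul_lt_iff₀ h0]
  exact hb

theorem int_gp (hp : 2 ≤ p) {h : E → ℝ} (hh : Lip h) (y : E) (r : ℝ) : IntegrableOn (fun x => ‖∇ h x‖ ^ p) (ball y r) := by
  obtain ⟨K, K0, -, hK⟩ := hh.ex
  refine ibd ((meas_grad h).norm.pow_const p) (C := K ^ p) (fun x => ?_) y r
  rw [abs_of_nonneg (by positivity)]
  exact Real.rpow_le_rpow (norm_nonneg _) (hK x) (by linarith)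

def Wt (p : ℝ) (h : E → ℝ) (S : ℝ) : Prop := ∀ᵐ y : E, y ∈ ball (0 : E) 1 → ∀ e ∈ Ds E,
  (1 - ‖y‖) ^ Module.finrank ℝ E * (max ⟪∇ h y, e⟫_ℝ 0) ^ p ≤ S

theorem ex_a (n : ℕ) : ∃ a : ℝ, 0 < a ∧ a ≤ 1 / 2 ∧ (1 + a) ^ n ≤ 4 / 3 * (1 - a) ^ n := by
  have h1 : ContinuousAt (fun a : ℝ => 4 / 3 * (1 - a) ^ n - (1 + a) ^ n) 0 := by fun_prop
  have h2 := h1.eventually_const_lt (u := 0) (by norm_num)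
  obtain ⟨r, hr, H⟩ := Metric.eventually_nhds_iff.1 h2
  refine ⟨min (r / 2) (1 / 2), by positivity, min_le_right _ _, ?_⟩
  have h0 : 0 < min (r / 2) (1 / 2) := by positivity
  have := @H (min (r / 2) (1 / 2)) (by
    rw [Real.dist_0_eq_abs, abs_of_pos h0]; linarith [min_le_left (r / 2) (1 / 2)])
  linarith

theorem sup_step (hp : 2 ≤ p) : ∃ C : ℝ, 0 < C ∧ ∀ (ε : ℝ) (h : E → ℝ) (S J : ℝ), 0 < ε → Sol p ε h → 0 < S →
    ∫ x in ball (0 : E) 1, ‖∇ h x‖ ^ p ≤ J → Wt p h S → S ≤ C * J ∨ Wt p h (3 / 4 * S) := by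
  obtain ⟨_, _, _, ν, hν, H⟩ := alternatives (E := E) hp
  set n := Module.finrank ℝ E with hn
  obtain ⟨a, a0, a1, a2⟩ := ex_a n
  have hp0 : 0 < p := by linarith
  refine ⟨2 ^ p / ν * ((1 - a) / a) ^ n, by have : 0 < 1 - a := by linarith
                                            positivity, ?_⟩
  intro ε h S J hε hs hS hJ hW
  by_contra! hcon
  obtain ⟨hc1, hc2⟩ := hcon
  apply hc2
  have loc : ∀ y ∈ ball (0 : E) 1, ∃ ρ > 0, ∀ᵐ x : E, x ∈ ball y ρ → ∀ e ∈ Ds E,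
      (1 - ‖x‖) ^ n * (max ⟪∇ h x, e⟫_ℝ 0) ^ p ≤ 3 / 4 * S := by
    intro y hy
    rw [mem_ball_zero_iff] at hy
    set t := 1 - ‖y‖ with ht
    have t0 : 0 < t := by linarith
    set s := a * t with hs'
    have s0 : 0 < s := by positivity
    have b0 : 0 < 1 - a := by linarith
    have b1 : 0 < (1 - a) * t := by positivity
    set Q := S / ((1 - a) * t) ^ n with hQ
    have Q0 : 0 < Q := by positivity
    set g := Q ^ (1 / p) with hg
    have g0 : 0 < g := by positivity
    have gp : g ^ p = Q := by
      rw [hg, ← Real.rpow_mul Q0.le, one_div, inv_mul_cancel₀ hp0.ne', Real.rpow_one]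
    have hys : ‖y‖ + s ≤ 1 := by nlinarith
    have nz : ∀ x : E, x ∈ ball y s → |‖x‖ - ‖y‖| < s := fun x hx => by
      rw [mem_ball, dist_eq_norm] at hx
      exact (abs_norm_sub_norm_le x y).trans_lt hx
    have hcb : cb (sc h y s) g := by
      intro e he
      filter_upwards [ae_sc hW y s0.ne'] with x hx hb
      rw [grad_sc _ _ s0.ne']
      have hm := mem_sc (y := y) s0 hb
      have h1 := hx (sub_sc hys hm) e he
      have h2 : (1 - a) * t ≤ 1 - ‖y + s • x‖ := by
        have := abs_lt.1 (nz _ hm)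
        nlinarith
      have h3 : ((1 - a) * t) ^ n * (max ⟪∇ h (y + s • x), e⟫_ℝ 0) ^ p ≤ S :=
        (mul_le_mul_of_nonneg_right (pow_le_pow_left₀ b1.le h2 n) (by positivity)).trans h1
      have h4 : (max ⟪∇ h (y + s • x), e⟫_ℝ 0) ^ p ≤ g ^ p := by
        rw [gp, hQ, le_div_iff₀ (by positivity), mul_comm]; exact h3
      exact (le_max_left _ _).trans ((Real.rpow_le_rpow_iff (le_max_right _ _) g0.le hp0).1 h4)
    have alt := (H ε (sc h y s) g hε (hs.sc s0 hys) g0 hcb).2.2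
    have meas : ∀ e ∈ Ds E, volume.real ({x | g / 2 ≤ ⟪∇ (sc h y s) x, e⟫_ℝ} ∩ ball (0 : E) (1 / 16)) ≤ ν := by
      intro e he
      by_contra! hlt
      have i1 : IntegrableOn (fun x => ‖∇ (sc h y s) x‖ ^ p) (ball (0 : E) 1) := int_gp hp (hs.sc s0 hys).1 _ _
      set A := {x | g / 2 ≤ ⟪∇ (sc h y s) x, e⟫_ℝ} ∩ ball (0 : E) (1 / 16) with hA
      have mA : MeasurableSet A := (measurableSet_le measurable_const (meas_comp _ _)).inter measurableSet_ball
      have AB : A ⊆ ball (0 : E) 1 := fun x hx => ball_subset_ball (by norm_num) hx.2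
      have e1 : volume.real A * (g / 2) ^ p ≤ ∫ x in A, ‖∇ (sc h y s) x‖ ^ p := by
        rw [← smul_eq_mul, ← setIntegral_const]
        refine setIntegral_mono_on (integrableOn_const (fin_sub AB)) (i1.mono_set AB) mA fun x hx => ?_
        exact Real.rpow_le_rpow (by positivity) (ab_norm he (le_trans hx.1 (le_abs_self _))) hp0.le
      have e2 : ∫ x in A, ‖∇ (sc h y s) x‖ ^ p ≤ ∫ x in ball (0 : E) 1, ‖∇ (sc h y s) x‖ ^ p :=
        setIntegral_mono_set i1 (Eventually.of_forall fun x => by dsimp; positivity) AB.eventuallyLE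
      have e3 : ∫ x in ball (0 : E) 1, ‖∇ (sc h y s) x‖ ^ p = (s ^ n)⁻¹ * ∫ x in ball y s, ‖∇ h x‖ ^ p := by
        simp only [grad_sc _ _ s0.ne']
        rw [cv (fun x => ‖∇ h x‖ ^ p) y s0 1, mul_one]
      have e4 : ∫ x in ball y s, ‖∇ h x‖ ^ p ≤ ∫ x in ball (0 : E) 1, ‖∇ h x‖ ^ p :=
        setIntegral_mono_set (int_gp hp hs.1 _ _) (Eventually.of_forall fun x => by dsimp; positivity)
          (sub_sc hys).eventuallyLE
      have e5 : ν * (g / 2) ^ p ≤ (s ^ n)⁻¹ * J := by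
        have : 0 < (s ^ n)⁻¹ := by positivity
        have : 0 < (g / 2) ^ p := by positivity
        calc ν * (g / 2) ^ p ≤ volume.real A * (g / 2) ^ p := by nlinarith
          _ ≤ (s ^ n)⁻¹ * ∫ x in ball y s, ‖∇ h x‖ ^ p := by rw [← e3]; exact e1.trans e2
          _ ≤ _ := by gcongr; exact e4.trans hJ
      rw [Real.div_rpow g0.le (by norm_num), gp, hQ, hs', mul_pow, mul_pow] at e5
      refine absurd hc1 (not_lt.2 ?_)
      have h2p : (0 : ℝ) < 2 ^ p := by positivity
      rw [div_pow]
      calc S = (ν * (S / ((1 - a) ^ n * t ^ n) / 2 ^ p)) * (2 ^ p / ν * ((1 - a) ^ n * t ^ n)) := by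
            field_simp
        _ ≤ ((a ^ n * t ^ n)⁻¹ * J) * (2 ^ p / ν * ((1 - a) ^ n * t ^ n)) := by gcongr
        _ = _ := by field_simp
    refine ⟨s * (1 / 32), by positivity, ?_⟩
    have A := ae_Ds fun e he => ae_at (P := fun ξ => ⟪ξ, e⟫_ℝ ≤ 3 / 4 * g) s0 (alt e he (meas e he))
    filter_upwards [A] with x hx hb e he
    have h1 := hx e he hb
    have h2 := abs_lt.1 (nz x (ball_subset_ball (by linarith) hb))
    have h3 : (max ⟪∇ h x, e⟫_ℝ 0) ^ p ≤ 9 / 16 * Q := by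
      calc (max ⟪∇ h x, e⟫_ℝ 0) ^ p ≤ (3 / 4 * g) ^ p :=
            Real.rpow_le_rpow (le_max_right _ _) (max_le h1 (by positivity)) hp0.le
        _ = (3 / 4) ^ p * Q := by rw [Real.mul_rpow (by norm_num) g0.le, gp]
        _ ≤ (3 / 4) ^ (2 : ℝ) * Q := by
            gcongr ?_ * _
            exact Real.rpow_le_rpow_of_exponent_ge (by norm_num) (by norm_num) hp
        _ = _ := by norm_num
    have h5 : 0 ≤ 1 - ‖x‖ := by nlinarith
    calc (1 - ‖x‖) ^ n * (max ⟪∇ h x, e⟫_ℝ 0) ^ p ≤ ((1 + a) * t) ^ n * (9 / 16 * Q) := by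
          gcongr; nlinarith
      _ ≤ (4 / 3 * (1 - a) ^ n * t ^ n) * (9 / 16 * Q) := by
          rw [mul_pow]; gcongr
      _ = _ := by rw [hQ, mul_pow]; field_simp; norm_num
  have : volume {x : E | ¬ (x ∈ ball (0 : E) 1 → ∀ e ∈ Ds E, (1 - ‖x‖) ^ n * (max ⟪∇ h x, e⟫_ℝ 0) ^ p ≤ 3 / 4 * S)} = 0 := by
    refine measure_null_of_locally_null _ fun y hy => ?_
    have hy' : y ∈ ball (0 : E) 1 := by by_contra hc; exact hy fun h => absurd h hc
    obtain ⟨ρ, ρ0, hρ⟩ := loc y hy'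
    refine ⟨_, ?_, hρ⟩
    filter_upwards [self_mem_nhdsWithin, mem_nhdsWithin_of_mem_nhds (ball_mem_nhds y ρ0)] with x h1 h2 h3
    exact h1 fun _ => h3 h2
  exact this

end sup
end AP

namespace AP
set_option linter.unusedSectionVars false
open Filter
open scoped Topology Gradient NNReal
section T
variable {E : Type*} [NormedAddCommGroup E] [InnerProductSpace ℝ E] [FiniteDimensional ℝ E]
  [MeasureSpace E] [BorelSpace E] [(volume : Measure E).IsAddHaarMeasure] [Nontrivial E]
variable {p ε : ℝ}

theorem ae_ex {P : E → Prop} {y : E} {r : ℝ} (hr : 0 < r) (h : ∀ᵐ x : E, x ∈ ball y r → P x) : ∃ x ∈ ball y r, P x := by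
  by_contra! hc
  have : volume (ball y r) ≤ 0 := by
    rw [ae_iff] at h
    rw [← h]
    exact measure_mono fun x hx => by simpa using ⟨by simpa using hx, hc x hx⟩
  exact absurd this (not_le.2 (measure_ball_pos _ _ hr))

theorem Wt_end (hp : 2 ≤ p) : ∃ C : ℝ, 0 < C ∧ ∀ (ε : ℝ) (h : E → ℝ) (J : ℝ), 0 < ε → Sol p ε h → 0 < J →
    ∫ x in ball (0 : E) 1, ‖∇ h x‖ ^ p ≤ J → Wt p h (C * J) := by
  obtain ⟨C, C0, H⟩ := sup_step (E := E) hp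
  refine ⟨C, C0, ?_⟩
  intro ε h J hε hs hJ hI
  have mono : ∀ S S', S ≤ S' → Wt p h S → Wt p h S' := fun S S' hS hw => by
    filter_upwards [hw] with x hx hb e he
    exact (hx hb e he).trans hS
  obtain ⟨L, L0, -, hL⟩ := hs.1.ex
  have w0 : Wt p h (L ^ p) := Eventually.of_forall fun x hb e he => by
    rw [mem_ball_zero_iff] at hb
    have h1 : (max ⟪∇ h x, e⟫_ℝ 0) ^ p ≤ L ^ p := by
      refine Real.rpow_le_rpow (le_max_right _ _) (max_le ?_ L0) (by linarith)
      have := abs_real_inner_le_norm (∇ h x) e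
      rw [Ds_norm he, mul_one] at this
      exact (le_abs_self _).trans (this.trans (hL x))
    have h2 : (1 - ‖x‖) ^ Module.finrank ℝ E ≤ 1 := pow_le_one₀ (by linarith) (by linarith [norm_nonneg x])
    have h3 : 0 ≤ (max ⟪∇ h x, e⟫_ℝ 0) ^ p := by positivity
    have h4 : 0 ≤ L ^ p := by positivity
    nlinarith
  have it : ∀ k : ℕ, Wt p h (max ((3 / 4) ^ k * L ^ p) (C * J)) := by
    intro k
    induction k with
    | zero => exact mono _ _ (by rw [pow_zero, one_mul]; exact le_max_left _ _) w0
    | succ k ih =>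
      rcases le_or_gt ((3 / 4) ^ k * L ^ p) (C * J) with h1 | h1
      · rw [max_eq_right h1] at ih
        exact mono _ _ (le_max_right _ _) ih
      · rw [max_eq_left h1.le] at ih
        rcases H ε h _ J hε hs (lt_trans (by positivity) h1) hI ih with h2 | h2
        · exact absurd h1 (not_lt.2 h2)
        · exact mono _ _ (le_trans (by rw [pow_succ]; linarith) (le_max_left _ _)) h2
  have hk : Tendsto (fun k : ℕ => (3 / 4 : ℝ) ^ k * L ^ p) atTop (𝓝 (0 * L ^ p)) :=
    (tendsto_pow_atTop_nhds_zero_of_lt_one (by norm_num) (by norm_num)).mul_const _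
  rw [zero_mul] at hk
  obtain ⟨k, hk⟩ := (hk.eventually_le_const (u := C * J) (by positivity)).exists
  have := it k
  rwa [max_eq_right hk] at this

theorem solT (hp : 2 ≤ p) : ∃ C θ : ℝ, 0 < C ∧ 0 < θ ∧ θ < 1 ∧ ∀ (ε : ℝ) (h : E → ℝ) (J : ℝ), 0 < ε → Sol p ε h → 0 < J →
    ∫ x in ball (0 : E) 1, ‖∇ h x‖ ^ p ≤ J →
    (∀ᵐ x : E, x ∈ ball (0 : E) (1 / 2) → ‖∇ h x‖ ^ p ≤ C * J) ∧
    ∀ m : ℕ, ∃ ξ : E, ∀ᵐ x : E, x ∈ ball (0 : E) (1 / 2 * (1 / 32) ^ m) → ‖∇ h x - ξ‖ ^ p ≤ C * θ ^ m * J := by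
  obtain ⟨C, C0, H⟩ := Wt_end (E := E) hp
  obtain ⟨θ, θ0, θ1, D⟩ := osc_decay (E := E) hp
  have hp0 : 0 < p := by linarith
  set n := Module.finrank ℝ E with hn
  have n0 : (0 : ℝ) < n := by exact_mod_cast (Module.finrank_pos (R := ℝ) (M := E))
  refine ⟨(n : ℝ) ^ p * 4 ^ p * (2 ^ n * C), θ, by positivity, by linarith, θ1, ?_⟩
  intro ε h J hε hs hJ hI
  set Q := 2 ^ n * C * J with hQ
  have Q0 : 0 < Q := by positivity
  set g := Q ^ (1 / p) with hg
  have g0 : 0 < g := by positivity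
  have gp : g ^ p = Q := by
    rw [hg, ← Real.rpow_mul Q0.le, one_div, inv_mul_cancel₀ hp0.ne', Real.rpow_one]
  have h1 : ∀ᵐ x : E, x ∈ ball (0 : E) (1 / 2) → ∀ e ∈ Ds E, ⟪∇ h x, e⟫_ℝ ≤ g := by
    filter_upwards [H ε h J hε hs hJ hI] with x hx hb e he
    have h2 := hx (ball_subset_ball (by norm_num) hb) e he
    rw [mem_ball_zero_iff] at hb
    have h3 : (1 / 2 : ℝ) ^ n ≤ (1 - ‖x‖) ^ n := pow_le_pow_left₀ (by norm_num) (by linarith) n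
    have h4 : 0 ≤ (max ⟪∇ h x, e⟫_ℝ 0) ^ p := by positivity
    have h5 : (max ⟪∇ h x, e⟫_ℝ 0) ^ p ≤ g ^ p := by
      rw [gp, hQ]
      have h6 := (mul_le_mul_of_nonneg_right h3 h4).trans h2
      calc (max ⟪∇ h x, e⟫_ℝ 0) ^ p = 2 ^ n * ((1 / 2) ^ n * (max ⟪∇ h x, e⟫_ℝ 0) ^ p) := by
            rw [← mul_assoc, ← mul_pow]; norm_num
        _ ≤ 2 ^ n * (C * J) := by gcongr
        _ = _ := by ring
    exact (le_max_left _ _).trans ((Real.rpow_le_rpow_iff (le_max_right _ _) g0.le hp0).1 h5)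
  constructor
  · filter_upwards [h1] with x hx hb
    have h2 := Ds_bd (hx hb)
    have h4 : (1 : ℝ) ≤ 4 ^ p := Real.one_le_rpow (by norm_num) hp0.le
    calc ‖∇ h x‖ ^ p ≤ (n * g) ^ p := Real.rpow_le_rpow (norm_nonneg _) h2 hp0.le
      _ = (n : ℝ) ^ p * 1 * Q := by rw [Real.mul_rpow n0.le g0.le, gp, mul_one]
      _ ≤ (n : ℝ) ^ p * 4 ^ p * Q := by gcongr
      _ = _ := by rw [hQ]; ring
  · intro m
    have hf : (0 : ℝ) < 1 / 2 := by norm_num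
    have hc : cb (sc h 0 (1 / 2)) g := fun e he => (sc_ae (P := fun ξ => ⟪ξ, e⟫_ℝ ≤ g) hf).2 (by
      rw [mul_one]; filter_upwards [h1] with x hx hb; exact hx hb e he)
    have ho := (osc_sc hf).1 (D ε m _ g hε (hs.sc hf (by norm_num)) g0 hc)
    choose! a ha using ho
    have ha' := ae_Ds ha
    have ha2 : ∀ᵐ x : E, x ∈ ball (0 : E) (1 / 2 * (1 / 32) ^ m) → ∀ e ∈ Ds E, a e ≤ ⟪∇ h x, e⟫_ℝ ∧
        ⟪∇ h x, e⟫_ℝ ≤ a e + 4 * θ ^ m * g := by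
      filter_upwards [ha'] with x hx hb e he
      exact hx e he hb
    obtain ⟨x0, -, hx0⟩ := ae_ex (by positivity) ha2
    refine ⟨∇ h x0, ?_⟩
    filter_upwards [ha2] with x hx hb
    have h2 : ‖∇ h x - ∇ h x0‖ ≤ n * (4 * θ ^ m * g) := Ds_bd fun e he => by
      rw [inner_sub_left]
      linarith [(hx hb e he).2, (hx0 e he).1]
    have t0 : 0 < θ ^ m := by positivity
    have t1 : θ ^ m ≤ 1 := pow_le_one₀ (by linarith) θ1.le
    have t2 : (θ ^ m) ^ p ≤ θ ^ m := by
      calc (θ ^ m) ^ p ≤ (θ ^ m) ^ (1 : ℝ) := Real.rpow_le_rpow_of_exponent_ge t0 t1 (by linarith)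
        _ = _ := Real.rpow_one _
    calc ‖∇ h x - ∇ h x0‖ ^ p ≤ (n * (4 * θ ^ m * g)) ^ p := Real.rpow_le_rpow (norm_nonneg _) h2 hp0.le
      _ = (n : ℝ) ^ p * (4 ^ p * (θ ^ m) ^ p * Q) := by
        rw [Real.mul_rpow n0.le (by positivity), Real.mul_rpow (by positivity) g0.le, Real.mul_rpow (by norm_num) t0.le, gp]
      _ ≤ (n : ℝ) ^ p * (4 ^ p * θ ^ m * Q) := by gcongr
      _ = _ := by rw [hQ]; ring

end T
end AP

namespace AP
set_option linter.unusedSectionVars false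
open Filter
open scoped Topology Gradient NNReal
section mol
variable {E : Type*} [NormedAddCommGroup E] [InnerProductSpace ℝ E] [FiniteDimensional ℝ E]
  [MeasureSpace E] [BorelSpace E] [(volume : Measure E).IsAddHaarMeasure] [Nontrivial E]
variable {p ε : ℝ}

theorem c1_at {Ω : Set E} (ho : IsOpen Ω) {u : E → ℝ} (hd : ∀ x ∈ Ω, DifferentiableAt ℝ u x)
    (hc : ContinuousOn (fun x => ∇ u x) Ω) {x : E} (hx : x ∈ Ω) : ContDiffAt ℝ 1 u x := by
  refine contDiffAt_one_iff.2 ⟨fderiv ℝ u, Ω, ho.mem_nhds hx, ?_, fun y hy => (hd y hy).hasFDerivAt⟩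
  have : ∀ y, fderiv ℝ u y = InnerProductSpace.toDual ℝ E (∇ u y) := fun y => by simp [gradient]
  rw [funext this]
  exact (InnerProductSpace.toDual ℝ E).continuous.comp_continuousOn hc

theorem c1_lip {f : E → ℝ} (h : ContDiff ℝ 1 f) (hs : HasCompactSupport f) : Lip f := by
  obtain ⟨C, hC⟩ := h.lipschitzWith_of_hasCompactSupport hs one_ne_zero
  exact ⟨C, hC⟩

theorem ext_c1 {Ω : Set E} (ho : IsOpen Ω) {u : E → ℝ} (hd : ∀ x ∈ Ω, DifferentiableAt ℝ u x)
    (hc : ContinuousOn (fun x => ∇ u x) Ω) {x0 : E} {r : ℝ} (hr : 0 < r) (hb : closedBall x0 (2 * r) ⊆ Ω) :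
    ∃ U : E → ℝ, ContDiff ℝ 1 U ∧ HasCompactSupport U ∧ ∀ x ∈ ball (0 : E) (5 / 4), U x = sc u x0 r x := by
  let χ : ContDiffBump (0 : E) := ⟨5 / 4, 3 / 2, by norm_num, by norm_num⟩
  have e : ∀ x : E, 3 / 2 < ‖x‖ → χ x = 0 := fun x hx => χ.zero_of_le_dist (by
    rw [dist_zero_right]; exact hx.le)
  refine ⟨fun x => χ x * sc u x0 r x, ?_, ?_, ?_⟩
  · rw [contDiff_iff_contDiffAt]
    intro x
    rcases lt_or_ge ‖x‖ 2 with hx | hx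
    · refine χ.contDiffAt.mul (contDiffAt_const.mul (ContDiffAt.comp x (g := u) (f := fun x => x0 + r • x) ?_ (by fun_prop)))
      refine c1_at ho hd hc (hb ?_)
      rw [mem_closedBall, dist_eq_norm, add_sub_cancel_left, norm_smul, Real.norm_of_nonneg hr.le]
      nlinarith
    · refine (contDiffAt_const (c := (0 : ℝ))).congr_of_eventuallyEq ?_
      filter_upwards [(isOpen_lt continuous_const continuous_norm).mem_nhds (show (3 / 2 : ℝ) < ‖x‖ by linarith)] with y hy
      rw [e y hy, zero_mul]
  · exact HasCompactSupport.intro (isCompact_closedBall (0 : E) (3 / 2)) fun x hx => by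
      rw [mem_closedBall, dist_zero_right, not_le] at hx
      rw [e x hx, zero_mul]
  · intro x hx
    have : χ x = 1 := χ.one_of_mem_closedBall (ball_subset_closedBall hx)
    beta_reduce; rw [this, one_mul]

theorem bsc_c2 {g : E → ℝ} (hg : ContDiff ℝ 2 g) {L : ℝ} (hL : LipK L g) : ∃ K, BSC K g := by
  have hd : Differentiable ℝ g := hg.differentiable (by norm_num)
  have h1 : ContDiff ℝ 1 (fderiv ℝ g) := hg.fderiv_right (by norm_num)
  obtain ⟨C, hC⟩ := h1.contDiffOn.exists_lipschitzOnWith one_ne_zero (convex_closedBall (0 : E) 1) (isCompact_closedBall _ _)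
  have L0 := hL.nn
  have C0 : (0 : ℝ) ≤ C := C.2
  have tay : ∀ s ∈ sphere (0 : E) 1, ∀ x ∈ sphere (0 : E) 1, |g x - g s - ⟪∇ g s, x - s⟫_ℝ| ≤ -(2 * C * ⟪s, x - s⟫_ℝ) := by
    intro s hs x hx
    have hs' := sphere_subset_closedBall hs
    have hx' := sphere_subset_closedBall hx
    have h2 := Convex.norm_image_sub_le_of_norm_fderiv_le' (𝕜 := ℝ) (f := g) (φ := fderiv ℝ g s) (C := C * ‖x - s‖) (x := s) (y := x)
      (s := closedBall (0 : E) 1 ∩ closedBall s ‖x - s‖) (fun y _ => hd y) (fun y hy => by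
        have := hC.dist_le_mul y hy.1 s hs'
        rw [dist_eq_norm] at this
        exact this.trans (mul_le_mul_of_nonneg_left hy.2 C0))
      ((convex_closedBall _ _).inter (convex_closedBall _ _)) ⟨hs', mem_closedBall_self (norm_nonneg _)⟩
      ⟨hx', by rw [mem_closedBall, dist_eq_norm]⟩
    rw [Real.norm_eq_abs, ← grad_inner] at h2
    refine h2.trans (le_of_eq ?_)
    rw [mem_sphere_zero_iff_norm] at hs hx
    have h3 := norm_sub_sq_real x s
    have h4 : ⟪s, x - s⟫_ℝ = ⟪x, s⟫_ℝ - 1 := by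
      rw [inner_sub_right, real_inner_self_eq_norm_sq, hs, real_inner_comm]; norm_num
    rw [hs, hx] at h3
    rw [h4, mul_assoc, ← sq, h3]; ring
  refine ⟨L + 2 * C, hL.mono (by linarith), fun s hs => ⟨⟨∇ g s + (2 * C : ℝ) • s, ?_, fun x hx => ?_⟩,
    ⟨∇ g s - (2 * C : ℝ) • s, ?_, fun x hx => ?_⟩⟩⟩
  · refine (norm_add_le _ _).trans (add_le_add (hL.gr s) ?_)
    rw [norm_smul, mem_sphere_zero_iff_norm.1 hs, mul_one, Real.norm_of_nonneg (by positivity)]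
  · have := abs_le.1 (tay s hs x hx)
    rw [inner_add_left, inner_smul_left]
    simp only [conj_trivial]
    linarith [this.1]
  · refine (norm_sub_le _ _).trans (add_le_add (hL.gr s) ?_)
    rw [norm_smul, mem_sphere_zero_iff_norm.1 hs, mul_one, Real.norm_of_nonneg (by positivity)]
  · have := abs_le.1 (tay s hs x hx)
    rw [inner_sub_left, inner_smul_left]
    simp only [conj_trivial]
    linarith [this.2]

open scoped Convolution in
theorem moll {U : E → ℝ} (hU : ContDiff ℝ 1 U) (hs : HasCompactSupport U) {κ : ℝ} (hκ : 0 < κ) :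
    ∃ (g : E → ℝ) (K : ℝ), BSC K g ∧ Differentiable ℝ g ∧ ∀ x, ‖∇ U x - ∇ g x‖ ≤ κ := by
  have hcf : Continuous (fderiv ℝ U) := hU.continuous_fderiv one_ne_zero
  have huc : UniformContinuous (fderiv ℝ U) := (hs.fderiv ℝ).uniformContinuous_of_continuous hcf
  obtain ⟨δ, δ0, hδ⟩ := Metric.uniformContinuous_iff.1 huc κ hκ
  let φ : ContDiffBump (0 : E) := ⟨δ / 2, δ, by positivity, by linarith⟩
  set g : E → ℝ := (φ.normed volume ⋆[ContinuousLinearMap.lsmul ℝ ℝ, volume] U) with hg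
  have hg2 : ContDiff ℝ 2 g := by
    have := (φ.hasCompactSupport_normed (μ := (volume : Measure E))).contDiff_convolution_left (n := 2) (μ := (volume : Measure E))
      (ContinuousLinearMap.lsmul ℝ ℝ) (φ.contDiff_normed (n := 2)) (hU.continuous.locallyIntegrable (μ := volume))
    exact this
  have hgd : Differentiable ℝ g := hg2.differentiable (by norm_num)
  have key : ∀ x, ‖∇ U x - ∇ g x‖ ≤ κ := by
    intro x
    have h1 := hs.hasFDerivAt_convolution_right (𝕜 := ℝ) (μ := (volume : Measure E)) (ContinuousLinearMap.lsmul ℝ ℝ)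
      ((φ.continuous_normed (μ := (volume : Measure E))).locallyIntegrable (μ := volume)) hU x
    have h2 : (ContinuousLinearMap.lsmul ℝ ℝ : ℝ →L[ℝ] ℝ →L[ℝ] ℝ).precompR E =
        (ContinuousLinearMap.lsmul ℝ ℝ : ℝ →L[ℝ] (E →L[ℝ] ℝ) →L[ℝ] (E →L[ℝ] ℝ)) := by
      ext; simp [ContinuousLinearMap.precompR]
    rw [h2] at h1
    have h3 := φ.dist_normed_convolution_le (μ := (volume : Measure E)) (x₀ := x) (ε := κ) hcf.aestronglyMeasurable
      (fun y hy => (hδ hy).le)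
    rw [← h1.fderiv, dist_comm, dist_eq_norm] at h3
    rw [gradient, gradient, ← map_sub, LinearIsometryEquiv.norm_map]
    exact h3
  obtain ⟨L, L0, -, hL⟩ := (c1_lip hU hs).ex
  have hgl : LipK (L + κ) g := by
    have hb : ∀ x, ‖fderiv ℝ g x‖₊ ≤ (⟨L + κ, by positivity⟩ : ℝ≥0) := fun x => by
      change ‖fderiv ℝ g x‖ ≤ L + κ
      have h1 : ‖fderiv ℝ g x‖ = ‖∇ g x‖ := by rw [gradient, LinearIsometryEquiv.norm_map]
      rw [h1]
      have h2 := norm_sub_norm_le (∇ g x) (∇ U x)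
      rw [norm_sub_rev] at h2
      linarith [key x, hL x]
    intro x y
    have := (lipschitzWith_of_nnnorm_fderiv_le hgd hb).dist_le_mul x y
    rwa [Real.dist_eq, dist_eq_norm] at this
  obtain ⟨K, hK⟩ := bsc_c2 hg2 hgl
  exact ⟨g, K, hK, hgd, key⟩

end mol
end AP

namespace AP
set_option linter.unusedSectionVars false
open Filter
open scoped Topology Gradient NNReal
section cmp
variable {E : Type*} [NormedAddCommGroup E] [InnerProductSpace ℝ E] [FiniteDimensional ℝ E]
  [MeasureSpace E] [BorelSpace E] [(volume : Measure E).IsAddHaarMeasure] [Nontrivial E]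
variable {p ε : ℝ}

theorem tw {a b q : ℝ} (ha : 0 ≤ a) (hb : 0 ≤ b) (hq : 0 ≤ q) : (a + b) ^ q ≤ 2 ^ q * (a ^ q + b ^ q) := by
  have h1 : (a + b) ^ q ≤ (2 * max a b) ^ q :=
    Real.rpow_le_rpow (by positivity) (by linarith [le_max_left a b, le_max_right a b]) hq
  rw [Real.mul_rpow (by norm_num) (le_max_of_le_left ha)] at h1
  refine h1.trans (mul_le_mul_of_nonneg_left ?_ (by positivity))
  have := Real.rpow_nonneg ha q
  have := Real.rpow_nonneg hb q
  rcases le_total a b with h | h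
  · rw [max_eq_right h]; linarith
  · rw [max_eq_left h]; linarith
theorem tws {ξ ζ η : E} {q : ℝ} (hq : 0 ≤ q) : ‖ξ - ζ‖ ^ q ≤ 2 ^ q * (‖ξ - η‖ ^ q + ‖η - ζ‖ ^ q) :=
  (Real.rpow_le_rpow (norm_nonneg _) (norm_sub_le_norm_sub_add_norm_sub ξ η ζ) hq).trans (tw (norm_nonneg _) (norm_nonneg _) hq)
theorem pk (hp : 2 ≤ p) {s κ : ℝ} (hs : 0 ≤ s) (hκ : 0 ≤ κ) (h1 : κ ≤ 1) : (s + κ) ^ p ≤ s ^ p + κ * (p * 2 ^ p) * (s ^ p + 1) := by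
  have h2 := bern (q := p) (by linarith) (add_nonneg hs hκ) hs
  have h3 : (s + κ) ^ (p - 1) ≤ 2 ^ p * (s ^ p + 1) := by
    calc (s + κ) ^ (p - 1) ≤ (s + 1) ^ (p - 1) := Real.rpow_le_rpow (by positivity) (by linarith) (by linarith)
      _ ≤ (s + 1) ^ p := Real.rpow_le_rpow_of_exponent_le (by linarith) (by linarith)
      _ ≤ 2 ^ p * (s ^ p + 1 ^ p) := tw hs zero_le_one (by linarith)
      _ = _ := by rw [Real.one_rpow]
  have h4 := mul_le_mul_of_nonneg_left h3 (by positivity : 0 ≤ p * κ)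
  nlinarith
theorem pg {γ b : ℝ} (h0 : 0 ≤ γ) (hγ : γ < p) (hb : 0 < b) : ∃ C : ℝ, 0 ≤ C ∧ ∀ t : ℝ, 0 ≤ t → t ^ γ ≤ b * t ^ p + C := by
  have h := (tendsto_rpow_neg_atTop (by linarith : 0 < p - γ)).eventually_le_const hb
  obtain ⟨T, T1, hT⟩ := (h.and (eventually_ge_atTop 1)).exists
  refine ⟨T ^ γ, by positivity, fun t ht => ?_⟩
  rcases le_total t T with h1 | h1
  · have : t ^ γ ≤ T ^ γ := Real.rpow_le_rpow ht h1 h0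
    have : 0 ≤ b * t ^ p := by positivity
    linarith
  · have t0 : 0 < t := by linarith
    have h2 : t ^ γ = t ^ (-(p - γ)) * t ^ p := by rw [← Real.rpow_add t0]; congr 1; ring
    have h3 : t ^ (-(p - γ)) ≤ T ^ (-(p - γ)) := Real.rpow_le_rpow_of_nonpos (by linarith) h1 (by linarith)
    rw [h2]
    have : 0 ≤ T ^ γ := by positivity
    have : 0 ≤ t ^ p := by positivity
    nlinarith

def UMin (p : ℝ) (Φ : ℝ → ℝ) (U : E → ℝ) : Prop := ∀ v : E → ℝ, Lip v → (∀ x ∈ sphere (0 : E) 1, v x = U x) →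
  ∫ x in ball (0 : E) 1, (‖∇ U x‖ ^ p / p + Φ (U x)) ≤ ∫ x in ball (0 : E) 1, (‖∇ v x‖ ^ p / p + Φ (v x))

theorem int_c {f : E → ℝ} (hf : Continuous f) (y : E) (r : ℝ) : IntegrableOn f (ball y r) :=
  (hf.continuousOn.integrableOn_compact (isCompact_closedBall y r)).mono_set ball_subset_closedBall
theorem int_dp (hp : 2 ≤ p) {f g : E → ℝ} (hf : Lip f) (hg : Lip g) (y : E) (r : ℝ) :
    IntegrableOn (fun x => ‖∇ f x - ∇ g x‖ ^ p) (ball y r) := by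
  obtain ⟨K, K0, -, hK⟩ := hf.ex
  obtain ⟨L, L0, -, hL⟩ := hg.ex
  refine ibd (((meas_grad f).sub (meas_grad g)).norm.pow_const p) (C := (K + L) ^ p) (fun x => ?_) y r
  change |‖∇ f x - ∇ g x‖ ^ p| ≤ _
  rw [abs_of_nonneg (by positivity)]
  exact Real.rpow_le_rpow (norm_nonneg _) ((norm_sub_le _ _).trans (add_le_add (hK x) (hL x))) (by linarith)

theorem int_const' (c : ℝ) (y : E) (r : ℝ) : IntegrableOn (fun _ : E => c) (ball y r) := integrableOn_const measure_ball_lt_top.ne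
theorem int_cst (c : ℝ) (A : Set E) : ∫ _ in A, c = volume.real A * c := by rw [setIntegral_const, smul_eq_mul]

set_option maxHeartbeats 1000000 in
theorem compare (hp : 2 ≤ p) {γ CF : ℝ} (hγ : 0 < γ) (hγp : γ < p) (hCF : 0 ≤ CF) : ∃ C : ℝ, 0 < C ∧
    ∀ (U : E → ℝ) (Φ : ℝ → ℝ) (ρ : ℝ), ContDiff ℝ 1 U → HasCompactSupport U → Continuous Φ → 0 < ρ → ρ ≤ 1 → UMin p Φ U →
    (∀ x ∈ ball (0 : E) 1, ∀ t, Φ t - Φ (U x) ≤ ρ * CF * (1 + |t - U x| ^ γ)) →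
    ∃ (ε : ℝ) (h : E → ℝ), 0 < ε ∧ Sol p ε h ∧ ∫ x in ball (0 : E) 1, ‖∇ U x - ∇ h x‖ ^ p ≤ C * ρ := by
  obtain ⟨c, c0, hc⟩ := alg4 (E := E) hp
  have hp0 : 0 < p := by linarith
  set b := c / (2 * (CF + 1) * 2 ^ p) with hb
  have b0 : 0 < b := by positivity
  have hb2 : CF * b * 2 ^ p ≤ c / 2 := by
    have e : (CF + 1) * b * 2 ^ p = c / 2 := by rw [hb]; field_simp
    rw [← e]; gcongr; linarith
  obtain ⟨Cb, Cb0, hCb⟩ := pg hγ.le hγp b0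
  set V0 := volume.real (ball (0 : E) 1) with hV0
  have V00 : 0 < V0 := ball_vpos one_pos
  set K1 := CF * (1 + Cb) * V0 + 1 with hK1
  have K10 : 0 < K1 := by positivity
  refine ⟨2 ^ p * (V0 + 2 * K1 / c), by positivity, ?_⟩
  intro U Φ ρ hU hUc hΦ hρ hρ1 hmin hΦ2
  have hUL : Lip U := c1_lip hU hUc
  obtain ⟨L, L0, -, hL⟩ := hUL.ex
  set P := p * 2 ^ p with hP
  have P0 : 0 < P := by positivity
  set Y := ((L + 1) ^ p / p + (L + 1) ^ 2) * V0 with hY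
  set Z := P * (L ^ p + 1) * V0 / p + P * (p * Y + V0) / p + (L + 1) ^ 2 * V0 + 1 with hZ
  have Z1 : 1 ≤ Z := by
    have : 0 ≤ P * (L ^ p + 1) * V0 / p + P * (p * Y + V0) / p + (L + 1) ^ 2 * V0 := by positivity
    linarith
  set κ := ρ / Z with hκ
  have κ0 : 0 < κ := by positivity
  have κρ : κ ≤ ρ := div_le_self hρ.le Z1
  have κ1 : κ ≤ 1 := κρ.trans hρ1
  have κZ : κ * Z = ρ := by rw [hκ]; field_simp
  obtain ⟨g, K, hbsc, hgd, hUg⟩ := moll hU hUc κ0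
  obtain ⟨h, hs, hhg⟩ := exist_R hp κ0 hbsc
  have hgL : Lip g := hbsc.1.lip
  have hUd : Differentiable ℝ U := hU.differentiable one_ne_zero
  refine ⟨κ, h, κ0, hs, ?_⟩
  set V : E → ℝ := fun x => h x + (U x - g x) with hV
  have hVL : Lip V := hs.1.add (hUL.sub hgL)
  set w : E → ℝ := fun x => h x - g x with hw
  have hwL : Lip w := hs.1.sub hgL
  have hw0 : ∀ x, x ∉ ball (0 : E) 1 → w x = 0 := fun x hx => by rw [hw]; simp [hhg x hx]
  have gw : ∀ᵐ x : E, ∇ w x = ∇ h x - ∇ g x := by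
    filter_upwards [hs.1.ae] with x hx
    exact grad_sub hx (hgd x)
  have gV : ∀ᵐ x : E, ∇ V x = ∇ h x + (∇ U x - ∇ g x) := by
    filter_upwards [hs.1.ae] with x hx
    have h1 := grad_add (f := h) (g := fun y => U y - g y) hx ((hUd x).sub (hgd x))
    rw [grad_sub (hUd x) (hgd x)] at h1
    exact h1
  set B := ball (0 : E) 1 with hB
  have hgn : ∀ x, ‖∇ g x‖ ≤ ‖∇ U x‖ + κ := fun x => by
    have h2 := norm_sub_norm_le (∇ g x) (∇ U x)
    rw [norm_sub_rev] at h2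
    linarith [hUg x]
  have iU : IntegrableOn (fun x => ‖∇ U x‖ ^ p) B := int_gp hp hUL _ _
  have ig : IntegrableOn (fun x => ‖∇ g x‖ ^ p) B := int_gp hp hgL _ _
  have ih : IntegrableOn (fun x => ‖∇ h x‖ ^ p) B := int_gp hp hs.1 _ _
  have iV : IntegrableOn (fun x => ‖∇ V x‖ ^ p) B := int_gp hp hVL _ _
  obtain ⟨Kh, -, hKh, -⟩ := hs.1.ex
  have iGg : IntegrableOn (fun x => Gf p κ (∇ g x)) B := intG hp κ0.le hbsc.1 _ _
  have iGh : IntegrableOn (fun x => Gf p κ (∇ h x)) B := intG hp κ0.le hKh _ _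
  have id : IntegrableOn (fun x => ‖∇ g x - ∇ h x‖ ^ p) B := int_dp hp hgL hs.1 _ _
  set D := ∫ x in B, ‖∇ g x - ∇ h x‖ ^ p with hD
  -- strong convexity
  have s1 : (∫ x in B, Gf p κ (∇ h x)) + c * D ≤ ∫ x in B, Gf p κ (∇ g x) := by
    have el := hs.2 w hwL hw0
    have iA := int_A hp κ0.le hs.1 hwL (0 : E) 1
    have : ∫ x in B, (Gf p κ (∇ h x) + c * ‖∇ g x - ∇ h x‖ ^ p - ⟪Aop p κ (∇ h x), ∇ w x⟫_ℝ) ≤ ∫ x in B, Gf p κ (∇ g x) := by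
      refine integral_mono_ae ((iGh.add (id.const_mul c)).sub iA) iGg (ae_restrict_of_ae ?_)
      filter_upwards [gw] with x hx
      have h1 := hc κ κ0.le (∇ g x) (∇ h x)
      rw [hx, ← neg_sub (∇ g x), inner_neg_right]
      linarith
    rw [integral_sub (by exact iGh.add (id.const_mul c)) iA, integral_add iGh (id.const_mul c), integral_const_mul, el] at this
    linarith
  have G1 : ∫ x in B, Gf p κ (∇ h x) ≥ (∫ x in B, ‖∇ h x‖ ^ p) / p := by
    rw [← integral_div]
    refine setIntegral_mono (ih.div_const p) iGh fun x => ?_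
    unfold Gf
    have : 0 ≤ κ / 2 * ‖∇ h x‖ ^ 2 := by positivity
    linarith
  have gL : ∀ x, ‖∇ g x‖ ≤ L + 1 := fun x => by linarith [hgn x, hL x]
  have G2 : ∫ x in B, Gf p κ (∇ g x) ≤ (∫ x in B, ‖∇ g x‖ ^ p) / p + κ * ((L + 1) ^ 2 * V0) := by
    have : ∫ x in B, Gf p κ (∇ g x) ≤ ∫ x in B, (‖∇ g x‖ ^ p / p + κ * (L + 1) ^ 2) := by
      refine setIntegral_mono iGg ((ig.div_const p).add (int_const' _ _ _)) fun x => ?_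
      unfold Gf
      have h1 : ‖∇ g x‖ ^ 2 ≤ (L + 1) ^ 2 := pow_le_pow_left₀ (norm_nonneg _) (gL x) 2
      have : 0 ≤ ‖∇ g x‖ ^ 2 := by positivity
      beta_reduce
      nlinarith
    rw [integral_add (ig.div_const p) (int_const' _ _ _), integral_div, int_cst] at this
    linarith
  have G3 : ∫ x in B, ‖∇ g x‖ ^ p ≤ (L + 1) ^ p * V0 := by
    have := setIntegral_mono (μ := (volume : Measure E)) ig (int_const' ((L + 1) ^ p) (0 : E) 1) fun x => Real.rpow_le_rpow (norm_nonneg _) (gL x) hp0.le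
    rw [int_cst] at this
    linarith
  have cD : 0 ≤ c * D := mul_nonneg c0.le (integral_nonneg fun x => by positivity)
  have X1 : ∫ x in B, ‖∇ h x‖ ^ p ≤ p * Y := by
    have h1 : (∫ x in B, ‖∇ h x‖ ^ p) / p ≤ Y := by
      have h2 : (∫ x in B, ‖∇ g x‖ ^ p) / p ≤ (L + 1) ^ p * V0 / p := by gcongr
      have h3 : κ * ((L + 1) ^ 2 * V0) ≤ (L + 1) ^ 2 * V0 := mul_le_of_le_one_left (by positivity) κ1
      have h4 : Y = (L + 1) ^ p * V0 / p + (L + 1) ^ 2 * V0 := by rw [hY]; ring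
      linarith
    rwa [div_le_iff₀ hp0, mul_comm] at h1
  have a1 : ∫ x in B, ‖∇ g x‖ ^ p ≤ (∫ x in B, ‖∇ U x‖ ^ p) + κ * (P * (L ^ p + 1) * V0) := by
    have : ∫ x in B, ‖∇ g x‖ ^ p ≤ ∫ x in B, (‖∇ U x‖ ^ p + κ * P * (L ^ p + 1)) := by
      refine setIntegral_mono ig (iU.add (int_const' _ _ _)) fun x => ?_
      have h1 := (Real.rpow_le_rpow (norm_nonneg _) (hgn x) hp0.le).trans (pk hp (norm_nonneg _) κ0.le κ1)
      have h2 : ‖∇ U x‖ ^ p ≤ L ^ p := Real.rpow_le_rpow (norm_nonneg _) (hL x) hp0.le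
      refine h1.trans ?_
      beta_reduce
      gcongr
    rw [integral_add iU (int_const' _ _ _), int_cst] at this
    linarith
  have a2 : ∫ x in B, ‖∇ V x‖ ^ p ≤ (∫ x in B, ‖∇ h x‖ ^ p) + κ * (P * (p * Y + V0)) := by
    have : ∫ x in B, ‖∇ V x‖ ^ p ≤ ∫ x in B, (‖∇ h x‖ ^ p + κ * P * (‖∇ h x‖ ^ p + 1)) := by
      refine integral_mono_ae iV (ih.add ((ih.add (int_const' _ _ _)).const_mul _)) (ae_restrict_of_ae ?_)
      filter_upwards [gV] with x hx
      rw [hx]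
      refine (Real.rpow_le_rpow (norm_nonneg _) ?_ hp0.le).trans (pk hp (norm_nonneg _) κ0.le κ1)
      exact (norm_add_le _ _).trans (add_le_add le_rfl (hUg x))
    rw [integral_add ih (by exact (ih.add (int_const' 1 0 1)).const_mul (κ * P)), integral_const_mul, integral_add ih (int_const' _ _ _), int_cst] at this
    have h2 : κ * P * ((∫ x in B, ‖∇ h x‖ ^ p) + V0 * 1) ≤ κ * P * (p * Y + V0) := by
      have : 0 ≤ κ * P := by positivity
      refine mul_le_mul_of_nonneg_left ?_ this
      linarith
    linarith
  -- minimality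
  have iΦU : IntegrableOn (fun x => Φ (U x)) B := int_c (hΦ.comp hUL.cont) _ _
  have iΦV : IntegrableOn (fun x => Φ (V x)) B := int_c (hΦ.comp hVL.cont) _ _
  have m1 := hmin V hVL fun x hx => by
    have : h x = g x := hhg x fun hxb => by
      rw [mem_ball_zero_iff] at hxb; rw [mem_sphere_zero_iff_norm] at hx; linarith
    rw [hV]; simp [this]
  rw [integral_add (iU.div_const p) iΦU, integral_add (iV.div_const p) iΦV, integral_div, integral_div] at m1
  have iw : ∀ q : ℝ, 0 ≤ q → IntegrableOn (fun x => |w x| ^ q) B := fun q hq =>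
    int_c (hwL.cont.abs.rpow_const fun x => Or.inr hq) _ _
  have m2 : (∫ x in B, Φ (V x)) - ∫ x in B, Φ (U x) ≤ ρ * (CF * (1 + Cb) * V0) + c / 2 * D := by
    rw [← integral_sub iΦV iΦU]
    have h1 : ∫ x in B, (Φ (V x) - Φ (U x)) ≤ ∫ x in B, (ρ * CF * b * |w x| ^ p + ρ * CF * (1 + Cb)) := by
      refine setIntegral_mono_on (iΦV.sub iΦU) (((iw p hp0.le).const_mul _).add (int_const' _ _ _)) measurableSet_ball fun x hx => ?_
      have h2 := hΦ2 x hx (V x)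
      have h3 : V x - U x = w x := by rw [hV, hw]; ring
      rw [h3] at h2
      have h4 := hCb |w x| (abs_nonneg _)
      refine h2.trans ?_
      calc _ ≤ ρ * CF * (1 + (b * |w x| ^ p + Cb)) := by gcongr
        _ = _ := by ring
    rw [integral_add ((iw p hp0.le).const_mul _) (int_const' _ _ _), integral_const_mul, int_cst] at h1
    have h5 := poin hwL hw0 (q := p) (by linarith)
    have h6 : ∫ x in B, ‖∇ w x‖ ^ p = D := by
      refine integral_congr_ae (ae_restrict_of_ae ?_)
      filter_upwards [gw] with x hx
      rw [hx, norm_sub_rev]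
    rw [h6] at h5
    have D0 : 0 ≤ D := integral_nonneg fun x => by positivity
    have h7 : ρ * CF * b * ∫ x in B, |w x| ^ p ≤ c / 2 * D := by
      calc ρ * CF * b * ∫ x in B, |w x| ^ p ≤ ρ * CF * b * (2 ^ p * D) := by gcongr
        _ = ρ * ((CF * b * 2 ^ p) * D) := by ring
        _ ≤ 1 * ((c / 2) * D) := by gcongr
        _ = _ := one_mul _
    linarith
  have fin : c / 2 * D ≤ ρ * K1 := by
    have e1 : (∫ x in B, ‖∇ g x‖ ^ p) / p ≤ (∫ x in B, ‖∇ U x‖ ^ p) / p + κ * (P * (L ^ p + 1) * V0 / p) := by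
      rw [← mul_div_assoc, ← add_div]; gcongr
    have e2 : (∫ x in B, ‖∇ V x‖ ^ p) / p ≤ (∫ x in B, ‖∇ h x‖ ^ p) / p + κ * (P * (p * Y + V0) / p) := by
      rw [← mul_div_assoc, ← add_div]; gcongr
    have e3 : κ * (P * (L ^ p + 1) * V0 / p) + κ * (P * (p * Y + V0) / p) + κ * ((L + 1) ^ 2 * V0) ≤ ρ := by
      rw [← κZ, hZ]; linarith [mul_add κ (P * (L ^ p + 1) * V0 / p + P * (p * Y + V0) / p + (L + 1) ^ 2 * V0) 1, mul_add κ (P * (L ^ p + 1) * V0 / p + P * (p * Y + V0) / p) ((L + 1) ^ 2 * V0), mul_add κ (P * (L ^ p + 1) * V0 / p) (P * (p * Y + V0) / p)]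
    rw [hK1, mul_add]
    linarith
  have fin2 : D ≤ 2 * K1 / c * ρ := by
    rw [div_mul_eq_mul_div, le_div_iff₀ c0]; linarith
  have : ∫ x in B, ‖∇ U x - ∇ h x‖ ^ p ≤ ∫ x in B, 2 ^ p * (ρ + ‖∇ g x - ∇ h x‖ ^ p) := by
    refine setIntegral_mono (int_dp hp hUL hs.1 _ _) (((int_const' _ _ _).add id).const_mul _) fun x => ?_
    refine (tws (η := ∇ g x) hp0.le).trans ?_
    have : ‖∇ U x - ∇ g x‖ ^ p ≤ ρ := by
      calc ‖∇ U x - ∇ g x‖ ^ p ≤ κ ^ p := Real.rpow_le_rpow (norm_nonneg _) (hUg x) hp0.le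
        _ ≤ κ ^ (1 : ℝ) := Real.rpow_le_rpow_of_exponent_ge κ0 κ1 (by linarith)
        _ ≤ ρ := by rw [Real.rpow_one]; exact κρ
    beta_reduce
    gcongr
  rw [integral_const_mul, integral_add (int_const' _ _ _) id, int_cst] at this
  refine this.trans ?_
  rw [mul_assoc]
  gcongr
  linarith

end cmp
end AP

namespace AP
set_option linter.unusedSectionVars false
open Filter
open scoped Topology Gradient NNReal
section cac
variable {E : Type*} [NormedAddCommGroup E] [InnerProductSpace ℝ E] [FiniteDimensional ℝ E]
  [MeasureSpace E] [BorelSpace E] [(volume : Measure E).IsAddHaarMeasure] [Nontrivial E]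
variable {p ε : ℝ}

theorem fpow {γ M : ℝ} (hγ : 0 < γ) (hM : 0 ≤ M) : ∃ C : ℝ, 0 ≤ C ∧ ∀ x y : ℝ, 0 ≤ x → x ≤ M → 0 ≤ y →
    (x + y) ^ γ ≤ x ^ γ + C * (y ^ (min γ 1) + y ^ γ) := by
  rcases le_total γ 1 with h | h
  · refine ⟨1, zero_le_one, fun x y hx _ hy => ?_⟩
    have h1 := Real.rpow_add_le_add_rpow hx hy hγ.le h
    have : 0 ≤ y ^ (min γ 1) := by positivity
    linarith
  · refine ⟨γ * (2 ^ (γ - 1) * (M ^ (γ - 1) + 1)), by positivity, fun x y hx hxM hy => ?_⟩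
    have h1 := bern h (add_nonneg hx hy) hx
    have h2 : (x + y) ^ (γ - 1) ≤ 2 ^ (γ - 1) * (M ^ (γ - 1) + y ^ (γ - 1)) :=
      (tw hx hy (by linarith)).trans (by gcongr)
    have h3 : y ^ (γ - 1) * y = y ^ γ := by
      rcases hy.eq_or_lt with h0 | h0
      · rw [← h0, mul_zero, Real.zero_rpow hγ.ne']
      · rw [← Real.rpow_add_one h0.ne']; congr 1; ring
    rw [min_eq_right h, Real.rpow_one]
    have h4 : (x + y) ^ (γ - 1) * y ≤ 2 ^ (γ - 1) * (M ^ (γ - 1) + 1) * (y + y ^ γ) := by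
      calc (x + y) ^ (γ - 1) * y ≤ 2 ^ (γ - 1) * (M ^ (γ - 1) + y ^ (γ - 1)) * y := by gcongr
        _ = 2 ^ (γ - 1) * (M ^ (γ - 1) * y + y ^ γ) := by rw [← h3]; ring
        _ ≤ 2 ^ (γ - 1) * ((M ^ (γ - 1) + 1) * (y + y ^ γ)) := by
            gcongr
            have a1 : 0 ≤ M ^ (γ - 1) * y ^ γ := by positivity
            linarith [mul_add (M ^ (γ - 1)) y (y ^ γ), add_mul (M ^ (γ - 1)) 1 (y + y ^ γ)]
        _ = _ := by ring
    have h5 := mul_le_mul_of_nonneg_left h4 hγ.le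
    linarith

def FH (M γ g CF CM : ℝ) (F : ℝ → ℝ) : Prop := Continuous F ∧ (∀ t, 0 ≤ F t) ∧ (∀ t, |t| ≤ M → F t ≤ CM) ∧
  ∀ r t b, 0 < r → r ≤ 1 → |r * b| ≤ M → F (r * t) - F (r * b) ≤ r ^ g * CF * (1 + |t - b| ^ γ)

theorem fh_of {γ lp lm δ0 M : ℝ} (hγ : 0 < γ) (hlp : 0 < lp) (hlm : 0 < lm) (hδ : 0 < δ0) (hM : 0 < M) :
    ∃ CF CM : ℝ, 0 ≤ CF ∧ 0 ≤ CM ∧ ∀ δ, 0 ≤ δ → δ ≤ δ0 → FH M γ (min γ 1) CF CM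
      (fun t => δ * (lp * (max t 0) ^ γ + lm * (max (-t) 0) ^ γ)) := by
  obtain ⟨C, C0, hC⟩ := fpow hγ hM.le
  have g0 : 0 < min γ 1 := lt_min hγ one_pos
  refine ⟨δ0 * ((lp + lm) * (2 * C)), δ0 * ((lp + lm) * M ^ γ), by positivity, by positivity, fun δ h0 h1 => ⟨?_, ?_, ?_, ?_⟩⟩
  · have c1 : ∀ f : ℝ → ℝ, Continuous f → Continuous fun t => (max (f t) 0) ^ γ := fun f hf =>
      (hf.max continuous_const).rpow_const fun _ => Or.inr hγ.le
    exact continuous_const.mul ((continuous_const.mul (c1 _ continuous_id)).add (continuous_const.mul (c1 _ continuous_neg)))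
  · intro t; positivity
  · intro t ht
    beta_reduce
    have a1 : max t 0 ≤ M := max_le ((le_abs_self t).trans ht) hM.le
    have a2 : max (-t) 0 ≤ M := max_le ((neg_le_abs t).trans ht) hM.le
    calc _ ≤ δ0 * (lp * M ^ γ + lm * M ^ γ) := by gcongr
      _ = _ := by ring
  · intro r t b hr hr1 hb
    have key : ∀ t b : ℝ, |r * b| ≤ M → (max (r * t) 0) ^ γ - (max (r * b) 0) ^ γ ≤ 2 * C * (r ^ (min γ 1) * (1 + |t - b| ^ γ)) := by
      intro t b hb
      have a1 : max (r * b) 0 ≤ M := max_le ((le_abs_self _).trans hb) hM.le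
      have a2 : max (r * t) 0 ≤ max (r * b) 0 + r * |t - b| := by
        have : r * t - r * b ≤ r * |t - b| := by rw [← mul_sub]; gcongr; exact le_abs_self _
        have : 0 ≤ r * |t - b| := by positivity
        exact max_le (by linarith [le_max_left (r * b) 0]) (by linarith [le_max_right (r * b) 0])
      have a3 := (Real.rpow_le_rpow (le_max_right _ _) a2 hγ.le).trans (hC _ (r * |t - b|) (le_max_right _ _) a1 (by positivity))
      rw [Real.mul_rpow hr.le (abs_nonneg _), Real.mul_rpow hr.le (abs_nonneg _)] at a3
      have a4 : |t - b| ^ (min γ 1) ≤ 1 + |t - b| ^ γ := by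
        rcases le_total |t - b| 1 with h | h
        · have : |t - b| ^ (min γ 1) ≤ 1 := Real.rpow_le_one (abs_nonneg _) h g0.le
          have : 0 ≤ |t - b| ^ γ := by positivity
          linarith
        · have := Real.rpow_le_rpow_of_exponent_le h (min_le_left γ 1)
          linarith
      have a5 : r ^ γ ≤ r ^ (min γ 1) := Real.rpow_le_rpow_of_exponent_ge hr hr1 (min_le_left _ _)
      have a6 : C * (r ^ (min γ 1) * |t - b| ^ (min γ 1) + r ^ γ * |t - b| ^ γ) ≤
          C * (r ^ (min γ 1) * (1 + |t - b| ^ γ) + r ^ (min γ 1) * (1 + |t - b| ^ γ)) := by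
        gcongr; linarith
      linarith
    have k1 := key t b hb
    have k2 := key (-t) (-b) (by rwa [mul_neg, abs_neg])
    rw [mul_neg, mul_neg, show -t - -b = -(t - b) by ring, abs_neg] at k2
    have X0 : 0 ≤ 2 * C * (r ^ (min γ 1) * (1 + |t - b| ^ γ)) := by positivity
    set X := 2 * C * (r ^ (min γ 1) * (1 + |t - b| ^ γ)) with hX
    calc _ = δ * (lp * ((max (r * t) 0) ^ γ - (max (r * b) 0) ^ γ) + lm * ((max (-(r * t)) 0) ^ γ - (max (-(r * b)) 0) ^ γ)) := by ring
      _ ≤ δ * (lp * X + lm * X) := by gcongr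
      _ ≤ δ0 * (lp * X + lm * X) := by gcongr
      _ = _ := by rw [hX]; ring

def Mn (p : ℝ) (F : ℝ → ℝ) (Ω : Set E) (u : E → ℝ) : Prop :=
  (∀ x ∈ Ω, DifferentiableAt ℝ u x) ∧ ContinuousOn (fun x => ∇ u x) Ω ∧
  ∀ (z : E) (r : ℝ), 0 < r → closedBall z r ⊆ Ω → ∀ v : E → ℝ, Lip v → EqOn v u (sphere z r) →
      (∫ x in ball z r, (‖∇ u x‖ ^ p / p + F (u x))) ≤ ∫ x in ball z r, (‖∇ v x‖ ^ p / p + F (v x))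

theorem umin_of {F : ℝ → ℝ} {Ω : Set E} {u U : E → ℝ} {x0 : E} {r : ℝ} (h : Mn p F Ω u) (hr : 0 < r)
    (hb : closedBall x0 (2 * r) ⊆ Ω) (hU : ∀ x ∈ ball (0 : E) (5 / 4), U x = sc u x0 r x) :
    (∀ x ∈ ball (0 : E) 1, ∇ U x = ∇ u (x0 + r • x) ∧ r * U x = u (x0 + r • x)) ∧ UMin p (fun t => F (r * t)) U := by
  have h1 : ∀ x ∈ ball (0 : E) 1, ∇ U x = ∇ u (x0 + r • x) ∧ r * U x = u (x0 + r • x) := by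
    intro x hx
    have hx2 : x ∈ ball (0 : E) (5 / 4) := ball_subset_ball (by norm_num) hx
    constructor
    · rw [← grad_sc u x0 hr.ne']
      exact grad_congr (Filter.eventually_of_mem (isOpen_ball.mem_nhds hx2) hU)
    · rw [hU x hx2, sc, mul_inv_cancel_left₀ hr.ne']
  refine ⟨h1, fun v hv hvU => ?_⟩
  set w : E → ℝ := fun y => r * v (r⁻¹ • (y - x0)) with hw
  have hwv : ∀ x, r * v x = w (x0 + r • x) := fun x => by
    rw [hw]; beta_reduce; rw [add_sub_cancel_left, inv_smul_smul₀ hr.ne']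
  have hvs : v = sc w x0 r := funext fun x => by rw [sc, ← hwv, inv_mul_cancel_left₀ hr.ne']
  have hwL : Lip w := by
    obtain ⟨K, K0, hK, -⟩ := hv.ex
    refine Lip.mk' (K := K) K0 fun x y => ?_
    rw [hw]; beta_reduce
    rw [← mul_sub, abs_mul, abs_of_pos hr]
    refine (mul_le_mul_of_nonneg_left (hK _ _) hr.le).trans (le_of_eq ?_)
    rw [← smul_sub, norm_smul, norm_inv, Real.norm_of_nonneg hr.le, sub_sub_sub_cancel_right]
    field_simp
  have hm := h.2.2 x0 r hr ((closedBall_subset_closedBall (by linarith)).trans hb) w hwL (fun y hy => by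
    have hz : r⁻¹ • (y - x0) ∈ sphere (0 : E) 1 := by
      rw [mem_sphere, dist_eq_norm] at hy
      rw [mem_sphere_zero_iff_norm, norm_smul, hy, norm_inv, Real.norm_of_nonneg hr.le, inv_mul_cancel₀ hr.ne']
    rw [hw]; beta_reduce
    rw [hvU _ hz, hU _ (by rw [mem_ball_zero_iff, mem_sphere_zero_iff_norm.1 hz]; norm_num), sc, mul_inv_cancel_left₀ hr.ne', smul_inv_smul₀ hr.ne', add_sub_cancel])
  have e1 := cv (fun y => ‖∇ u y‖ ^ p / p + F (u y)) x0 hr 1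
  have e2 := cv (fun y => ‖∇ w y‖ ^ p / p + F (w y)) x0 hr 1
  rw [mul_one] at e1 e2
  have f1 : ∫ x in ball (0 : E) 1, (‖∇ U x‖ ^ p / p + F (r * U x)) = ∫ x in ball (0 : E) 1, (‖∇ u (x0 + r • x)‖ ^ p / p + F (u (x0 + r • x))) :=
    setIntegral_congr_fun measurableSet_ball fun x hx => by
      beta_reduce; rw [(h1 x hx).1, (h1 x hx).2]
  have f2 : ∫ x in ball (0 : E) 1, (‖∇ v x‖ ^ p / p + F (r * v x)) = ∫ x in ball (0 : E) 1, (‖∇ w (x0 + r • x)‖ ^ p / p + F (w (x0 + r • x))) :=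
    setIntegral_congr_fun measurableSet_ball fun x hx => by
      beta_reduce; rw [hwv]; conv_lhs => rw [hvs, grad_sc w x0 hr.ne']
  rw [f1, f2, e1, e2]
  exact mul_le_mul_of_nonneg_left hm (by positivity)

theorem grad_eta (k : ℕ) (x : E) (hx : ‖x‖ < 1) : DifferentiableAt ℝ (fun y : E => (1 - ‖y‖ ^ 2) ^ k) x ∧
    ‖∇ (fun y : E => (1 - ‖y‖ ^ 2) ^ k) x‖ * (1 - ‖x‖ ^ 2) ≤ 2 * k * (1 - ‖x‖ ^ 2) ^ k := by
  have h := (((hasStrictFDerivAt_norm_sq x).hasFDerivAt).const_sub 1).pow k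
  refine ⟨h.differentiableAt, ?_⟩
  have s0 : 0 < 1 - ‖x‖ ^ 2 := by nlinarith [norm_nonneg x]
  rcases k with _ | k
  · simp
  rw [gradient, LinearIsometryEquiv.norm_map, h.fderiv, norm_smul, norm_neg]
  have h2 : ‖(2 • innerSL ℝ x : E →L[ℝ] ℝ)‖ ≤ 2 := by
    rw [two_smul]
    refine (norm_add_le _ _).trans ?_
    rw [innerSL_apply_norm]; linarith
  calc _ ≤ ‖((k + 1 : ℕ) • (1 - ‖x‖ ^ 2) ^ (k + 1 - 1) : ℝ)‖ * 2 * (1 - ‖x‖ ^ 2) := by gcongr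
    _ = _ := by
      rw [Real.norm_of_nonneg (by positivity), nsmul_eq_mul, Nat.add_sub_cancel, pow_succ]; ring

theorem cacc0 (hp : 2 ≤ p) : ∃ C : ℝ, 0 < C ∧ ∀ (U : E → ℝ) (Φ : ℝ → ℝ) (A CM : ℝ), 0 ≤ A → 0 ≤ CM → ContDiff ℝ 1 U → HasCompactSupport U →
    Continuous Φ → UMin p Φ U → (∀ t, 0 ≤ Φ t) → (∀ t, |t| ≤ A → Φ t ≤ CM) → (∀ x ∈ ball (0 : E) 1, |U x| ≤ A) →
    ∫ x in ball (0 : E) (1 / 2), ‖∇ U x‖ ^ p ≤ C * (A ^ p + CM) := by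
  obtain ⟨k, hk⟩ := exists_nat_ge p
  have hp0 : 0 < p := by linarith
  set V0 := volume.real (ball (0 : E) 1) with hV0
  have V00 : 0 < V0 := ball_vpos one_pos
  refine ⟨(4 / 3) ^ k * (V0 * ((2 * k) ^ p + p) + 1), by positivity, ?_⟩
  intro U Φ A CM A0 CM0 hU hUc hΦ hmin Φ0 hΦM hUA
  set η : E → ℝ := fun y => (1 - ‖y‖ ^ 2) ^ k with hη
  have hηc : ContDiff ℝ 1 η := (contDiff_const.sub (contDiff_norm_sq ℝ)).pow k
  have hUL : Lip U := c1_lip hU hUc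
  have hηU : Lip (fun x => η x * U x) := c1_lip (hηc.mul hU) hUc.mul_left
  set v : E → ℝ := fun x => U x - η x * U x with hv
  have hvL : Lip v := hUL.sub hηU
  set B := ball (0 : E) 1 with hB
  have hs : ∀ x ∈ B, 0 < 1 - ‖x‖ ^ 2 ∧ 1 - ‖x‖ ^ 2 ≤ 1 := fun x hx => by
    rw [hB, mem_ball_zero_iff] at hx
    exact ⟨by nlinarith [norm_nonneg x], by nlinarith [norm_nonneg x]⟩
  have hη01 : ∀ x ∈ B, 0 < η x ∧ η x ≤ 1 := fun x hx => ⟨pow_pos (hs x hx).1 k, pow_le_one₀ (hs x hx).1.le (hs x hx).2⟩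
  have m := hmin v hvL fun x hx => by
    rw [mem_sphere_zero_iff_norm] at hx
    have : k ≠ 0 := by rintro rfl; norm_num at hk; linarith
    rw [hv, hη]; simp [hx, this]
  have iU : IntegrableOn (fun x => ‖∇ U x‖ ^ p) B := int_gp hp hUL _ _
  have iv : IntegrableOn (fun x => ‖∇ v x‖ ^ p) B := int_gp hp hvL _ _
  have iΦU : IntegrableOn (fun x => Φ (U x)) B := int_c (hΦ.comp hUL.cont) _ _
  have iΦv : IntegrableOn (fun x => Φ (v x)) B := int_c (hΦ.comp hvL.cont) _ _
  have iηU : IntegrableOn (fun x => η x * ‖∇ U x‖ ^ p) B := by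
    refine Integrable.mono iU ((hηc.continuous.measurable.mul ((meas_grad U).norm.pow_const p)).aestronglyMeasurable) ?_
    refine (ae_restrict_mem measurableSet_ball).mono fun x hx => ?_
    rw [norm_mul, Real.norm_of_nonneg (hη01 x hx).1.le]
    exact mul_le_of_le_one_left (norm_nonneg _) (hη01 x hx).2
  rw [integral_add (iU.div_const p) iΦU, integral_add (iv.div_const p) iΦv, integral_div, integral_div] at m
  have m1 : 0 ≤ ∫ x in B, Φ (U x) := integral_nonneg fun x => Φ0 _
  have m2 : ∫ x in B, Φ (v x) ≤ V0 * CM := by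
    rw [← int_cst]
    refine setIntegral_mono_on iΦv (int_const' _ _ _) measurableSet_ball fun x hx => hΦM _ ?_
    have e : v x = (1 - η x) * U x := by rw [hv]; ring
    obtain ⟨a, b⟩ := hη01 x hx
    rw [e, abs_mul, abs_of_nonneg (by linarith)]
    exact (mul_le_of_le_one_left (abs_nonneg _) (by linarith)).trans (hUA x hx)
  have m3 : ∫ x in B, ‖∇ v x‖ ^ p ≤ (∫ x in B, ‖∇ U x‖ ^ p) - (∫ x in B, η x * ‖∇ U x‖ ^ p) + V0 * (A * (2 * k)) ^ p := by
    rw [← int_cst, ← integral_sub iU iηU, ← integral_add (by exact iU.sub iηU) (int_const' _ _ _)]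
    refine setIntegral_mono_on iv ((iU.sub iηU).add (int_const' _ _ _)) measurableSet_ball fun x hx => ?_
    beta_reduce
    obtain ⟨a, b⟩ := hη01 x hx
    obtain ⟨s0, s1⟩ := hs x hx
    obtain ⟨g1, g2⟩ := grad_eta k x (mem_ball_zero_iff.1 hx)
    have hUd : DifferentiableAt ℝ U x := hU.differentiable one_ne_zero x
    have e : ∇ v x = (1 - η x) • ∇ U x - U x • ∇ η x := by
      have e1 := grad_sub (f := U) (g := fun x => η x * U x) hUd (g1.mul hUd)
      rw [grad_mul (f := η) (g := U) g1 hUd] at e1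
      rw [hv, e1, sub_smul, one_smul]; abel
    set s := 1 - ‖x‖ ^ 2 with hs'
    have n1 : ‖∇ v x‖ ≤ (1 - η x) * ‖∇ U x‖ + η x * (A * (2 * k) / s) := by
      rw [e]
      refine (norm_sub_le _ _).trans ?_
      rw [norm_smul, norm_smul, Real.norm_of_nonneg (by linarith), Real.norm_eq_abs]
      refine add_le_add le_rfl ?_
      calc |U x| * ‖∇ η x‖ ≤ A * (2 * k * η x / s) := by
            have := hUA x hx
            gcongr
            rw [le_div_iff₀ s0]; exact g2
        _ = _ := by ring
    refine (Real.rpow_le_rpow (norm_nonneg _) n1 hp0.le).trans ?_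
    have p1 : 0 ≤ A * (2 * k) / s := by positivity
    have p2 : 0 ≤ 1 - η x := by linarith
    have cx := (convexOn_rpow (p := p) (by linarith)).2 (mem_Ici.2 (norm_nonneg (∇ U x))) (mem_Ici.2 p1) p2 a.le (by ring)
    simp only [smul_eq_mul] at cx
    refine cx.trans ?_
    have q1 : η x * (A * (2 * k) / s) ^ p ≤ (A * (2 * k)) ^ p := by
      rw [Real.div_rpow (by positivity) s0.le, ← mul_div_assoc, div_le_iff₀ (by positivity), mul_comm]
      gcongr
      change s ^ k ≤ s ^ p
      rw [← Real.rpow_natCast]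
      exact Real.rpow_le_rpow_of_exponent_ge s0 s1 hk
    linarith
  have m4 : ∫ x in B, η x * ‖∇ U x‖ ^ p ≤ V0 * (A * (2 * k)) ^ p + p * (V0 * CM) := by
    have : (∫ x in B, ‖∇ U x‖ ^ p) / p ≤ (∫ x in B, ‖∇ v x‖ ^ p) / p + V0 * CM := by linarith
    have h2 := mul_le_mul_of_nonneg_left this hp0.le
    rw [mul_add, mul_div_cancel₀ _ hp0.ne', mul_div_cancel₀ _ hp0.ne'] at h2
    linarith
  have m5 : (3 / 4) ^ k * ∫ x in ball (0 : E) (1 / 2), ‖∇ U x‖ ^ p ≤ ∫ x in B, η x * ‖∇ U x‖ ^ p := by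
    have sub : ball (0 : E) (1 / 2) ⊆ B := ball_subset_ball (by norm_num)
    rw [← integral_const_mul]
    refine (setIntegral_mono_on ((iU.mono_set sub).const_mul _) (iηU.mono_set sub) measurableSet_ball fun x hx => ?_).trans
      (setIntegral_mono_set iηU ((ae_restrict_mem measurableSet_ball).mono fun x hx => ?_) sub.eventuallyLE)
    · beta_reduce
      rw [mem_ball_zero_iff] at hx
      refine mul_le_mul_of_nonneg_right (pow_le_pow_left₀ (by norm_num) ?_ k) (by positivity)
      nlinarith [norm_nonneg x]
    · exact mul_nonneg (hη01 x hx).1.le (by positivity)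
  have m6 : ∫ x in ball (0 : E) (1 / 2), ‖∇ U x‖ ^ p ≤ (4 / 3) ^ k * (V0 * (A * (2 * k)) ^ p + p * (V0 * CM)) := by
    have h1 := mul_le_mul_of_nonneg_left (m5.trans m4) (by positivity : (0 : ℝ) ≤ (4 / 3) ^ k)
    rw [← mul_assoc, ← mul_pow] at h1
    norm_num at h1 ⊢
    exact h1
  refine m6.trans ?_
  rw [mul_assoc]
  gcongr
  rw [Real.mul_rpow A0 (by positivity)]
  have a1 : 0 ≤ A ^ p := by positivity
  have a2 : 0 ≤ V0 * ((2 * k) ^ p * CM) := by positivity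
  have a3 : 0 ≤ V0 * (p * A ^ p) := by positivity
  linarith

end cac
end AP

namespace AP
set_option linter.unusedSectionVars false
open Filter
open scoped Topology Gradient NNReal
section stp
variable {E : Type*} [NormedAddCommGroup E] [InnerProductSpace ℝ E] [FiniteDimensional ℝ E]
  [MeasureSpace E] [BorelSpace E] [(volume : Measure E).IsAddHaarMeasure] [Nontrivial E]
variable {p ε : ℝ}

set_option maxHeartbeats 600000 in
theorem stp (hp : 2 ≤ p) {γ g CF M : ℝ} (hγ : 0 < γ) (hγp : γ < p) (hg : 0 < g) (hCF : 0 ≤ CF) : ∃ C0 θ : ℝ, 1 ≤ C0 ∧ 0 < θ ∧ θ < 1 ∧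
    ∀ (F : ℝ → ℝ) (Ω : Set E) (u : E → ℝ) (x0 : E) (r CM : ℝ), FH M γ g CF CM F → IsOpen Ω → Mn p F Ω u → (∀ x ∈ Ω, |u x| ≤ M) →
    0 < r → r ≤ 1 → closedBall x0 (2 * r) ⊆ Ω → ∀ (m : ℕ) (l : ℝ), l = 1 / 2 * (1 / 32) ^ m →
    (∫ x in ball (0 : E) 1, ‖∇ u (x0 + (l * r) • x)‖ ^ p ≤ C0 * (∫ x in ball (0 : E) 1, ‖∇ u (x0 + r • x)‖ ^ p) + C0 * (l ^ Module.finrank ℝ E)⁻¹ * r ^ g) ∧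
    ∃ ξ : E, ∫ x in ball (0 : E) 1, ‖∇ u (x0 + (l * r) • x) - ξ‖ ^ p ≤
      C0 * θ ^ m * ((∫ x in ball (0 : E) 1, ‖∇ u (x0 + r • x)‖ ^ p) + r ^ g) + C0 * (l ^ Module.finrank ℝ E)⁻¹ * r ^ g := by
  obtain ⟨C1, C10, hC1⟩ := compare (E := E) hp hγ hγp hCF
  obtain ⟨C2, θ, C20, θ0, θ1, hT⟩ := solT (E := E) hp
  have hp0 : 0 < p := by linarith
  set V0 := volume.real (ball (0 : E) 1) with hV0
  have V00 : 0 < V0 := ball_vpos one_pos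
  set n := Module.finrank ℝ E with hn
  set S := (2 : ℝ) ^ p with hS
  have S0 : 0 < S := by positivity
  set C0 := S * V0 * C2 * S * (1 + C1) + S * C1 + 1 + S * V0 * C2 * S * C1 with hC0
  have hA : 0 ≤ S * V0 * C2 * S * (1 + C1) := by positivity
  have hA2 : 0 ≤ S * V0 * C2 * S * C1 := by positivity
  have hA3 : 0 ≤ S * C1 := by positivity
  refine ⟨C0, θ, by rw [hC0]; linarith, θ0, θ1, ?_⟩
  intro F Ω u x0 r CM hF ho hm hu hr hr1 hb m l hl
  obtain ⟨U, hU, hUc, hUu⟩ := ext_c1 ho hm.1 hm.2.1 hr hb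
  obtain ⟨hUe, hUm⟩ := umin_of hm hr hb hUu
  have l0 : 0 < l := by rw [hl]; positivity
  have l1 : l ≤ 1 := by
    have : ((1 : ℝ) / 32) ^ m ≤ 1 := pow_le_one₀ (by norm_num) (by norm_num)
    rw [hl]; linarith
  have hmem : ∀ x ∈ ball (0 : E) 1, x0 + r • x ∈ Ω := fun x hx => hb (by
    refine ball_subset_closedBall (ball_subset_ball (by linarith) (mem_sc hr hx)))
  have rg1 : r ^ g ≤ 1 := Real.rpow_le_one hr.le hr1 hg.le
  have rg0 : 0 < r ^ g := by positivity
  obtain ⟨ε, h, ε0, hs, hUh⟩ := hC1 U (fun t => F (r * t)) (r ^ g) hU hUc (hF.1.comp (continuous_const.mul continuous_id)) rg0 rg1 hUm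
    (fun x hx t => hF.2.2.2 r t (U x) hr hr1 (by rw [(hUe x hx).2]; exact hu _ (hmem x hx)))
  have hUL : Lip U := c1_lip hU hUc
  set φ := ∫ x in ball (0 : E) 1, ‖∇ u (x0 + r • x)‖ ^ p with hφ
  have φe : φ = ∫ x in ball (0 : E) 1, ‖∇ U x‖ ^ p := setIntegral_congr_fun measurableSet_ball fun x hx => by
    beta_reduce; rw [(hUe x hx).1]
  have φ0 : 0 ≤ φ := integral_nonneg fun x => by positivity
  set J := S * (φ + C1 * r ^ g) with hJ
  have J0 : 0 < J := by positivity
  have iU : IntegrableOn (fun x => ‖∇ U x‖ ^ p) (ball (0 : E) 1) := int_gp hp hUL _ _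
  have ih : IntegrableOn (fun x => ‖∇ h x‖ ^ p) (ball (0 : E) 1) := int_gp hp hs.1 _ _
  have id : IntegrableOn (fun x => ‖∇ U x - ∇ h x‖ ^ p) (ball (0 : E) 1) := int_dp hp hUL hs.1 _ _
  have hJh : ∫ x in ball (0 : E) 1, ‖∇ h x‖ ^ p ≤ J := by
    have : ∫ x in ball (0 : E) 1, ‖∇ h x‖ ^ p ≤ ∫ x in ball (0 : E) 1, S * (‖∇ U x‖ ^ p + ‖∇ U x - ∇ h x‖ ^ p) := by
      refine setIntegral_mono ih ((iU.add id).const_mul S) fun x => ?_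
      have := tws (ξ := 0) (ζ := ∇ h x) (η := ∇ U x) hp0.le
      rwa [zero_sub, zero_sub, norm_neg, norm_neg] at this
    rw [integral_const_mul, integral_add iU id, ← φe] at this
    exact this.trans (by rw [hJ]; gcongr)
  obtain ⟨t1, t2⟩ := hT ε h J ε0 hs J0 hJh
  have key : ∀ (ξ : E) (T : ℝ), 0 ≤ T → (∀ᵐ x : E, x ∈ ball (0 : E) l → ‖∇ h x - ξ‖ ^ p ≤ T) →
      ∫ x in ball (0 : E) 1, ‖∇ u (x0 + (l * r) • x) - ξ‖ ^ p ≤ S * C1 * (l ^ n)⁻¹ * r ^ g + S * V0 * T := by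
    intro ξ T T0 hξ
    have e1 := cv (fun y => ‖∇ U y - ξ‖ ^ p) (0 : E) l0 1
    have e2 : ∫ x in ball (0 : E) 1, ‖∇ U (0 + l • x) - ξ‖ ^ p = ∫ x in ball (0 : E) 1, ‖∇ u (x0 + (l * r) • x) - ξ‖ ^ p :=
      setIntegral_congr_fun measurableSet_ball fun x hx => by
        have hx2 : l • x ∈ ball (0 : E) 1 := by
          rw [mem_ball_zero_iff] at hx ⊢
          rw [norm_smul, Real.norm_of_nonneg l0.le]
          exact (mul_le_of_le_one_left (norm_nonneg x) l1).trans_lt hx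
        beta_reduce
        rw [zero_add, (hUe _ hx2).1, smul_smul, mul_comm r l]
    rw [← e2, e1, mul_one]
    have sub : ball (0 : E) l ⊆ ball 0 1 := ball_subset_ball l1
    have cU : Continuous fun x => ∇ U x := (LinearIsometryEquiv.continuous _).comp (hU.continuous_fderiv one_ne_zero)
    have i1 : IntegrableOn (fun x => ‖∇ U x - ξ‖ ^ p) (ball (0 : E) l) :=
      int_c ((cU.sub continuous_const).norm.rpow_const fun _ => Or.inr hp0.le) _ _
    have i2 := id.mono_set sub
    have b1 : ∫ x in ball (0 : E) l, ‖∇ U x - ξ‖ ^ p ≤ ∫ x in ball (0 : E) l, S * (‖∇ U x - ∇ h x‖ ^ p + T) := by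
      refine integral_mono_ae i1 ((i2.add (int_const' _ _ _)).const_mul S) ?_
      filter_upwards [ae_restrict_mem measurableSet_ball, ae_restrict_of_ae hξ] with x hx h2
      exact (tws (η := ∇ h x) hp0.le).trans (mul_le_mul_of_nonneg_left (add_le_add le_rfl (h2 hx)) S0.le)
    rw [integral_const_mul, integral_add i2 (int_const' _ _ _), int_cst] at b1
    have b2 : ∫ x in ball (0 : E) l, ‖∇ U x - ∇ h x‖ ^ p ≤ C1 * r ^ g :=
      (setIntegral_mono_set id (Eventually.of_forall fun x => by positivity) sub.eventuallyLE).trans hUh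
    have b3 : volume.real (ball (0 : E) l) = l ^ n * V0 := by
      have := ball_mul (E := E) l0 1
      rwa [mul_one] at this
    rw [b3] at b1
    calc (l ^ n)⁻¹ * ∫ x in ball (0 : E) l, ‖∇ U x - ξ‖ ^ p ≤ (l ^ n)⁻¹ * (S * (C1 * r ^ g + l ^ n * V0 * T)) := by
          gcongr; exact b1.trans (by gcongr)
      _ = _ := by field_simp
  have hl2 : ball (0 : E) l ⊆ ball (0 : E) (1 / 2) := ball_subset_ball (by
    have : ((1 : ℝ) / 32) ^ m ≤ 1 := pow_le_one₀ (by norm_num) (by norm_num)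
    rw [hl]; linarith)
  have ln1 : 1 ≤ (l ^ n)⁻¹ := (one_le_inv₀ (by positivity)).2 (pow_le_one₀ l0.le l1)
  have q1 : S * C1 * (l ^ n)⁻¹ * r ^ g + S * V0 * C2 * S * C1 * (l ^ n)⁻¹ * r ^ g ≤ C0 * (l ^ n)⁻¹ * r ^ g := by
    rw [← add_mul, ← add_mul]; gcongr; rw [hC0]; linarith
  constructor
  · have := key 0 (C2 * J) (by positivity) (t1.mono fun x hx hxl => by rw [sub_zero]; exact hx (hl2 hxl))
    simp only [sub_zero] at this
    have q2 : S * V0 * (C2 * J) = S * V0 * C2 * S * φ + S * V0 * C2 * S * C1 * 1 * r ^ g := by rw [hJ]; ring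
    have q3 : S * V0 * C2 * S * C1 * 1 * r ^ g ≤ S * V0 * C2 * S * C1 * (l ^ n)⁻¹ * r ^ g := by gcongr
    have q4 : S * V0 * C2 * S * φ ≤ C0 * φ := by
      gcongr
      rw [hC0]
      have : S * V0 * C2 * S * (1 + C1) = S * V0 * C2 * S + S * V0 * C2 * S * C1 := by ring
      linarith
    linarith
  · obtain ⟨ξ, hξ⟩ := t2 m
    refine ⟨ξ, (key ξ (C2 * θ ^ m * J) (by positivity) (by rw [hl]; exact hξ)).trans ?_⟩
    have q2 : S * V0 * (C2 * θ ^ m * J) = S * V0 * C2 * S * (φ + C1 * r ^ g) * θ ^ m := by rw [hJ]; ring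
    have q3 : S * V0 * C2 * S * (φ + C1 * r ^ g) ≤ C0 * (φ + r ^ g) := by
      calc S * V0 * C2 * S * (φ + C1 * r ^ g) ≤ S * V0 * C2 * S * ((1 + C1) * (φ + r ^ g)) := by
            gcongr
            have : 0 ≤ C1 * φ := by positivity
            linarith [add_mul 1 C1 (φ + r ^ g), mul_add C1 φ (r ^ g)]
        _ = S * V0 * C2 * S * (1 + C1) * (φ + r ^ g) := by ring
        _ ≤ _ := by gcongr; rw [hC0]; linarith
    have q4 := mul_le_mul_of_nonneg_right q3 (pow_nonneg θ0.le m)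
    have q5 : 0 ≤ S * V0 * C2 * S * C1 * (l ^ n)⁻¹ * r ^ g := by positivity
    linarith
end stp
end AP

namespace AP
set_option linter.unusedSectionVars false
open Filter
open scoped Topology Gradient NNReal
section itr
variable {E : Type*} [NormedAddCommGroup E] [InnerProductSpace ℝ E] [FiniteDimensional ℝ E]
  [MeasureSpace E] [BorelSpace E] [(volume : Measure E).IsAddHaarMeasure] [Nontrivial E]
variable {p ε : ℝ}

theorem iter {C0 θ g : ℝ} (n : ℕ) (hC0 : 1 ≤ C0) (θ0 : 0 < θ) (θ1 : θ < 1) (hg : 0 < g) : ∃ Q K : ℝ, 0 < Q ∧ Q ≤ 1 / 32 ∧ 0 < K ∧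
    ∀ (r0 : ℝ) (φ : ℝ → ℝ) (X : ℝ → ℝ → Prop), 0 < r0 → r0 ≤ 1 → (∀ r, 0 ≤ φ r) → (∀ r a b, a ≤ b → X r a → X r b) →
    (∀ r, 0 < r → r ≤ r0 → ∀ (m : ℕ) (l : ℝ), l = 1 / 2 * (1 / 32) ^ m → φ (l * r) ≤ C0 * φ r + C0 * (l ^ n)⁻¹ * r ^ g ∧
      X (l * r) (C0 * θ ^ m * (φ r + r ^ g) + C0 * (l ^ n)⁻¹ * r ^ g)) →
    ∀ k : ℕ, X (r0 / 2 * Q ^ k) (K * (1 + φ r0) * (1 / 2) ^ k) := by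
  obtain ⟨J, hJ⟩ := exists_nat_ge ((n + 1) / g)
  rw [div_le_iff₀ hg] at hJ
  have c0 : 0 < (2 * C0) ^ J := by positivity
  obtain ⟨m1', hm1'⟩ := exists_pow_lt_of_lt_one (by positivity : 0 < 1 / 2 / (2 * C0) ^ J) θ1
  set m1 := m1' + 1 with hm1d
  have hm1 : θ ^ m1 * (2 * C0) ^ J ≤ 1 / 2 := by
    rw [← le_div_iff₀ c0]
    exact (pow_le_pow_of_le_one θ0.le θ1.le (Nat.le_succ _)).trans hm1'.le
  set μ : ℝ := (1 / 32) ^ m1 with hμ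
  have μ0 : 0 < μ := by positivity
  have μ1 : μ ≤ 1 / 32 := by
    rw [hμ, hm1d, pow_succ]
    exact mul_le_of_le_one_left (by norm_num) (pow_le_one₀ (by norm_num) (by norm_num))
  set q : ℝ := 1 / 2 * μ with hq
  have q0 : 0 < q := by positivity
  have q1 : q ≤ 1 / 2 := by linarith
  set D := (q ^ n)⁻¹ with hD
  have D0 : 0 < D := by positivity
  have Q0 : 0 < μ * q ^ J := by positivity
  refine ⟨μ * q ^ J, C0 * (D + 1) + C0 * 2 ^ n, Q0,
    (mul_le_of_le_one_right μ0.le (pow_le_one₀ q0.le (by linarith))).trans μ1, by positivity, ?_⟩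
  intro r0 φ X hr0 hr1 φ0 Xm H k
  have h1 : ∀ i : ℕ, φ (r0 * q ^ i) ≤ (2 * C0) ^ i * (φ r0 + D) := by
    intro i
    induction i with
    | zero => simp; exact D0.le
    | succ i ih =>
      have qi : q ^ i ≤ 1 := pow_le_one₀ q0.le (by linarith)
      have ri : r0 * q ^ i ≤ r0 := mul_le_of_le_one_right hr0.le qi
      have ri0 : 0 < r0 * q ^ i := by positivity
      have h2 := (H (r0 * q ^ i) ri0 ri m1 q hq).1
      rw [show q * (r0 * q ^ i) = r0 * q ^ (i + 1) by ring] at h2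
      have h3 : (r0 * q ^ i) ^ g ≤ 1 := Real.rpow_le_one ri0.le (ri.trans hr1) hg.le
      have h4 : (1 : ℝ) ≤ (2 * C0) ^ i := one_le_pow₀ (by linarith)
      have φr := φ0 r0
      calc φ (r0 * q ^ (i + 1)) ≤ C0 * ((2 * C0) ^ i * (φ r0 + D)) + C0 * D * 1 := h2.trans (by gcongr)
        _ ≤ C0 * ((2 * C0) ^ i * (φ r0 + D)) + C0 * ((2 * C0) ^ i * (φ r0 + D)) := by
            rw [mul_one]
            gcongr
            calc D ≤ 1 * (φ r0 + D) := by linarith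
              _ ≤ _ := by gcongr
        _ = _ := by ring
  have qi : q ^ (J * k) ≤ 1 := pow_le_one₀ q0.le (by linarith)
  set r := r0 * q ^ (J * k) with hr
  have ri : r ≤ r0 := mul_le_of_le_one_right hr0.le qi
  have ri0 : 0 < r := by positivity
  have h2 := (H r ri0 ri (m1 * k) (1 / 2 * (1 / 32) ^ (m1 * k)) rfl).2
  have e : 1 / 2 * (1 / 32) ^ (m1 * k) * r = r0 / 2 * (μ * q ^ J) ^ k := by
    rw [hr, pow_mul, pow_mul, mul_pow]; ring
  rw [e] at h2
  refine Xm _ _ _ ?_ h2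
  have φr := φ0 r0
  have a1 : r ^ g ≤ 1 := Real.rpow_le_one ri0.le (ri.trans hr1) hg.le
  have a2 : (1 : ℝ) ≤ (2 * C0) ^ (J * k) := one_le_pow₀ (by linarith)
  have a3 : C0 * θ ^ (m1 * k) * (φ r + r ^ g) ≤ C0 * (D + 1) * (1 + φ r0) * (1 / 2) ^ k := by
    have b1 : φ r + r ^ g ≤ (2 * C0) ^ (J * k) * (φ r0 + D + 1) := by
      have := h1 (J * k)
      rw [← hr] at this
      linarith [mul_add ((2 * C0) ^ (J * k)) (φ r0 + D) 1]
    calc _ ≤ C0 * θ ^ (m1 * k) * ((2 * C0) ^ (J * k) * (φ r0 + D + 1)) := by gcongr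
      _ = C0 * (φ r0 + D + 1) * (θ ^ m1 * (2 * C0) ^ J) ^ k := by rw [mul_pow, pow_mul, pow_mul]; ring
      _ ≤ C0 * ((D + 1) * (1 + φ r0)) * (1 / 2) ^ k := by
          gcongr
          have : 0 ≤ D * φ r0 := by positivity
          linarith
      _ = _ := by ring
  have a4 : C0 * ((1 / 2 * (1 / 32) ^ (m1 * k)) ^ n)⁻¹ * r ^ g ≤ C0 * 2 ^ n * 1 * (1 / 2) ^ k := by
    have b1 : r ^ g ≤ (q ^ k) ^ (n + 1) := by
      have : r ≤ q ^ (J * k) := by rw [hr]; exact mul_le_of_le_one_left (by positivity) hr1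
      calc r ^ g ≤ (q ^ (J * k)) ^ g := Real.rpow_le_rpow ri0.le this hg.le
        _ = (q ^ k) ^ (J * g) := by
            rw [mul_comm J k, pow_mul, ← Real.rpow_natCast (q ^ k) J, ← Real.rpow_mul (by positivity)]
        _ ≤ (q ^ k) ^ ((n + 1 : ℕ) : ℝ) := Real.rpow_le_rpow_of_exponent_ge (by positivity) (pow_le_one₀ q0.le (by linarith)) (by push_cast; exact hJ)
        _ = _ := Real.rpow_natCast _ _
    have b2 : (q ^ k) ^ (n + 1) ≤ (μ ^ k) ^ n * (1 / 2) ^ k := by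
      rw [pow_succ]; gcongr; linarith
    calc _ ≤ C0 * ((1 / 2 * (1 / 32) ^ (m1 * k)) ^ n)⁻¹ * ((μ ^ k) ^ n * (1 / 2) ^ k) := by gcongr; exact b1.trans b2
      _ = _ := by
        rw [pow_mul, ← hμ, mul_pow, one_div_pow]
        field_simp
  have a5 : C0 * 2 ^ n * 1 * (1 / 2) ^ k ≤ C0 * 2 ^ n * (1 + φ r0) * (1 / 2) ^ k := by gcongr; linarith
  calc _ ≤ C0 * (D + 1) * (1 + φ r0) * (1 / 2) ^ k + C0 * 2 ^ n * (1 + φ r0) * (1 / 2) ^ k := add_le_add a3 (a4.trans a5)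
    _ = _ := by ring
end itr
end AP

namespace AP
set_option linter.unusedSectionVars false
open Filter
open scoped Topology Gradient NNReal
section cam
variable {E : Type*} [NormedAddCommGroup E] [InnerProductSpace ℝ E] [FiniteDimensional ℝ E]
  [MeasureSpace E] [BorelSpace E] [(volume : Measure E).IsAddHaarMeasure] [Nontrivial E]
variable {p ε : ℝ}

theorem vol_b (x : E) {s : ℝ} (hs : 0 < s) : volume.real (ball x s) = s ^ Module.finrank ℝ E * volume.real (ball (0 : E) 1) := by
  rw [← ball_mul hs 1, mul_one, measureReal_def, measureReal_def, Measure.addHaar_ball_center]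

theorem int_f (hp : 2 ≤ p) {f : E → E} {Ω : Set E} (hf : ContinuousOn f Ω) {x : E} {r : ℝ} (hb : closedBall x r ⊆ Ω) (ξ : E) :
    IntegrableOn (fun y => ‖f y - ξ‖ ^ p) (ball x r) := by
  have h1 : ContinuousOn (fun y => ‖f y - ξ‖ ^ p) (closedBall x r) :=
    ((hf.mono hb).sub continuousOn_const).norm.rpow_const fun _ _ => Or.inr (by linarith)
  exact (h1.integrableOn_compact (isCompact_closedBall x r)).mono_set ball_subset_closedBall

theorem cmp2 (hp : 2 ≤ p) {f : E → E} {Ω : Set E} (hf : ContinuousOn f Ω) {x y z ξ ζ : E} {R S s T T' : ℝ} (hs : 0 < s)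
    (hx : closedBall x R ⊆ Ω) (hy : closedBall y S ⊆ Ω) (zx : ball z s ⊆ ball x R) (zy : ball z s ⊆ ball y S)
    (h1 : ∫ y in ball x R, ‖f y - ξ‖ ^ p ≤ T) (h2 : ∫ y in ball y S, ‖f y - ζ‖ ^ p ≤ T') :
    ‖ξ - ζ‖ ^ p * (s ^ Module.finrank ℝ E * volume.real (ball (0 : E) 1)) ≤ 2 ^ p * (T + T') := by
  have i1 := int_f hp hf hx ξ
  have i2 := int_f hp hf hy ζ
  have a1 := (setIntegral_mono_set i1 (Eventually.of_forall fun x => by positivity) zx.eventuallyLE).trans h1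
  have a2 := (setIntegral_mono_set i2 (Eventually.of_forall fun x => by positivity) zy.eventuallyLE).trans h2
  have b : ∫ _ in ball z s, ‖ξ - ζ‖ ^ p ≤ ∫ y in ball z s, 2 ^ p * (‖f y - ξ‖ ^ p + ‖f y - ζ‖ ^ p) := by
    refine setIntegral_mono (int_const' _ _ _) (((i1.mono_set zx).add (i2.mono_set zy)).const_mul _) fun w => ?_
    have := tws (ξ := ξ) (ζ := ζ) (η := f w) (q := p) (by linarith)
    rwa [norm_sub_rev ξ (f w)] at this
  rw [int_cst, vol_b z hs, integral_const_mul, integral_add (i1.mono_set zx) (i2.mono_set zy)] at b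
  rw [mul_comm]
  exact b.trans (by gcongr)

theorem root (hp : 2 ≤ p) {a K : ℝ} (ha : 0 ≤ a) (hK : 0 ≤ K) (k : ℕ) (h : a ^ p ≤ K * (1 / 2) ^ k) : a ≤ K ^ (1 / p) * ((1 / 2 : ℝ) ^ (1 / p)) ^ k := by
  have hp0 : 0 < p := by linarith
  have h1 := Real.rpow_le_rpow (by positivity) h (by positivity : 0 ≤ 1 / p)
  rw [← Real.rpow_mul ha, mul_one_div_cancel hp0.ne', Real.rpow_one, Real.mul_rpow hK (by positivity)] at h1
  refine h1.trans (le_of_eq ?_)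
  rw [← Real.rpow_natCast, ← Real.rpow_natCast, ← Real.rpow_mul (by norm_num), ← Real.rpow_mul (by norm_num), mul_comm (k : ℝ)]

theorem camp (hp : 2 ≤ p) {Q K : ℝ} (Q0 : 0 < Q) (Q1 : Q ≤ 1 / 32) (K0 : 0 < K) : ∃ C : ℝ, 0 < C ∧
    ∀ (f : E → E) (Ω : Set E) (x0 : E) (ρ : ℝ), ContinuousOn f Ω → 0 < ρ → closedBall x0 ρ ⊆ Ω →
    ∀ ξ : ℕ → E, (∀ k, ∫ y in ball x0 (ρ * Q ^ k), ‖f y - ξ k‖ ^ p ≤ K * (1 / 2) ^ k * (ρ * Q ^ k) ^ Module.finrank ℝ E) →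
    ∀ k, ‖ξ k - f x0‖ ≤ C * ((1 / 2 : ℝ) ^ (1 / p)) ^ k := by
  have hp0 : 0 < p := by linarith
  set V0 := volume.real (ball (0 : E) 1) with hV0
  have V00 : 0 < V0 := ball_vpos one_pos
  set n := Module.finrank ℝ E with hn
  set t := (1 / 2 : ℝ) ^ (1 / p) with ht
  have t0 : 0 < t := by positivity
  have t1 : t < 1 := Real.rpow_lt_one (by norm_num) (by norm_num) (by positivity)
  set K1 := 2 ^ p * (K * ((Q ^ n)⁻¹ + 1)) / V0 with hK1
  have K10 : 0 < K1 := by positivity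
  have ht1 : 0 < 1 - t := by linarith
  refine ⟨K1 ^ (1 / p) / (1 - t), by positivity, ?_⟩
  intro f Ω x0 ρ hf hρ hb ξ hξ
  have R0 : ∀ k, 0 < ρ * Q ^ k := fun k => by positivity
  have R1 : ∀ k, ρ * Q ^ k ≤ ρ := fun k => mul_le_of_le_one_right hρ.le (pow_le_one₀ Q0.le (by linarith))
  have hbk : ∀ k, closedBall x0 (ρ * Q ^ k) ⊆ Ω := fun k => (closedBall_subset_closedBall (R1 k)).trans hb
  have st : ∀ k, dist (ξ k) (ξ (k + 1)) ≤ K1 ^ (1 / p) * t ^ k := by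
    intro k
    rw [dist_eq_norm]
    refine root hp (norm_nonneg _) K10.le k ?_
    have hle : ρ * Q ^ (k + 1) ≤ ρ * Q ^ k := by
      gcongr ρ * ?_
      exact pow_le_pow_of_le_one Q0.le (by linarith) (Nat.le_succ k)
    have := cmp2 hp hf (R0 (k + 1)) (hbk k) (hbk (k + 1)) (ball_subset_ball hle) subset_rfl (hξ k) (hξ (k + 1))
    rw [← hV0, ← hn] at this
    set X := (ρ * Q ^ (k + 1)) ^ n with hX
    have X0 : 0 < X := by rw [hX]; exact pow_pos (R0 _) _
    have e : (ρ * Q ^ k) ^ n = (Q ^ n)⁻¹ * X := by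
      rw [hX, pow_succ, ← mul_assoc, mul_pow _ Q]; field_simp
    have h2 : K * (1 / 2 : ℝ) ^ (k + 1) * X ≤ K * (1 / 2) ^ k * X := by
      gcongr ?_ * ?_ * ?_
      exact pow_le_pow_of_le_one (by norm_num) (by norm_num) (Nat.le_succ k)
    rw [e] at this
    have h3 : ‖ξ k - ξ (k + 1)‖ ^ p * (X * V0) ≤ K1 * (1 / 2) ^ k * (X * V0) := by
      refine this.trans ?_
      calc _ ≤ (2 : ℝ) ^ p * (K * (1 / 2) ^ k * ((Q ^ n)⁻¹ * X) + K * (1 / 2) ^ k * X) := by gcongr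
        _ = _ := by rw [hK1]; field_simp
    exact le_of_mul_le_mul_right h3 (by positivity)
  have pick : ∀ k, ∃ y ∈ ball x0 (ρ * Q ^ k), ‖f y - ξ k‖ ^ p ≤ 2 * K / V0 * (1 / 2) ^ k := by
    intro k
    by_contra! hc
    have h1 : ∫ _ in ball x0 (ρ * Q ^ k), 2 * K / V0 * (1 / 2 : ℝ) ^ k ≤ ∫ y in ball x0 (ρ * Q ^ k), ‖f y - ξ k‖ ^ p :=
      setIntegral_mono_on (int_const' _ _ _) (int_f hp hf (hbk k) _) measurableSet_ball fun y hy => (hc y hy).le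
    rw [int_cst, vol_b x0 (R0 k), ← hn, ← hV0] at h1
    have h2 := h1.trans (hξ k)
    have e : (ρ * Q ^ k) ^ n * V0 * (2 * K / V0 * (1 / 2) ^ k) = 2 * (K * (1 / 2) ^ k * (ρ * Q ^ k) ^ n) := by field_simp
    have : 0 < K * (1 / 2) ^ k * (ρ * Q ^ k) ^ n := by have := R0 k; positivity
    linarith
  choose y hy1 hy2 using pick
  have ylim : Tendsto y atTop (𝓝 x0) := by
    rw [tendsto_iff_dist_tendsto_zero]
    refine squeeze_zero (fun _ => dist_nonneg) (fun k => (mem_ball.1 (hy1 k)).le) ?_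
    have := (tendsto_pow_atTop_nhds_zero_of_lt_one Q0.le (by linarith : Q < 1)).const_mul ρ
    rwa [mul_zero] at this
  have flim : Tendsto (fun k => f (y k)) atTop (𝓝 (f x0)) :=
    ((hf.mono hb).continuousAt (closedBall_mem_nhds x0 hρ)).tendsto.comp ylim
  have dl : Tendsto (fun k => f (y k) - ξ k) atTop (𝓝 0) := by
    refine squeeze_zero_norm (fun k => root hp (norm_nonneg _) (by positivity) k (hy2 k)) ?_
    have := (tendsto_pow_atTop_nhds_zero_of_lt_one t0.le t1).const_mul ((2 * K / V0) ^ (1 / p))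
    rwa [mul_zero] at this
  have xlim : Tendsto ξ atTop (𝓝 (f x0)) := by
    have := flim.sub dl
    simpa using this
  intro k
  have := dist_le_of_le_geometric_of_tendsto t (K1 ^ (1 / p)) t1 st xlim k
  rw [dist_eq_norm] at this
  refine this.trans (le_of_eq ?_)
  ring

theorem exc (hp : 2 ≤ p) {γ g CF CM M d : ℝ} (hγ : 0 < γ) (hγp : γ < p) (hg : 0 < g) (hCF : 0 ≤ CF) (hCM : 0 ≤ CM) (hM : 0 < M) (hd : 0 < d) :
    ∃ Q K ρ : ℝ, 0 < Q ∧ Q ≤ 1 / 32 ∧ 0 < K ∧ 0 < ρ ∧ ρ < d ∧ ∀ (F : ℝ → ℝ) (Ω : Set E) (u : E → ℝ), FH M γ g CF CM F → IsOpen Ω → Mn p F Ω u →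
    (∀ x ∈ Ω, |u x| ≤ M) → ∀ x0 : E, ball x0 d ⊆ Ω →
    (∫ y in ball x0 ρ, ‖∇ u y‖ ^ p ≤ K * ρ ^ Module.finrank ℝ E) ∧
    ∃ ξ : ℕ → E, ∀ k, ∫ y in ball x0 (ρ * Q ^ k), ‖∇ u y - ξ k‖ ^ p ≤ K * (1 / 2) ^ k * (ρ * Q ^ k) ^ Module.finrank ℝ E := by
  obtain ⟨C0, θ, hC0, θ0, θ1, H⟩ := stp (E := E) (M := M) hp hγ hγp hg hCF
  set n := Module.finrank ℝ E with hn
  obtain ⟨Q, K, Q0, Q1, K0, hI⟩ := iter n hC0 θ0 θ1 hg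
  obtain ⟨Cc, Cc0, hcc⟩ := cacc0 (E := E) hp
  set r1 := min (d / 4) 1 with hr1
  have r10 : 0 < r1 := lt_min (by positivity) one_pos
  have r1d : r1 ≤ d / 4 := min_le_left _ _
  have r11 : r1 ≤ 1 := min_le_right _ _
  set T := Cc * ((M / r1) ^ p + CM) with hT
  have T0 : 0 < T := by positivity
  set W := 2 ^ n * T with hW
  have W0 : 0 < W := by positivity
  refine ⟨Q, K * (1 + W) + 2 ^ n * W, r1 / 4, Q0, Q1, by positivity, by positivity, by linarith, ?_⟩
  intro F Ω u hF ho hm hu x0 hb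
  have cb : ∀ r, r ≤ r1 → closedBall x0 (2 * r) ⊆ Ω := fun r hr => (closedBall_subset_ball (by linarith)).trans hb
  obtain ⟨U, hU, hUc, hUu⟩ := ext_c1 ho hm.1 hm.2.1 r10 (cb r1 le_rfl)
  obtain ⟨hUe, hUm⟩ := umin_of hm r10 (cb r1 le_rfl) hUu
  have hmem : ∀ x ∈ ball (0 : E) 1, x0 + r1 • x ∈ Ω := fun x hx =>
    cb r1 le_rfl (ball_subset_closedBall (ball_subset_ball (by linarith) (mem_sc r10 hx)))
  have c1 := hcc U (fun t => F (r1 * t)) (M / r1) CM (by positivity) hCM hU hUc (hF.1.comp (continuous_const.mul continuous_id)) hUm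
    (fun t => hF.2.1 _) (fun t ht => hF.2.2.1 _ (by
      rw [abs_mul, abs_of_pos r10]; rwa [le_div_iff₀ r10, mul_comm] at ht))
    (fun x hx => by
      have := hu _ (hmem x hx)
      rw [← (hUe x hx).2, abs_mul, abs_of_pos r10] at this
      rwa [le_div_iff₀ r10, mul_comm])
  have c2 : ∫ x in ball (0 : E) (1 / 2), ‖∇ u (x0 + r1 • x)‖ ^ p ≤ T := by
    refine le_trans (le_of_eq (setIntegral_congr_fun measurableSet_ball fun x hx => ?_)) c1
    beta_reduce; rw [(hUe x (ball_subset_ball (by norm_num) hx)).1]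
  rw [cv (fun y => ‖∇ u y‖ ^ p) x0 r10, ← hn, inv_mul_le_iff₀ (by positivity)] at c2
  set r0 := r1 / 2 with hr0
  have r00 : 0 < r0 := by positivity
  have c3 : ∫ x in ball (0 : E) 1, ‖∇ u (x0 + r0 • x)‖ ^ p ≤ W := by
    rw [cv (fun y => ‖∇ u y‖ ^ p) x0 r00, ← hn, inv_mul_le_iff₀ (by positivity), mul_one]
    rw [mul_one_div] at c2
    refine c2.trans (le_of_eq ?_)
    rw [hW, hr0, div_pow]; field_simp
  have it := hI r0 (fun r => ∫ x in ball (0 : E) 1, ‖∇ u (x0 + r • x)‖ ^ p)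
    (fun r a => ∃ ξ : E, ∫ x in ball (0 : E) 1, ‖∇ u (x0 + r • x) - ξ‖ ^ p ≤ a) r00 (by linarith)
    (fun r => integral_nonneg fun x => by positivity) (fun r a b hab ⟨ξ, h⟩ => ⟨ξ, h.trans hab⟩)
    (fun r hr hrr m l hl => H F Ω u x0 r CM hF ho hm hu hr (by linarith) (cb r (by linarith)) m l hl)
  have e4 : r0 / 2 = r1 / 4 := by rw [hr0]; ring
  constructor
  · have sub : ball x0 (r1 / 4) ⊆ ball x0 r0 := ball_subset_ball (by linarith)
    rw [cv (fun y => ‖∇ u y‖ ^ p) x0 r00, ← hn, inv_mul_le_iff₀ (by positivity), mul_one] at c3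
    have i1 := int_f hp hm.2.1 (x := x0) (r := r0) ((closedBall_subset_closedBall (by linarith)).trans (cb r0 (by linarith))) 0
    simp only [sub_zero] at i1
    refine ((setIntegral_mono_set i1 (Eventually.of_forall fun x => by positivity) sub.eventuallyLE).trans c3).trans ?_
    have e : r0 ^ n * W = 2 ^ n * W * (r1 / 4) ^ n := by
      rw [show r0 = 2 * (r1 / 4) by rw [hr0]; ring, mul_pow]; ring
    rw [e]; gcongr
    have : 0 < K * (1 + W) := by positivity
    linarith
  · choose ξ hξ using it
    refine ⟨ξ, fun k => ?_⟩
    have h1 := hξ k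
    rw [e4] at h1
    have R0 : 0 < r1 / 4 * Q ^ k := by positivity
    rw [cv (fun y => ‖∇ u y - ξ k‖ ^ p) x0 R0, ← hn, inv_mul_le_iff₀ (by positivity), mul_one, mul_comm ((r1 / 4 * Q ^ k) ^ n)] at h1
    refine h1.trans ?_
    gcongr
    have : 0 ≤ 2 ^ n * W := by positivity
    calc _ ≤ K * (1 + W) := by gcongr
      _ ≤ _ := by linarith
end cam
end AP

namespace AP
set_option linter.unusedSectionVars false
open Filter
open scoped Topology Gradient NNReal
section fin
variable {E : Type*} [NormedAddCommGroup E] [InnerProductSpace ℝ E] [FiniteDimensional ℝ E]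
  [MeasureSpace E] [BorelSpace E] [(volume : Measure E).IsAddHaarMeasure] [Nontrivial E]
variable {p ε : ℝ}

theorem ball_in {Ω : Set E} {x : E} {d : ℝ} (hx : x ∈ Ω) (hd : 0 < d) (h : d ≤ infDist x (frontier Ω)) : ball x d ⊆ Ω := by
  by_contra hc
  obtain ⟨y, hy, hyΩ⟩ := not_subset.1 hc
  have hf : ∀ z ∈ ball x d, z ∈ interior Ω ∪ interior Ωᶜ := fun z hz => by
    rw [← compl_frontier_eq_union_interior]
    intro hzf
    have := infDist_le_dist_of_mem (x := x) hzf
    rw [mem_ball, dist_comm] at hz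
    linarith
  obtain ⟨w, -, w1, w2⟩ := (convex_ball x d).isPreconnected _ _ isOpen_interior isOpen_interior hf
    ⟨x, mem_ball_self hd, (hf x (mem_ball_self hd)).resolve_right fun h => interior_subset h hx⟩
    ⟨y, hy, (hf y hy).resolve_left fun h => hyΩ (interior_subset h)⟩
  exact interior_subset w2 (interior_subset w1)

theorem hol {a B G t Q ρ s : ℝ} (t0 : 0 < t) (t1 : t < 1) (Q0 : 0 < Q) (Qt : Q < t) (ρ0 : 0 < ρ) (B0 : 0 ≤ B) (G0 : 0 ≤ G) (s0 : 0 < s)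
    (h1 : a ≤ B) (h2 : ∀ k : ℕ, s ≤ ρ * Q ^ k → a ≤ G * t ^ k) : a ≤ (G / t + B) * (1 / ρ) ^ (Real.log t / Real.log Q) * s ^ (Real.log t / Real.log Q) := by
  have lQ : Real.log Q < 0 := Real.log_neg Q0 (by linarith)
  set α := Real.log t / Real.log Q with hα
  have α0 : 0 < α := div_pos_of_neg_of_neg (Real.log_neg t0 t1) lQ
  have hQα : Q ^ α = t := by
    rw [Real.rpow_def_of_pos Q0, hα, mul_div_cancel₀ _ lQ.ne, Real.exp_log t0]
  rw [mul_assoc, ← Real.mul_rpow (by positivity) s0.le, one_div_mul_eq_div]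
  rcases le_or_gt (s / ρ) 1 with h | h
  · obtain ⟨k, k1, k2⟩ := exists_nat_pow_near_of_lt_one (by positivity : 0 < s / ρ) h Q0 (by linarith : Q < 1)
    have b1 := h2 k (by rwa [div_le_iff₀ ρ0, mul_comm] at k2)
    have b2 : t ^ (k + 1) ≤ (s / ρ) ^ α := by
      rw [← hQα, ← Real.rpow_natCast, ← Real.rpow_mul Q0.le, mul_comm, Real.rpow_mul Q0.le, Real.rpow_natCast]
      exact Real.rpow_le_rpow (by positivity) k1.le α0.le
    calc a ≤ G * t ^ k := b1
      _ = G / t * t ^ (k + 1) := by rw [pow_succ]; field_simp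
      _ ≤ (G / t + B) * (s / ρ) ^ α := by gcongr; linarith
  · have : 1 ≤ (s / ρ) ^ α := Real.one_le_rpow h.le α0.le
    have : 0 ≤ G / t := by positivity
    calc a ≤ (G / t + B) * 1 := by linarith
      _ ≤ _ := by gcongr

theorem main (hp : 2 ≤ p) {γ g CF CM M d : ℝ} (hγ : 0 < γ) (hγp : γ < p) (hg : 0 < g) (hCF : 0 ≤ CF) (hCM : 0 ≤ CM) (hM : 0 < M) (hd : 0 < d) :
    ∃ α C : ℝ, α ∈ Ioo (0 : ℝ) 1 ∧ 0 < C ∧ ∀ (F : ℝ → ℝ) (Ω : Set E) (u : E → ℝ), FH M γ g CF CM F → IsOpen Ω → Mn p F Ω u →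
    (∀ x ∈ Ω, |u x| ≤ M) → ∀ x : E, ball x d ⊆ Ω → ‖∇ u x‖ ≤ C ∧ ∀ y, ball y d ⊆ Ω → ‖∇ u x - ∇ u y‖ ≤ C * ‖x - y‖ ^ α := by
  obtain ⟨Q, K, ρ, Q0, Q1, K0, ρ0, ρd, hE⟩ := exc (E := E) hp hγ hγp hg hCF hCM hM hd
  obtain ⟨C, C0, hC⟩ := camp (E := E) hp Q0 Q1 K0
  have hp0 : 0 < p := by linarith
  set V0 := volume.real (ball (0 : E) 1) with hV0
  have V00 : 0 < V0 := ball_vpos one_pos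
  set n := Module.finrank ℝ E with hn
  set t := (1 / 2 : ℝ) ^ (1 / p) with ht
  have t0 : 0 < t := by positivity
  have t1 : t < 1 := Real.rpow_lt_one (by norm_num) (by norm_num) (by positivity)
  have t2 : 1 / 2 ≤ t := by
    have := Real.rpow_le_rpow_of_exponent_ge (x := 1 / 2) (by norm_num) (by norm_num) (by rw [div_le_one hp0]; linarith : 1 / p ≤ 1)
    rwa [Real.rpow_one] at this
  have lQ : Real.log Q < 0 := Real.log_neg Q0 (by linarith)
  set A := (2 : ℝ) ^ p * (2 * K) / V0 with hA
  have A0 : 0 < A := by positivity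
  set B := C + A ^ (1 / p) with hB
  have B0 : 0 < B := by positivity
  set L := (2 : ℝ) ^ p * (2 * K) * 2 ^ n / V0 with hL
  have L0 : 0 < L := by positivity
  set G := 2 * C + L ^ (1 / p) with hG
  have G0 : 0 < G := by positivity
  set α := Real.log t / Real.log Q with hα
  refine ⟨α, (G / t + 2 * B) * (1 / (ρ / 2)) ^ α + B, ⟨div_pos_of_neg_of_neg (Real.log_neg t0 t1) lQ, ?_⟩, by positivity, ?_⟩
  · rw [hα, div_lt_one_of_neg lQ]; exact Real.log_lt_log Q0 (by linarith)
  intro F Ω u hF ho hm hu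
  have cbk : ∀ x, ball x d ⊆ Ω → ∀ k, closedBall x (ρ * Q ^ k) ⊆ Ω := fun x hx k =>
    (closedBall_subset_ball ((mul_le_of_le_one_right ρ0.le (pow_le_one₀ Q0.le (by linarith))).trans_lt ρd)).trans hx
  have sup : ∀ x, ball x d ⊆ Ω → ‖∇ u x‖ ≤ B := by
    intro x hx
    obtain ⟨h1, ξ, hξ⟩ := hE F Ω u hF ho hm hu x hx
    have hc := cbk x hx 0
    have h2 := hC (fun x => ∇ u x) Ω x ρ hm.2.1 ρ0 (by simpa using hc) ξ hξ 0
    have h3 := hξ 0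
    rw [pow_zero, mul_one] at h2 h3 hc
    rw [pow_zero, mul_one] at h3
    have h4 := cmp2 (f := fun x => ∇ u x) (ζ := 0) hp hm.2.1 ρ0 hc hc subset_rfl subset_rfl h3 (by simpa only [sub_zero] using h1)
    rw [sub_zero, ← hn, ← hV0] at h4
    have h5 : ‖ξ 0‖ ^ p ≤ A * (1 / 2) ^ 0 := by
      rw [pow_zero, mul_one, hA, le_div_iff₀ V00]
      have : 0 < ρ ^ n := by positivity
      refine le_of_mul_le_mul_right ?_ this
      linarith
    have h6 := root hp (norm_nonneg _) A0.le 0 h5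
    rw [pow_zero, mul_one] at h6
    have h7 := norm_sub_norm_le (∇ u x) (ξ 0)
    rw [norm_sub_rev] at h7
    linarith
  intro x hx
  refine ⟨(sup x hx).trans (le_add_of_nonneg_left (by positivity)), fun y hy => ?_⟩
  rcases eq_or_ne x y with rfl | hxy
  · rw [sub_self, norm_zero]; positivity
  have s0 : 0 < ‖x - y‖ := norm_pos_iff.2 (sub_ne_zero.2 hxy)
  obtain ⟨-, ξ, hξ⟩ := hE F Ω u hF ho hm hu x hx
  obtain ⟨-, ζ, hζ⟩ := hE F Ω u hF ho hm hu y hy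
  have k1 := hC (fun x => ∇ u x) Ω x ρ hm.2.1 ρ0 (by simpa using cbk x hx 0) ξ hξ
  have k2 := hC (fun x => ∇ u x) Ω y ρ hm.2.1 ρ0 (by simpa using cbk y hy 0) ζ hζ
  have fin := hol (a := ‖∇ u x - ∇ u y‖) (B := 2 * B) (ρ := ρ / 2) t0 t1 Q0 (by linarith) (by positivity) (by positivity) G0.le s0
    ((norm_sub_le _ _).trans (by linarith [sup x hx, sup y hy])) (fun k hk => by
      have R0 : 0 < ρ * Q ^ k := by positivity
      set R := ρ * Q ^ k with hR
      have hk2 : ‖x - y‖ ≤ R / 2 := by rw [hR]; linarith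
      have s1 : ball y (R / 2) ⊆ ball x R := ball_subset_ball' (by rw [dist_comm, dist_eq_norm]; linarith)
      have h4 := cmp2 (f := fun x => ∇ u x) hp hm.2.1 (half_pos R0) (cbk x hx k) (cbk y hy k) s1 (ball_subset_ball (by linarith)) (hξ k) (hζ k)
      rw [← hn, ← hV0, ← hR] at h4
      have h5 : ‖ξ k - ζ k‖ ^ p ≤ L * (1 / 2) ^ k := by
        have : 0 < (R / 2) ^ n * V0 := by positivity
        refine le_of_mul_le_mul_right (h4.trans (le_of_eq ?_)) this
        have e : R ^ n = (R / 2) ^ n * 2 ^ n := by rw [← mul_pow]; congr 1; ring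
        rw [hL, e]; field_simp; ring
      have h6 := root hp (norm_nonneg _) L0.le k h5
      have a1 := k1 k
      have a2 := k2 k
      rw [norm_sub_rev] at a1
      have e : ∇ u x - ∇ u y = (∇ u x - ξ k) + (ξ k - ζ k) + (ζ k - ∇ u y) := by abel
      rw [e]
      refine (norm_add₃_le).trans ?_
      rw [hG]
      linarith)
  refine fin.trans ?_
  gcongr
  linarith
end fin
end AP

/-- Interior `C^{1,α}` estimate for local minimizers of the rescaled Alt–Phillips
functional `J_δ` in the degenerate regime `2 ≤ p < ∞`. -/
theorem stmt0 (N : ℕ) (hN : 1 ≤ N) (p γ lp lm δ₀ M d : ℝ)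
    (hp : 2 ≤ p) (hγ0 : 0 < γ) (hγp : γ < p) (hlp : 0 < lp) (hlm : 0 < lm)
    (hδ₀ : 0 < δ₀) (hM : 0 < M) (hd : 0 < d) :
    ∃ α C₁ : ℝ, α ∈ Set.Ioo (0 : ℝ) 1 ∧ 0 < C₁ ∧
      ∀ (Ω : Set (EuclideanSpace ℝ (Fin N))), IsOpen Ω → Bornology.IsBounded Ω →
      ∀ δ : ℝ, 0 ≤ δ → δ ≤ δ₀ →
      ∀ u : EuclideanSpace ℝ (Fin N) → ℝ,
        APLocMin N p (fun t => δ * Fgam γ lp lm t) Ω u →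
        (∀ x ∈ Ω, |u x| ≤ M) →
      ∀ Ω' : Set (EuclideanSpace ℝ (Fin N)), Ω' ⊆ Ω →
        (∀ x ∈ Ω', d ≤ Metric.infDist x (frontier Ω)) →
        (∀ x ∈ Ω', ‖gradient u x‖ ≤ C₁) ∧
        (∀ x ∈ Ω', ∀ y ∈ Ω',
          ‖gradient u x - gradient u y‖ ≤ C₁ * ‖x - y‖ ^ α) := by
  have : NeZero N := ⟨by omega⟩
  have : Nontrivial (EuclideanSpace ℝ (Fin N)) :=
    Module.nontrivial_of_finrank_pos (R := ℝ) (by rw [finrank_euclideanSpace_fin]; omega)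
  obtain ⟨CF, CM, hCF, hCM, hF⟩ := AP.fh_of hγ0 hlp hlm hδ₀ hM
  obtain ⟨α, C, hα, hC, H⟩ := AP.main (E := EuclideanSpace ℝ (Fin N)) hp hγ0 hγp (lt_min hγ0 one_pos) hCF hCM hM hd
  refine ⟨α, C, hα, hC, ?_⟩
  intro Ω ho _ δ h0 h1 u hu hb Ω' hsub hdist
  have hm : AP.Mn p (fun t => δ * Fgam γ lp lm t) Ω u := by
    refine ⟨hu.1, hu.2.1, fun z r hr hz v hv he => ?_⟩
    obtain ⟨K, hK⟩ := hv
    exact hu.2.2.2 z r hr (by rwa [closure_ball z hr.ne']) v K hK.lipschitzOnWith he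
  have key := H _ Ω u (hF δ h0 h1) ho hm hb
  have hbl : ∀ x ∈ Ω', ball x d ⊆ Ω := fun x hx => AP.ball_in (hsub hx) hd (hdist x hx)
  exact ⟨fun x hx => (key x (hbl x hx)).1, fun x hx y hy => (key x (hbl x hx)).2 y (hbl y hy)⟩
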